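/- Fix integers N ≥ 2, d ≥ 2 and m ≥ 1 with N > 2^d·(d−1), and let F ∈ ℤ[x₀,…,x_N] be homogeneous of degree d defining a smooth hypersurface, i.e. for every nonzero z ∈ ℂ^{N+1} with F(z) = 0 the gradient (∂F/∂x₀(z),…,∂F/∂x_N(z)) is nonzero. For each prime p let Ω_{p^m} be a nonempty subset of X̂(ℤ/p^mℤ), set ω_p = 1 − #Ω_{p^m}/#X̂(ℤ/p^mℤ), and set G(Q) = ∑_{q ≤ Q, q squarefree} ∏_{p ∣ q} ω_p/(1−ω_p). Then there exist δ₁ > 0, δ₂ > 0 and C > 0 such that for all B ≥ 2, the number of primitive vectors x ∈ ℤ^{N+1} with F(x) = 0, ‖x‖∞^{N+1−d} ≤ B, and whose reduction modulo p^m lies in Ω_{p^m} for every prime p, is at most C·B / min(G(B^{δ₁}), B^{δ₂}). -/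

import Mathlib

noncomputable section
open MvPolynomial
open scoped Classical

/-- A vector of integers is primitive if the gcd of its coordinates is `1`. -/
def IsPrimitiveVec {k : ℕ} (x : Fin k → ℤ) : Prop := Finset.gcd Finset.univ x = 1

/-- The sup-norm `max_i |x_i|` of an integer vector. -/
def supNorm {k : ℕ} (x : Fin k → ℤ) : ℕ := Finset.univ.sup fun i => (x i).natAbs

/-- `X̂(ℤ/p^kℤ)`: the points of `(ℤ/p^kℤ)^{N+1}` whose reduction mod `p` is nonzero and
which satisfy `F = 0` in `ℤ/p^kℤ`. -/
def Xhat (N : ℕ) (F : MvPolynomial (Fin (N + 1)) ℤ) (p k : ℕ) :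
    Set (Fin (N + 1) → ZMod (p ^ k)) :=
  {x | (∃ i, ¬ (p ∣ (x i).val)) ∧
    eval x (MvPolynomial.map (Int.castRingHom (ZMod (p ^ k))) F) = 0}

/-- degree `< k` -/
def DLT {R : Type*} [CommRing R] {n : ℕ} (k : ℕ) (p : MvPolynomial (Fin n) R) : Prop :=
  ∀ s ∈ p.support, s.degree < k

section dlt
variable {R : Type*} [CommRing R] {n : ℕ}

lemma DLT.zero (k : ℕ) : DLT k (0 : MvPolynomial (Fin n) R) := by
  intro s hs; simp at hs

lemma DLT.mono {k l : ℕ} (h : k ≤ l) {p : MvPolynomial (Fin n) R} (hp : DLT k p) : DLT l p :=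
  fun s hs => (hp s hs).trans_le h

lemma DLT.add {k : ℕ} {p q : MvPolynomial (Fin n) R} (hp : DLT k p) (hq : DLT k q) :
    DLT k (p + q) := by
  intro s hs
  rcases Finset.mem_union.1 (MvPolynomial.support_add hs) with h | h
  · exact hp s h
  · exact hq s h

lemma DLT.neg {k : ℕ} {p : MvPolynomial (Fin n) R} (hp : DLT k p) : DLT k (-p) := by
  intro s hs; rw [MvPolynomial.support_neg] at hs; exact hp s hs

lemma DLT.sub {k : ℕ} {p q : MvPolynomial (Fin n) R} (hp : DLT k p) (hq : DLT k q) :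
    DLT k (p - q) := by
  rw [sub_eq_add_neg]; exact hp.add hq.neg

lemma DLT.sum {k : ℕ} {ι : Type*} (t : Finset ι) (p : ι → MvPolynomial (Fin n) R)
    (hp : ∀ i ∈ t, DLT k (p i)) : DLT k (∑ i ∈ t, p i) := by
  induction t using Finset.induction_on with
  | empty => simpa using DLT.zero k
  | insert a t ha ih =>
    rw [Finset.sum_insert ha]
    exact (hp a (by simp)).add (ih fun i hi => hp i (by simp [hi]))

lemma DLT.mul {a b : ℕ} {p q : MvPolynomial (Fin n) R} (hp : DLT (a + 1) p) (hq : DLT b q) :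
    DLT (a + b) (p * q) := by
  intro s hs
  obtain ⟨u, hu, v, hv, rfl⟩ := Finset.mem_add.1 (MvPolynomial.support_mul p q hs)
  have h1 := hp u hu
  have h2 := hq v hv
  rw [map_add]; omega

lemma DLT.of_hom {k : ℕ} {p : MvPolynomial (Fin n) R} (hp : p.IsHomogeneous k) :
    DLT (k + 1) p := by
  intro s hs
  have := hp.degree_eq_sum_deg_support hs
  have h2 : s.degree = ∑ i ∈ s.support, s i := rfl
  omega

lemma DLT.C (a : R) : DLT 1 (C a : MvPolynomial (Fin n) R) := DLT.of_hom (isHomogeneous_C _ _)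

lemma DLT.X (i : Fin n) : DLT 2 (X i : MvPolynomial (Fin n) R) := DLT.of_hom (isHomogeneous_X _ _)

lemma DLT.pderiv {k : ℕ} {p : MvPolynomial (Fin n) R} (hp : DLT (k + 1) p) (i : Fin n) :
    DLT k (pderiv i p) := by
  intro s hs
  rw [mem_support_iff, coeff_pderiv] at hs
  have : s + Finsupp.single i 1 ∈ p.support := by
    rw [mem_support_iff]; intro h; apply hs; rw [h]; simp
  have := hp _ this
  rw [map_add] at this
  simp at this
  exact this

lemma DLT.eq_zero {p : MvPolynomial (Fin n) R} (hp : DLT 0 p) : p = 0 := by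
  rw [← MvPolynomial.support_eq_empty]
  apply Finset.eq_empty_of_forall_notMem
  intro s hs; exact absurd (hp s hs) (Nat.not_lt_zero _)

lemma pderiv_comm' (i j : Fin n) (p : MvPolynomial (Fin n) R) :
    pderiv i (pderiv j p) = pderiv j (pderiv i p) := by
  ext s
  simp only [coeff_pderiv]
  by_cases h : i = j
  · subst h; rfl
  · rw [add_right_comm]
    have h' : j ≠ i := fun e => h e.symm
    simp [Finsupp.single_apply, h, h']
    ring

/-- Taylor expansion. -/
lemma taylor (h : Fin n → R) (k : ℕ) (p : MvPolynomial (Fin n) R) (hp : DLT (k + 2) p) :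
    ∃ r : MvPolynomial (Fin n) R, DLT k r ∧ ∀ x : Fin n → R,
      eval (x + h) p = eval x p + ∑ i, h i * eval x (pderiv i p) + eval x r := by
  have key : ∀ (m : ℕ) (s : Fin n →₀ ℕ), s.degree = m → ∀ a : R,
      ∃ r : MvPolynomial (Fin n) R, DLT (m - 1) r ∧ ∀ x : Fin n → R,
      eval (x + h) (monomial s a) = eval x (monomial s a) +
        ∑ i, h i * eval x (MvPolynomial.pderiv i (monomial s a)) + eval x r := by
    intro m
    induction m with
    | zero =>
      intro s hs a
      have : s = 0 := (Finsupp.degree_eq_zero_iff s).1 hs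
      subst this
      refine ⟨0, DLT.zero _, ?_⟩
      intro x
      have : (monomial 0 a : MvPolynomial (Fin n) R) = MvPolynomial.C a := rfl
      rw [this]; simp
    | succ m ih =>
      intro s hs a
      have hne : s ≠ 0 := by rintro rfl; simp at hs
      obtain ⟨j, hj⟩ := Finsupp.ne_iff.1 hne
      have hj' : Finsupp.single j 1 ≤ s := by
        rw [Finsupp.single_le_iff]; exact Nat.one_le_iff_ne_zero.2 hj
      obtain ⟨s', hs'⟩ := exists_add_of_le hj'
      have hdeg : s'.degree = m := by
        rw [hs', map_add] at hs; simp at hs; omega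
      obtain ⟨r, hr, hx⟩ := ih s' hdeg a
      have hmon : (monomial s a : MvPolynomial (Fin n) R)
          = MvPolynomial.X j * monomial s' a := by
        rw [hs', MvPolynomial.X, monomial_mul, one_mul]
      set q := (monomial s' a : MvPolynomial (Fin n) R) with hq
      have hqd : DLT (m + 1) q := DLT.of_hom (isHomogeneous_monomial _ hdeg)
      refine ⟨MvPolynomial.X j * r + MvPolynomial.C (h j) *
        ((∑ i, MvPolynomial.C (h i) * MvPolynomial.pderiv i q) + r), ?_, ?_⟩
      · have e1 : DLT m (MvPolynomial.X j * r) := by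
          rcases m with _ | m
          · have : r = 0 := DLT.eq_zero (by simpa using hr)
            rw [this, mul_zero]; exact DLT.zero _
          · have := (DLT.X (R := R) j).mul hr
            refine this.mono ?_
            omega
        refine DLT.add e1 ?_
        have : DLT (0 + m) (MvPolynomial.C (h j) *
          ((∑ i, MvPolynomial.C (h i) * MvPolynomial.pderiv i q) + r)) := by
          refine (DLT.C (h j)).mul (DLT.add (DLT.sum _ _ fun i _ => ?_) (hr.mono (by omega)))
          have := (DLT.C (h i)).mul (hqd.pderiv i)
          simpa using this
        simpa using this
      · intro x
        rw [hmon]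
        simp only [map_mul, map_add, eval_X, map_sum, eval_C, pderiv_mul, pderiv_X, Pi.add_apply]
        rw [hx x]
        have : ∑ i, h i * (eval x (Pi.single (M := fun _ => MvPolynomial (Fin n) R) i 1 j) * eval x q
            + x j * eval x (MvPolynomial.pderiv i q))
            = h j * eval x q + x j * ∑ i, h i * eval x (MvPolynomial.pderiv i q) := by
          simp only [mul_add, Finset.sum_add_distrib, Finset.mul_sum]
          congr 1
          · rw [Finset.sum_eq_single j]
            · simp
            · intro b _ hb
              simp [Pi.single_apply, hb.symm]
            · simp
          · exact Finset.sum_congr rfl fun i _ => by ring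
        rw [this]
        ring
  choose! r hr1 hr2 using fun s : Fin n →₀ ℕ => key s.degree s rfl
  refine ⟨∑ s ∈ p.support, r s (coeff s p), DLT.sum _ _ fun s hs => ?_, fun x => ?_⟩
  · exact (hr1 s _).mono (by have := hp s hs; omega)
  · have e1 : ∀ y, eval y p = ∑ s ∈ p.support, eval y (monomial s (coeff s p)) := by
      intro y
      conv_lhs => rw [p.as_sum]
      rw [map_sum]
    have e2 : ∀ i, eval x (MvPolynomial.pderiv i p) =
        ∑ s ∈ p.support, eval x (MvPolynomial.pderiv i (monomial s (coeff s p))) := by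
      intro i
      conv_lhs => rw [p.as_sum]
      rw [map_sum, map_sum]
    rw [e1, e1, Finset.sum_congr rfl fun s _ => hr2 s (coeff s p) x]
    simp only [e2, Finset.sum_add_distrib, Finset.mul_sum, map_sum]
    rw [Finset.sum_comm]

end dlt

/-- polarization -/
def Phi {n : ℕ} : List (Fin n → ℤ) → MvPolynomial (Fin n) ℤ → ℤ
  | [], p => eval 0 p
  | h :: l, p => ∑ j, h j * Phi l (pderiv j p)

/-- iterated differences -/
def dd {A B : Type*} [AddCommGroup A] [AddCommGroup B] : List A → (A → B) → A → B
  | [], f => f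
  | h :: l, f => dd l (fun x => f (x + h) - f x)

section phi
variable {n : ℕ}

lemma Phi_add (l : List (Fin n → ℤ)) (p q : MvPolynomial (Fin n) ℤ) :
    Phi l (p + q) = Phi l p + Phi l q := by
  induction l generalizing p q with
  | nil => simp [Phi]
  | cons h l ih => simp [Phi, ih, mul_add, Finset.sum_add_distrib]

lemma Phi_C_mul (l : List (Fin n → ℤ)) (c : ℤ) (p : MvPolynomial (Fin n) ℤ) :
    Phi l (C c * p) = c * Phi l p := by
  induction l generalizing p with
  | nil => simp [Phi]
  | cons h l ih =>
    simp only [Phi, pderiv_C_mul, ih, Finset.mul_sum]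
    exact Finset.sum_congr rfl fun _ _ => by ring

lemma Phi_zero (l : List (Fin n → ℤ)) : Phi l 0 = 0 := by
  have := Phi_C_mul l 0 0
  simpa using this

lemma Phi_sum {ι : Type*} (t : Finset ι) (l : List (Fin n → ℤ)) (p : ι → MvPolynomial (Fin n) ℤ) :
    Phi l (∑ i ∈ t, p i) = ∑ i ∈ t, Phi l (p i) := by
  induction t using Finset.induction_on with
  | empty => simp [Phi_zero]
  | insert a t ha ih => rw [Finset.sum_insert ha, Finset.sum_insert ha, Phi_add, ih]

lemma Phi_mid (l₁ l₂ : List (Fin n → ℤ)) (u : Fin n → ℤ) (p : MvPolynomial (Fin n) ℤ) :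
    Phi (l₁ ++ u :: l₂) p = ∑ j, u j * Phi (l₁ ++ l₂) (pderiv j p) := by
  induction l₁ generalizing p with
  | nil => rfl
  | cons h l ih =>
    simp only [List.cons_append, Phi, ih, Finset.mul_sum]
    rw [Finset.sum_comm]
    refine Finset.sum_congr rfl fun i _ => Finset.sum_congr rfl fun j _ => ?_
    rw [pderiv_comm']; ring

lemma Phi_DLT (l : List (Fin n → ℤ)) (p : MvPolynomial (Fin n) ℤ) (hp : DLT l.length p) :
    Phi l p = 0 := by
  induction l generalizing p with
  | nil => rw [DLT.eq_zero hp, Phi_zero]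
  | cons h l ih =>
    simp only [Phi]
    exact Finset.sum_eq_zero fun j _ => by rw [ih _ (DLT.pderiv hp j), mul_zero]

lemma dd_poly (l : List (Fin n → ℤ)) (p : MvPolynomial (Fin n) ℤ) (hp : DLT (l.length + 2) p) :
    ∃ c : ℤ, ∀ x : Fin n → ℤ,
      dd l (fun x => eval x p) x = c + ∑ j, x j * Phi l (pderiv j p) := by
  induction l generalizing p with
  | nil =>
    refine ⟨eval 0 p, fun x => ?_⟩
    obtain ⟨r, hr, hx⟩ := taylor x 0 p hp
    have := hx 0
    rw [DLT.eq_zero hr] at this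
    simpa [dd, Phi] using this
  | cons h l ih =>
    obtain ⟨r, hr, hx⟩ := taylor h _ p hp
    have e : (fun x => eval (x + h) p - eval x p) =
        fun x => eval x ((∑ i, C (h i) * pderiv i p) + r) := by
      funext x
      rw [hx x]; simp; ring
    have hd : DLT (l.length + 2) ((∑ i, C (h i) * pderiv i p) + r) := by
      refine DLT.add (DLT.sum _ _ fun i _ => ?_) (hr.mono (by simp))
      have := (DLT.C (h i)).mul (DLT.pderiv (k := l.length + 2) hp i)
      simpa using this
    obtain ⟨c, hc⟩ := ih _ hd
    refine ⟨c, fun x => ?_⟩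
    simp only [dd]
    rw [e, hc x]
    congr 1
    refine Finset.sum_congr rfl fun j _ => ?_
    congr 1
    rw [map_add, Phi_add, Phi_DLT l (pderiv j r) (DLT.pderiv (k := l.length) hr j), add_zero, map_sum, Phi_sum]
    simp only [Phi, pderiv_C_mul, Phi_C_mul]
    exact Finset.sum_congr rfl fun i _ => by rw [pderiv_comm']

lemma dd_affine {A : Type*} [AddCommGroup A] (l : List A) (f : A → ℤ) (a : A) (M : ℕ) (x : A) :
    dd l (fun x => f (a + M • x)) x = dd (l.map fun h => M • h) f (a + M • x) := by
  induction l generalizing f with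
  | nil => rfl
  | cons h l ih =>
    simp only [dd, List.map_cons]
    rw [← ih]
    congr 1
    funext x
    rw [smul_add, add_assoc]

lemma Phi_smul (l : List (Fin n → ℤ)) (M : ℕ) (p : MvPolynomial (Fin n) ℤ) :
    Phi (l.map fun h => M • h) p = (M : ℤ) ^ l.length * Phi l p := by
  induction l generalizing p with
  | nil => simp [Phi]
  | cons h l ih =>
    simp only [List.map_cons, Phi, ih, Finset.mul_sum, List.length_cons]
    refine Finset.sum_congr rfl fun i _ => ?_
    simp [pow_succ]; ring

/-- Weyl phase: differences of `x ↦ F(a + M x)`. -/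
lemma dd_phase (l : List (Fin n → ℤ)) (p : MvPolynomial (Fin n) ℤ) (hp : DLT (l.length + 2) p)
    (a : Fin n → ℤ) (M : ℕ) : ∃ c : ℤ, ∀ x : Fin n → ℤ,
      dd l (fun x => eval (a + M • x) p) x =
        c + (M : ℤ) ^ (l.length + 1) * ∑ j, x j * Phi l (pderiv j p) := by
  obtain ⟨c, hc⟩ := dd_poly (l.map fun h => M • h) p (by simpa using hp)
  refine ⟨c + ∑ j, a j * Phi (l.map fun h => M • h) (pderiv j p), fun x => ?_⟩
  rw [dd_affine l (fun x => eval x p) a M x, hc]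
  simp only [Phi_smul, Pi.add_apply, add_mul, Finset.sum_add_distrib, Finset.mul_sum, add_assoc]
  congr 2
  refine Finset.sum_congr rfl fun i _ => ?_
  simp; ring

lemma dd_shift {A B : Type*} [AddCommGroup A] [AddCommGroup B] (l : List A) (f : A → B) (z x : A) :
    dd l (fun x => f (x + z)) x = dd l f (x + z) := by
  induction l generalizing f with
  | nil => rfl
  | cons h l ih =>
    simp only [dd]
    rw [← ih]
    congr 1
    funext x
    rw [add_right_comm]

/-- bound for `Phi`. -/
lemma Phi_bound (k : ℕ) (p : MvPolynomial (Fin n) ℤ) : ∃ C : ℝ, 1 ≤ C ∧ ∀ (l : List (Fin n → ℤ)) (R : ℝ),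
    l.length = k → 0 ≤ R → (∀ h ∈ l, ∀ i, |(h i : ℝ)| ≤ R) → |(Phi l p : ℝ)| ≤ C * R ^ k := by
  induction k generalizing p with
  | zero =>
    refine ⟨|((eval 0 p : ℤ) : ℝ)| + 1, by linarith [abs_nonneg ((eval 0 p : ℤ) : ℝ)], ?_⟩
    intro l R hl hR _
    rw [List.length_eq_zero_iff] at hl
    subst hl
    simp [Phi]
  | succ k ih =>
    choose C hC1 hC using fun j => ih (pderiv j p)
    refine ⟨1 + ∑ j, C j, ?_, ?_⟩
    · have : 0 ≤ ∑ j, C j := Finset.sum_nonneg fun j _ => by linarith [hC1 j]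
      linarith
    · intro l R hl hR h
      rcases l with _ | ⟨u, l⟩
      · simp at hl
      · simp only [Phi]
        push_cast
        have hp : 0 ≤ R ^ (k + 1) := by positivity
        calc |∑ j, (u j : ℝ) * (Phi l (pderiv j p) : ℝ)|
            ≤ ∑ j, |(u j : ℝ) * (Phi l (pderiv j p) : ℝ)| := Finset.abs_sum_le_sum_abs _ _
          _ ≤ ∑ j, C j * R ^ (k + 1) := by
              refine Finset.sum_le_sum fun j _ => ?_
              rw [abs_mul, pow_succ]
              have h1 := h u (by simp) j
              have h2 := hC j l R (by simpa using hl) hR (fun h' hh => h h' (by simp [hh]))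
              calc _ ≤ R * (C j * R ^ k) := mul_le_mul h1 h2 (abs_nonneg _) hR
                _ = _ := by ring
          _ ≤ _ := by rw [← Finset.sum_mul]; nlinarith

/-- Lipschitz type bounds for evaluation -/
lemma eval_bound (p : MvPolynomial (Fin n) ℤ) (k : ℕ) (hp : DLT (k + 1) p) : ∃ C : ℝ, 1 ≤ C ∧
    ∀ (x : Fin n → ℤ) (R : ℝ), 1 ≤ R → (∀ i, |(x i : ℝ)| ≤ R) → |((eval x p : ℤ) : ℝ)| ≤ C * R ^ k := by
  refine ⟨1 + ∑ s ∈ p.support, |((coeff s p : ℤ) : ℝ)|, ?_, ?_⟩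
  · have : 0 ≤ ∑ s ∈ p.support, |((coeff s p : ℤ) : ℝ)| := Finset.sum_nonneg fun j _ => abs_nonneg _
    linarith
  · intro x R hR hx
    rw [eval_eq]
    push_cast
    have hp0 : 0 ≤ R ^ k := by positivity
    calc _ ≤ ∑ s ∈ p.support, |((coeff s p : ℤ) : ℝ) * ∏ i ∈ s.support, (x i : ℝ) ^ s i| :=
          Finset.abs_sum_le_sum_abs _ _
      _ ≤ ∑ s ∈ p.support, |((coeff s p : ℤ) : ℝ)| * R ^ k := by
          refine Finset.sum_le_sum fun s hs => ?_
          rw [abs_mul, Finset.abs_prod]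
          refine mul_le_mul_of_nonneg_left ?_ (abs_nonneg _)
          calc ∏ i ∈ s.support, |(x i : ℝ) ^ s i| ≤ ∏ i ∈ s.support, R ^ s i := by
                refine Finset.prod_le_prod (fun _ _ => abs_nonneg _) fun i _ => ?_
                rw [abs_pow]; exact pow_le_pow_left₀ (abs_nonneg _) (hx i) _
            _ = R ^ s.degree := by rw [Finset.prod_pow_eq_pow_sum]; rfl
            _ ≤ R ^ k := pow_le_pow_right₀ hR (Nat.lt_succ_iff.1 (hp s hs))
      _ ≤ _ := by rw [← Finset.sum_mul]; nlinarith

end phi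

section nullst
variable {n : ℕ}

/-- smoothness over ℂ -/
def SmoothF (F : MvPolynomial (Fin n) ℤ) : Prop := ∀ z : Fin n → ℂ, z ≠ 0 →
      eval z (MvPolynomial.map (Int.castRingHom ℂ) F) = 0 →
      ∃ i, eval z (pderiv i (MvPolynomial.map (Int.castRingHom ℂ) F)) ≠ 0

lemma clear_denom (p : MvPolynomial (Fin n) ℚ) : ∃ D : ℕ, D ≠ 0 ∧ ∃ p' : MvPolynomial (Fin n) ℤ,
    MvPolynomial.map (Int.castRingHom ℚ) p' = C (D : ℚ) * p := by
  induction p using MvPolynomial.induction_on with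
  | C a =>
    refine ⟨a.den, a.den_nz, C a.num, ?_⟩
    rw [map_C, ← map_mul]
    congr 1
    rw [mul_comm]; simp
  | add p q hp hq =>
    obtain ⟨D, hD, p', hp'⟩ := hp
    obtain ⟨E, hE, q', hq'⟩ := hq
    refine ⟨D * E, mul_ne_zero hD hE, C (E : ℤ) * p' + C (D : ℤ) * q', ?_⟩
    simp only [map_add, map_mul, hp', hq', map_C, Nat.cast_mul]
    simp
    ring
  | mul_X p i hp =>
    obtain ⟨D, hD, p', hp'⟩ := hp
    refine ⟨D, hD, p' * X i, ?_⟩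
    rw [map_mul, hp', map_X]; ring

lemma null_pow (d : ℕ) (hd : 1 ≤ d) (F : MvPolynomial (Fin n) ℤ) (hF : F.IsHomogeneous d)
    (hs : SmoothF F) (j : Fin n) : ∃ k : ℕ, ∃ D : ℕ, D ≠ 0 ∧ ∃ a : Fin n → MvPolynomial (Fin n) ℤ,
      C (D : ℤ) * X j ^ k = ∑ i, a i * pderiv i F := by
  set Fq := MvPolynomial.map (Int.castRingHom ℚ) F with hFq
  set I : Ideal (MvPolynomial (Fin n) ℚ) := Ideal.span (Set.range fun i => pderiv i Fq) with hI
  have h1 : X j ∈ I.radical := by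
    rw [← vanishingIdeal_zeroLocus_eq_radical (K := ℂ), mem_vanishingIdeal_iff]
    intro z hz
    rw [mem_zeroLocus_iff] at hz
    have hz' : ∀ i, eval z (pderiv i (MvPolynomial.map (Int.castRingHom ℂ) F)) = 0 := by
      intro i
      have := hz (pderiv i Fq) (Ideal.subset_span ⟨i, rfl⟩)
      rw [hFq, pderiv_map, aeval_def, eval₂_map] at this
      rw [pderiv_map, eval_map]
      rw [← this]
      congr 1
    have hz0 : z = 0 := by
      by_contra hne
      have he := (hF.map (Int.castRingHom ℂ)).sum_X_mul_pderiv
      have he2 := congrArg (eval z) he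
      simp only [map_sum, map_mul, eval_X, hz', mul_zero, Finset.sum_const_zero, map_nsmul] at he2
      have h0 : eval z (MvPolynomial.map (Int.castRingHom ℂ) F) = 0 := by
        have := he2.symm
        rw [smul_eq_zero] at this
        rcases this with h | h
        · omega
        · exact h
      obtain ⟨i, hi⟩ := hs z hne h0
      exact hi (hz' i)
    rw [hz0]; simp
  obtain ⟨k, hk⟩ := h1
  rw [hI, Ideal.mem_span_range_iff_exists_fun] at hk
  obtain ⟨c, hc⟩ := hk
  choose D hD c' hc' using fun i => clear_denom (c i)
  refine ⟨k, ∏ i, D i, Finset.prod_ne_zero_iff.2 fun i _ => hD i,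
    fun i => C (((∏ i' ∈ Finset.univ.erase i, D i' : ℕ) : ℤ)) * c' i, ?_⟩
  apply MvPolynomial.map_injective (Int.castRingHom ℚ) Int.cast_injective
  simp only [map_mul, map_sum, map_C, map_pow, map_X, ← pderiv_map]
  rw [← hc, Finset.mul_sum]
  refine Finset.sum_congr rfl fun i _ => ?_
  rw [hc' i]
  have : ((∏ i, D i : ℕ) : ℚ) = ((∏ i' ∈ Finset.univ.erase i, D i' : ℕ) : ℚ) * D i := by
    rw [← Nat.cast_mul, Finset.prod_erase_mul _ _ (Finset.mem_univ i)]
  have e2 : (Int.castRingHom ℚ) ((∏ i, D i : ℕ) : ℤ) = ((∏ i, D i : ℕ) : ℚ) := by simp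
  have e3 : (Int.castRingHom ℚ) ((∏ i' ∈ Finset.univ.erase i, D i' : ℕ) : ℤ) =
    ((∏ i' ∈ Finset.univ.erase i, D i' : ℕ) : ℚ) := by simp
  rw [e2, e3, this, map_mul]
  ring

/-- homogeneous form, uniform in `j` -/
lemma null_hom (d : ℕ) (hd : 1 ≤ d) (F : MvPolynomial (Fin n) ℤ) (hF : F.IsHomogeneous d)
    (hs : SmoothF F) : ∃ k : ℕ, ∃ D : ℕ, D ≠ 0 ∧ ∀ j, ∃ a : Fin n → MvPolynomial (Fin n) ℤ,
      (∀ i, (a i).IsHomogeneous k) ∧ C (D : ℤ) * X j ^ (k + (d - 1)) = ∑ i, a i * pderiv i F := by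
  choose k D hD a ha using null_pow d hd F hF hs
  have hpd : ∀ i, (pderiv i F).IsHomogeneous (d - 1) := fun i => hF.pderiv
  refine ⟨∑ j, k j, ∏ j, D j, Finset.prod_ne_zero_iff.2 fun i _ => hD i, fun j => ?_⟩
  set kk := ∑ j, k j with hkk
  set E := ∏ j' ∈ Finset.univ.erase j, D j' with hE
  have hkle : k j ≤ kk := Finset.single_le_sum (f := k) (fun _ _ => Nat.zero_le _) (Finset.mem_univ j)
  have h1 : C ((∏ j, D j : ℕ) : ℤ) * X j ^ (kk + (d - 1)) =
      ∑ i, (C (E : ℤ) * X j ^ (kk + (d - 1) - k j) * a j i) * pderiv i F := by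
    have : (∏ j, D j : ℕ) = E * D j := by
      rw [hE, Finset.prod_erase_mul _ _ (Finset.mem_univ j)]
    rw [this]
    simp only [mul_assoc]
    rw [← Finset.mul_sum, ← Finset.mul_sum, ← ha j]
    push_cast
    rw [map_mul]
    have : (X j : MvPolynomial (Fin n) ℤ) ^ (kk + (d - 1)) =
      X j ^ (kk + (d - 1) - k j) * X j ^ k j := by rw [← pow_add]; congr 1; omega
    rw [this]; ring
  set b := fun i => C (E : ℤ) * X j ^ (kk + (d - 1) - k j) * a j i with hb
  refine ⟨fun i => homogeneousComponent kk (b i), fun i => homogeneousComponent_isHomogeneous _ _, ?_⟩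
  have h2 := congrArg (homogeneousComponent (kk + (d - 1))) h1
  rw [homogeneousComponent_C_mul, homogeneousComponent_eq_self (isHomogeneous_X_pow _ _), map_sum] at h2
  rw [h2]
  refine Finset.sum_congr rfl fun i _ => ?_
  change homogeneousComponent (kk + (d - 1)) (b i * pderiv i F) = _
  conv_lhs => rw [← sum_homogeneousComponent (b i), Finset.sum_mul, map_sum]
  have h3 : ∀ m, homogeneousComponent (kk + (d - 1)) (homogeneousComponent m (b i) * pderiv i F) =
      if m = kk then homogeneousComponent m (b i) * pderiv i F else 0 := by
    intro m
    have hm := (homogeneousComponent_isHomogeneous m (b i)).mul (hpd i)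
    rw [homogeneousComponent_of_mem ((mem_homogeneousSubmodule _ _).2 hm)]
    by_cases h : m = kk
    · simp [h]
    · rw [if_neg h, if_neg (by omega)]
  simp only [h3]
  rw [Finset.sum_ite_eq']
  split_ifs with h
  · rfl
  · rw [homogeneousComponent_eq_zero]
    · simp
    · simp at h; omega

/-- good primes -/
lemma good_primes (d : ℕ) (hd : 1 ≤ d) (F : MvPolynomial (Fin n) ℤ) (hF : F.IsHomogeneous d)
    (hs : SmoothF F) : ∃ D : ℕ, D ≠ 0 ∧ ∀ p : ℕ, p.Prime → ¬ p ∣ D → ∀ x : Fin n → ℤ,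
      (∃ i, ¬ (p : ℤ) ∣ x i) → ∃ i, ¬ (p : ℤ) ∣ eval x (pderiv i F) := by
  obtain ⟨k, D, hD, h⟩ := null_hom d hd F hF hs
  refine ⟨D, hD, fun p hp hpD x ⟨j, hj⟩ => ?_⟩
  by_contra! hall
  obtain ⟨a, -, ha⟩ := h j
  have h1 := congrArg (eval x) ha
  simp only [map_mul, eval_C, map_pow, eval_X, map_sum] at h1
  have h2 : (p : ℤ) ∣ (D : ℤ) * x j ^ (k + (d - 1)) := by
    rw [h1]; exact Finset.dvd_sum fun i _ => (hall i).mul_left _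
  have hp' : Prime (p : ℤ) := Nat.prime_iff_prime_int.1 hp
  rcases hp'.dvd_or_dvd h2 with h3 | h3
  · exact hpD (by exact_mod_cast h3)
  · exact hj (hp'.dvd_of_dvd_pow h3)

end nullst

section fiber
variable {n : ℕ}

/-- the polynomial `x ↦ Phi (x + s) G` -/
def PPoly : List (Fin n → ℤ) → MvPolynomial (Fin n) ℤ → MvPolynomial (Fin n) ℤ
  | [], p => C (eval 0 p)
  | s :: l, p => ∑ j, (X j + C (s j)) * PPoly l (pderiv j p)

lemma eval_PPoly (l : List (Fin n → ℤ)) (p : MvPolynomial (Fin n) ℤ) (x : Fin n → ℤ) :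
    eval x (PPoly l p) = Phi (l.map fun s => x + s) p := by
  induction l generalizing p with
  | nil => simp [PPoly, Phi]
  | cons s l ih => simp [PPoly, Phi, ih]

lemma PPoly_lead (l : List (Fin n → ℤ)) (p : MvPolynomial (Fin n) ℤ)
    (hp : p.IsHomogeneous l.length) : ∃ r, DLT l.length r ∧
      PPoly l p = C (l.length.factorial : ℤ) * p + r := by
  induction l generalizing p with
  | nil =>
    refine ⟨0, DLT.zero _, ?_⟩
    have h1 := homogeneousComponent_eq_self hp
    simp only [List.length_nil] at h1
    rw [homogeneousComponent_zero] at h1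
    simp only [PPoly, List.length_nil, Nat.factorial_zero, Nat.cast_one, map_one, one_mul, add_zero]
    rw [← h1]; simp
  | cons s l ih =>
    have hpd : ∀ i, (pderiv i p).IsHomogeneous l.length := fun i => by
      have := hp.pderiv (i := i); simpa using this
    choose r hr hr2 using fun j => ih (pderiv j p) (hpd j)
    refine ⟨∑ j, (X j * r j + C (s j) * (C (l.length.factorial : ℤ) * pderiv j p + r j)), ?_, ?_⟩
    · refine DLT.sum _ _ fun j _ => DLT.add ?_ ?_
      · have := (DLT.X (R := ℤ) j).mul (hr j)
        refine this.mono (by simp; omega)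
      · have : DLT (0 + (l.length + 1)) (C (s j) * (C (l.length.factorial : ℤ) * pderiv j p + r j)) := by
          refine (DLT.C _).mul (DLT.add ?_ ((hr j).mono (by omega)))
          have := (DLT.C (l.length.factorial : ℤ)).mul (DLT.of_hom (hpd j))
          simpa using this
        simpa using this
    · simp only [PPoly, hr2]
      have he := hp.sum_X_mul_pderiv
      have hfac : (((s :: l).length.factorial : ℕ) : ℤ) = (l.length.factorial : ℤ) * ((s :: l).length : ℤ) := by
        simp [Nat.factorial_succ]; ring
      rw [hfac, map_mul, mul_assoc]
      have : (C ((s :: l).length : ℤ) : MvPolynomial (Fin n) ℤ) * p = (s :: l).length • p := by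
        rw [nsmul_eq_mul]; simp
      rw [this, ← he, Finset.mul_sum, ← Finset.sum_add_distrib]
      exact Finset.sum_congr rfl fun j _ => by ring

/-- finiteness of the set of exponents of small degree -/
lemma finite_deg (n D0 : ℕ) : {s : Fin n →₀ ℕ | s.degree < D0}.Finite := by
  have : {s : Fin n →₀ ℕ | s.degree < D0} ⊆
      Set.Iic (Finsupp.equivFunOnFinite.symm (fun _ : Fin n => D0)) := by
    intro s hs i
    have : s i ≤ s.degree := Finsupp.le_degree i s
    have h : s.degree < D0 := hs
    simp; omega
  exact (Set.finite_Iic _).subset this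

lemma fiber_bound (hn : 0 < n) (d : ℕ) (hd : 1 ≤ d) (F : MvPolynomial (Fin n) ℤ) (hF : F.IsHomogeneous d)
    (hs : SmoothF F) : ∃ C0 : ℕ, ∀ (l : List (Fin n → ℤ)), l.length = d - 1 →
      ∀ S : Finset (Fin n → ℤ),
      (∀ x ∈ S, ∀ i, Phi (l.map fun s => x + s) (pderiv i F) = 0) → S.card ≤ C0 := by
  haveI : Nonempty (Fin n) := ⟨⟨0, hn⟩⟩
  obtain ⟨k, D, hD, hnull⟩ := null_hom d hd F hF hs
  choose a ha1 ha2 using hnull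
  have hpd : ∀ i, (pderiv i F).IsHomogeneous (d - 1) := fun i => hF.pderiv
  set K := k + (d - 1) with hK
  set D0 := n * K + 1 with hD0
  set ms := (finite_deg n D0).toFinset with hms
  refine ⟨ms.card, fun l hl S hS => ?_⟩
  let ev : MvPolynomial (Fin n) ℤ → (S → ℚ) := fun p x => ((eval x.1 p : ℤ) : ℚ)
  have ev_add : ∀ p q, ev (p + q) = ev p + ev q := fun p q => by ext x; simp [ev]
  have ev_mul : ∀ p q, ev (p * q) = ev p * ev q := fun p q => by ext x; simp [ev]
  have ev_sum : ∀ {ι : Type} (t : Finset ι) (p : ι → MvPolynomial (Fin n) ℤ),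
      ev (∑ i ∈ t, p i) = ∑ i ∈ t, ev (p i) := fun t p => by
    ext x; simp [ev]
  have ev_C : ∀ (c : ℤ) p, ev (C c * p) = (c : ℚ) • ev p := fun c p => by ext x; simp [ev]
  let W : Submodule ℚ (S → ℚ) := Submodule.span ℚ (ms.image fun s => ev (monomial s 1))
  have hmon : ∀ (s : Fin n →₀ ℕ) (c : ℤ), (monomial s c : MvPolynomial (Fin n) ℤ) = C c * monomial s 1 := by
    intro s c; rw [C_mul_monomial, mul_one]
  have key : ∀ t, ∀ p, DLT t p → ev p ∈ W := by
    intro t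
    induction t with
    | zero =>
      intro p hp
      rw [hp.eq_zero]
      have : ev 0 = 0 := by ext x; simp [ev]
      rw [this]; exact W.zero_mem
    | succ t ih =>
      intro p hp
      rw [p.as_sum, ev_sum]
      refine W.sum_mem fun s hs => ?_
      rw [hmon, ev_C]
      refine W.smul_mem _ ?_
      have hst := hp s hs
      by_cases hsD : s.degree < D0
      · exact Submodule.subset_span (by
          rw [Finset.coe_image]
          exact ⟨s, by simpa [hms] using hsD, rfl⟩)
      by_cases hst2 : s.degree < t
      · exact ih _ ((DLT.of_hom (isHomogeneous_monomial 1 rfl)).mono hst2)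
      have hst3 : s.degree = t := by omega
      obtain ⟨j, hj⟩ : ∃ j, K ≤ s j := by
        by_contra! hcon
        have : s.degree ≤ n * K := by
          have : s.degree = ∑ i, s i := Finsupp.degree_eq_sum s
          rw [this]
          calc ∑ i, s i ≤ ∑ _i : Fin n, K := Finset.sum_le_sum fun i _ => (hcon i).le
            _ = n * K := by simp
        omega
      obtain ⟨s', hs'⟩ := exists_add_of_le (show Finsupp.single j K ≤ s by
        rw [Finsupp.single_le_iff]; exact hj)
      have hdeg : s'.degree + K = t := by
        rw [hs', map_add] at hst3; simp at hst3; omega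
      have hm2 : (monomial s 1 : MvPolynomial (Fin n) ℤ) = X j ^ K * monomial s' 1 := by
        rw [hs', X_pow_eq_monomial, monomial_mul, one_mul]
      choose r hr hr2 using fun i => PPoly_lead l (pderiv i F) (by rw [hl]; exact hpd i)
      have hev0 : ∀ i, ev (PPoly l (pderiv i F)) = 0 := by
        intro i; ext x
        simp only [ev, eval_PPoly, hS x.1 x.2 i]; simp
      set f : ℤ := (l.length.factorial : ℤ) with hf
      have e1 : C (f * D) * (monomial s 1 : MvPolynomial (Fin n) ℤ) =
          ∑ i, (monomial s' 1 * a j i) * PPoly l (pderiv i F) - ∑ i, (monomial s' 1 * a j i) * r i := by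
        rw [hm2, map_mul, ← Finset.sum_sub_distrib]
        have : C f * C (D : ℤ) * (X j ^ K * monomial s' 1) =
          C f * monomial s' 1 * (C (D : ℤ) * X j ^ K : MvPolynomial (Fin n) ℤ) := by ring
        rw [this, ha2 j, Finset.mul_sum]
        refine Finset.sum_congr rfl fun i _ => ?_
        rw [hr2]; ring
      have e2 : ((f * D : ℤ) : ℚ) • ev (monomial s 1) = - ev (∑ i, (monomial s' 1 * a j i) * r i) := by
        rw [← ev_C, e1, sub_eq_add_neg, ev_add, ev_sum]
        have : ev (-∑ i, (monomial s' 1 * a j i) * r i) = - ev (∑ i, (monomial s' 1 * a j i) * r i) := by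
          ext x; simp [ev]
        rw [this]
        simp [ev_mul, hev0]
      have e3 : ev (∑ i, (monomial s' 1 * a j i) * r i) ∈ W := by
        apply ih
        refine DLT.sum _ _ fun i _ => ?_
        have := (DLT.of_hom ((isHomogeneous_monomial (R := ℤ) 1 (rfl : s'.degree = _)).mul
          (ha1 j i))).mul (hr i)
        refine this.mono (by rw [hl]; omega)
      have hne : ((f * D : ℤ) : ℚ) ≠ 0 := by
        have : (f * D : ℤ) ≠ 0 := mul_ne_zero (by rw [hf]; exact_mod_cast Nat.factorial_ne_zero _)
          (by exact_mod_cast hD)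
        exact_mod_cast this
      have e4 : ev (monomial s 1) = ((f * D : ℤ) : ℚ)⁻¹ • (((f * D : ℤ) : ℚ) • ev (monomial s 1)) := by
        rw [smul_smul, inv_mul_cancel₀ hne, one_smul]
      rw [e4, e2]
      exact W.smul_mem _ (W.neg_mem e3)
  have hall : ∀ p, ev p ∈ W := fun p => key (p.totalDegree + 1) p (fun s hs => by
    have := le_totalDegree hs
    exact Nat.lt_succ_of_le this)
  have htop : W = ⊤ := by
    rw [eq_top_iff]
    intro g _
    have hsingle : ∀ x0 : S, (Pi.single x0 1 : S → ℚ) ∈ W := by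
      intro x0
      have hsep : ∀ x : S, x ≠ x0 → ∃ i, x.1 i ≠ x0.1 i := by
        intro x hx
        by_contra! hc
        exact hx (Subtype.ext (funext hc))
      choose! ix hix using hsep
      let q : MvPolynomial (Fin n) ℤ := ∏ x ∈ Finset.univ.erase x0, (X (ix x) - C (x.1 (ix x)))
      have hq : ∀ x : S, x ≠ x0 → ev q x = 0 := by
        intro x hx
        simp only [ev, q, map_prod]
        have : ∏ y ∈ Finset.univ.erase x0, eval x.1 (X (ix y) - C (y.1 (ix y))) = 0 :=
          Finset.prod_eq_zero (i := x) (by simp [hx]) (by simp)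
        exact_mod_cast this
      have hq0 : ev q x0 ≠ 0 := by
        simp only [ev, q, map_prod]
        have : ∏ y ∈ Finset.univ.erase x0, eval x0.1 (X (ix y) - C (y.1 (ix y))) ≠ 0 := by
          refine Finset.prod_ne_zero_iff.2 fun y hy => ?_
          have := hix y (by simpa using hy)
          simp [sub_ne_zero, this.symm]
        exact_mod_cast this
      have : (Pi.single x0 1 : S → ℚ) = (ev q x0)⁻¹ • ev q := by
        ext x
        by_cases hx : x = x0
        · subst hx; simp [hq0]
        · simp [hx, hq x hx]
      rw [this]
      exact W.smul_mem _ (hall q)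
    have : g = ∑ x, g x • (Pi.single x 1 : S → ℚ) := by
      ext y; simp [Finset.sum_apply, Pi.single_apply]
    rw [this]
    exact W.sum_mem fun x _ => W.smul_mem _ (hsingle x)
  have h1 : Module.finrank ℚ W ≤ ms.card :=
    (finrank_span_finset_le_card _).trans Finset.card_image_le
  rw [htop, finrank_top] at h1
  simpa using h1

end fiber

/-- iterated sums over lists -/
def lsum {α : Type} : ℕ → Finset α → (List α → ℝ) → ℝ
  | 0, _, g => g []
  | k + 1, S, g => ∑ u ∈ S, lsum k S (fun l => g (u :: l))

section lsum
variable {α : Type}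

lemma lsum_mono (k : ℕ) (S : Finset α) (f g : List α → ℝ)
    (h : ∀ l, l.length = k → (∀ u ∈ l, u ∈ S) → f l ≤ g l) : lsum k S f ≤ lsum k S g := by
  induction k generalizing f g with
  | zero => exact h [] rfl (by simp)
  | succ k ih =>
    refine Finset.sum_le_sum fun u hu => ih _ _ fun l hl hS => h _ (by simp [hl]) ?_
    intro v hv
    rcases List.mem_cons.1 hv with rfl | hv
    · exact hu
    · exact hS v hv

lemma lsum_nonneg (k : ℕ) (S : Finset α) (g : List α → ℝ) (h : ∀ l, 0 ≤ g l) : 0 ≤ lsum k S g := by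
  induction k generalizing g with
  | zero => exact h []
  | succ k ih => exact Finset.sum_nonneg fun u _ => ih _ fun l => h _

lemma lsum_subset (k : ℕ) (S T : Finset α) (g : List α → ℝ) (h : ∀ l, 0 ≤ g l) (hST : S ⊆ T) :
    lsum k S g ≤ lsum k T g := by
  induction k generalizing g with
  | zero => exact le_rfl
  | succ k ih =>
    exact (Finset.sum_le_sum fun u _ => ih (fun l => g (u :: l)) fun l => h _).trans
      (Finset.sum_le_sum_of_subset_of_nonneg hST fun u _ _ => lsum_nonneg _ _ _ fun l => h _)

lemma lsum_mul (k : ℕ) (S : Finset α) (c : ℝ) (g : List α → ℝ) :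
    lsum k S (fun l => c * g l) = c * lsum k S g := by
  induction k generalizing g with
  | zero => rfl
  | succ k ih => simp only [lsum, ih, Finset.mul_sum]

lemma lsum_finsum {ι : Type*} (k : ℕ) (S : Finset α) (t : Finset ι) (g : ι → List α → ℝ) :
    lsum k S (fun l => ∑ i ∈ t, g i l) = ∑ i ∈ t, lsum k S (g i) := by
  induction k generalizing g with
  | zero => rfl
  | succ k ih => simp only [lsum, ih]; rw [Finset.sum_comm]

lemma lsum_const (k : ℕ) (S : Finset α) (c : ℝ) : lsum k S (fun _ => c) = (S.card : ℝ) ^ k * c := by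
  induction k with
  | zero => simp [lsum]
  | succ k ih => simp only [lsum, ih]; simp; ring

lemma lsum_map (k : ℕ) (S T : Finset α) (φ : α → α) (hφ : ∀ v ∈ S, ∃ u ∈ T, φ u = v)
    (g : List α → ℝ) (h : ∀ l, 0 ≤ g l) :
    lsum k S g ≤ lsum k T (fun l => g (l.map φ)) := by
  induction k generalizing g with
  | zero => exact le_rfl
  | succ k ih =>
    have h1 : lsum (k + 1) S g ≤ ∑ u ∈ S, lsum k T (fun l => g (u :: l.map φ)) :=
      Finset.sum_le_sum fun u _ => ih (fun l => g (u :: l)) fun l => h _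
    refine h1.trans ?_
    have hsub : S ⊆ T.image φ := by
      intro v hv
      obtain ⟨u, hu, rfl⟩ := hφ v hv
      exact Finset.mem_image_of_mem _ hu
    refine (Finset.sum_le_sum_of_subset_of_nonneg hsub fun u _ _ => lsum_nonneg _ _ _ fun l => h _).trans ?_
    exact Finset.sum_image_le_of_nonneg (s := T) (g := φ)
      (f := fun u => lsum k T (fun l => g (u :: l.map φ)))
      (fun u _ => lsum_nonneg _ _ _ fun l => h _)

end lsum

section boxes
variable {n : ℕ}

/-- the box `|u_i| < X` -/
def bx (n : ℕ) (X : ℝ) : Finset (Fin n → ℤ) :=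
  Fintype.piFinset fun _ => Finset.Ioo (-⌈X⌉) ⌈X⌉

lemma mem_bx {X : ℝ} {u : Fin n → ℤ} : u ∈ bx n X ↔ ∀ i, |(u i : ℝ)| < X := by
  simp only [bx, Fintype.mem_piFinset, Finset.mem_Ioo]
  refine forall_congr' fun i => ?_
  rw [← abs_lt, Int.lt_ceil]
  simp

lemma bx_mono {X Y : ℝ} (h : X ≤ Y) : bx n X ⊆ bx n Y := fun _ hu =>
  mem_bx.2 fun i => (mem_bx.1 hu i).trans_le h

lemma card_bx {X : ℝ} (hX : 1 ≤ X) : ((bx n X).card : ℝ) ≤ (3 * X) ^ n := by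
  simp only [bx, Fintype.card_piFinset, Int.card_Ioo, Finset.prod_const, Finset.card_univ,
    Fintype.card_fin]
  push_cast
  gcongr
  have h1 : (1 : ℤ) ≤ ⌈X⌉ := Int.one_le_ceil_iff.2 (by linarith)
  have h2 : ((⌈X⌉ - -⌈X⌉ - 1).toNat : ℤ) = 2 * ⌈X⌉ - 1 := by omega
  have h3 : (((⌈X⌉ - -⌈X⌉ - 1).toNat : ℤ) : ℝ) = 2 * ⌈X⌉ - 1 := by rw [h2]; push_cast; ring
  have h4 := Int.ceil_lt_add_one X
  have h5 : (((⌈X⌉ - -⌈X⌉ - 1).toNat : ℕ) : ℝ) = 2 * ⌈X⌉ - 1 := by exact_mod_cast h3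
  rw [h5]; linarith

lemma zero_count (hn : 0 < n) (d : ℕ) (hd : 2 ≤ d) (F : MvPolynomial (Fin n) ℤ)
    (hF : F.IsHomogeneous d) (hs : SmoothF F) : ∃ C : ℝ, 1 ≤ C ∧ ∀ R : ℝ, 1 ≤ R →
      lsum (d - 1) (bx n R) (fun l => if ∀ i, Phi l (pderiv i F) = 0 then 1 else 0) ≤
        C * R ^ (n * (d - 2)) := by
  obtain ⟨C0, hC0⟩ := fiber_bound hn d (by omega) F hF hs
  refine ⟨(6 ^ n) ^ (d - 2) * C0 + 1, by have : 0 ≤ ((6:ℝ) ^ n) ^ (d - 2) * C0 := by positivity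
                                         linarith, fun R hR => ?_⟩
  obtain ⟨k, rfl⟩ : ∃ k, d = k + 2 := ⟨d - 2, by omega⟩
  simp only [show k + 2 - 1 = k + 1 by omega, show k + 2 - 2 = k by omega] at *
  set g : List (Fin n → ℤ) → ℝ := fun l => if ∀ i, Phi l (pderiv i F) = 0 then 1 else 0 with hg
  have hg0 : ∀ l, 0 ≤ g l := fun l => by simp only [hg]; split_ifs <;> norm_num
  have h1 : lsum (k + 1) (bx n R) g ≤ ∑ u ∈ bx n R, lsum k (bx n (2 * R))
      (fun l => g (((0 : Fin n → ℤ) :: l).map fun s => u + s)) := by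
    refine Finset.sum_le_sum fun u hu => ?_
    refine (lsum_map k _ (bx n (2 * R)) (fun s => u + s) ?_ _ (fun l => hg0 _)).trans ?_
    · intro v hv
      refine ⟨v - u, mem_bx.2 fun i => ?_, by simp⟩
      have a1 := mem_bx.1 hv i
      have a2 := mem_bx.1 hu i
      simp only [Pi.sub_apply, Int.cast_sub]
      have := abs_sub (v i : ℝ) (u i)
      linarith
    · simp
  have h2 : ∑ u ∈ bx n R, lsum k (bx n (2 * R))
      (fun l => g (((0 : Fin n → ℤ) :: l).map fun s => u + s)) ≤
      lsum k (bx n (2 * R)) (fun _ => (C0 : ℝ)) := by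
    rw [← lsum_finsum]
    refine lsum_mono _ _ _ _ fun l hl _ => ?_
    simp only [hg]
    rw [Finset.sum_ite, Finset.sum_const_zero, add_zero, Finset.sum_const, nsmul_eq_mul, mul_one]
    have := hC0 (0 :: l) (by simp [hl]) ((bx n R).filter fun u =>
      ∀ i, Phi (((0 : Fin n → ℤ) :: l).map fun s => u + s) (pderiv i F) = 0) (by
        intro x hx; exact (Finset.mem_filter.1 hx).2)
    exact_mod_cast this
  refine (h1.trans h2).trans ?_
  rw [lsum_const]
  have h3 : ((bx n (2 * R)).card : ℝ) ^ k ≤ ((3 * (2 * R)) ^ n) ^ k := by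
    gcongr; exact card_bx (by linarith)
  calc ((bx n (2 * R)).card : ℝ) ^ k * C0 ≤ ((3 * (2 * R)) ^ n) ^ k * C0 := by gcongr
    _ = (6 ^ n) ^ k * C0 * R ^ (n * k) := by
      rw [show 3 * (2 * R) = 6 * R by ring, mul_pow, mul_pow, pow_mul]; ring
    _ ≤ _ := by gcongr; linarith

end boxes

/-- additive character -/
def ee (t : ℝ) : ℂ := Complex.exp ((2 * Real.pi * t : ℝ) * Complex.I)

lemma ee_add (s t : ℝ) : ee (s + t) = ee s * ee t := by
  simp only [ee, ← Complex.exp_add]; congr 1; push_cast; ring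

lemma ee_zero : ee 0 = 1 := by simp [ee]

lemma norm_ee (t : ℝ) : ‖ee t‖ = 1 := Complex.norm_exp_ofReal_mul_I _

lemma ee_int (k : ℤ) : ee k = 1 := by
  simp only [ee]; rw [Complex.exp_eq_one_iff]; exact ⟨k, by push_cast; ring⟩

lemma ee_add_int (t : ℝ) (k : ℤ) : ee (t + k) = ee t := by rw [ee_add, ee_int, mul_one]

lemma ee_neg (t : ℝ) : ee (-t) = (starRingEnd ℂ) (ee t) := by
  simp only [ee, ← Complex.exp_conj]; congr 1
  rw [map_mul, Complex.conj_ofReal, Complex.conj_I]; push_cast; ring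

lemma ee_sum {ι : Type*} (s : Finset ι) (f : ι → ℝ) : ee (∑ i ∈ s, f i) = ∏ i ∈ s, ee (f i) := by
  induction s using Finset.induction_on with
  | empty => simp [ee_zero]
  | insert a s ha ih => rw [Finset.sum_insert ha, Finset.prod_insert ha, ee_add, ih]

lemma norm_ee_sub_one (t : ℝ) : ‖ee t - 1‖ ≤ 7 * |t| := by
  have h := Real.norm_exp_I_mul_ofReal_sub_one_le (x := 2 * Real.pi * t)
  have : ee t = Complex.exp (Complex.I * (2 * Real.pi * t : ℝ)) := by simp only [ee]; rw [mul_comm]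
  rw [this]
  refine h.trans ?_
  rw [Real.norm_eq_abs, abs_mul, abs_mul, abs_of_pos Real.pi_pos]
  have := Real.pi_lt_d2
  norm_num
  nlinarith [abs_nonneg t]

lemma norm_ee_sub_one_ge (t : ℝ) (ht : |t| ≤ 1 / 2) : 4 * |t| ≤ ‖ee t - 1‖ := by
  have h1 : ‖ee t - 1‖ = 2 * |Real.sin (Real.pi * t)| := by
    have := Complex.norm_exp_I_mul_ofReal_sub_one (2 * Real.pi * t)
    have h2 : ee t = Complex.exp (Complex.I * (2 * Real.pi * t : ℝ)) := by simp only [ee]; rw [mul_comm]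
    rw [h2, this, Real.norm_eq_abs, abs_mul]
    norm_num
    ring_nf
  rw [h1]
  have h3 := Real.mul_abs_le_abs_sin (x := Real.pi * t) (by
    rw [abs_mul, abs_of_pos Real.pi_pos]; nlinarith [Real.pi_pos])
  rw [abs_mul, abs_of_pos Real.pi_pos] at h3
  have : 2 / Real.pi * (Real.pi * |t|) = 2 * |t| := by field_simp
  linarith

/-- near an integer -/
def nd (t Y : ℝ) : Prop := ∃ m : ℤ, |t - m| ≤ Y

lemma nd.mono {t Y Z : ℝ} (h : nd t Y) (hYZ : Y ≤ Z) : nd t Z := h.imp fun _ hm => hm.trans hYZ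

lemma nd.sub {s t Y Z : ℝ} (h : nd s Y) (h' : nd t Z) : nd (s - t) (Y + Z) := by
  obtain ⟨a, ha⟩ := h; obtain ⟨b, hb⟩ := h'
  refine ⟨a - b, ?_⟩
  have : s - t - ((a - b : ℤ) : ℝ) = (s - a) - (t - b) := by push_cast; ring
  rw [this]; exact (abs_sub _ _).trans (add_le_add ha hb)

/-- 1D linear exponential sum, geometric -/
lemma geom_ee (γ : ℝ) (a b : ℤ) : ‖∑ y ∈ Finset.Icc a b, ee (γ * y)‖ * ‖ee γ - 1‖ ≤ 2 := by
  rw [← norm_mul]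
  by_cases hab : b < a
  · rw [Finset.Icc_eq_empty (by omega)]; simp
  · push Not at hab
    have key : ∀ k : ℕ, (∑ y ∈ Finset.Icc a (a + k), ee (γ * y)) * (ee γ - 1) =
        ee (γ * (a + k + 1)) - ee (γ * a) := by
      intro k
      induction k with
      | zero =>
        have e1 : ee (γ * (a + 1)) = ee (γ * a) * ee γ := by rw [← ee_add]; congr 1; ring
        simp [e1, mul_sub]
      | succ k ih =>
        have h1 : Finset.Icc a (a + (k + 1 : ℕ)) = insert (a + k + 1 : ℤ) (Finset.Icc a (a + k)) := by
          ext x; simp; omega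
        rw [h1, Finset.sum_insert (by simp), add_mul, ih]
        push_cast
        have e1 : ee (γ * (a + (k + 1) + 1)) = ee (γ * (a + k + 1)) * ee γ := by
          rw [← ee_add]; congr 1; ring
        rw [e1]; ring
    obtain ⟨k, hk⟩ := Int.eq_ofNat_of_zero_le (sub_nonneg.2 hab)
    have : b = a + k := by linarith
    rw [this, key]
    refine (norm_sub_le _ _).trans ?_
    rw [norm_ee, norm_ee]; norm_num

/-- weights for cells -/
def cw (r : ℤ) : ℝ := 1 / (max 1 |(r : ℝ)|) ^ 2

lemma cw_nonneg (r : ℤ) : 0 ≤ cw r := by unfold cw; positivity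

lemma lin1 (P : ℕ) (hP : 1 ≤ P) (γ : ℝ) : ∃ r ∈ Finset.Icc (-P : ℤ) P, nd (γ - r / P) (1 / (2 * P)) ∧
    ∀ a b : ℤ, b < a + P → ‖∑ y ∈ Finset.Icc a b, ee (γ * y)‖ ^ 2 ≤ (P : ℝ) ^ 2 * cw r := by
  have hP' : (1 : ℝ) ≤ P := by exact_mod_cast hP
  have hP0 : (0 : ℝ) < P := by linarith
  set m := round γ with hm
  set t := γ - m with ht
  have ht2 : |t| ≤ 1 / 2 := abs_sub_round γ
  set r := round (P * t) with hr
  have hr2 : |P * t - r| ≤ 1 / 2 := abs_sub_round _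
  have hPt : |P * t| = P * |t| := by rw [abs_mul, abs_of_pos hP0]
  have hrP : |(r : ℝ)| ≤ P := by
    have : |(r : ℝ)| ≤ |P * t| + |P * t - r| := by
      have := abs_sub (P * t) (P * t - r); simpa using this
    rw [hPt] at this; nlinarith
  refine ⟨r, ?_, ⟨m, ?_⟩, ?_⟩
  · rw [Finset.mem_Icc]; rw [abs_le] at hrP; exact_mod_cast hrP
  · have : γ - r / P - m = (P * t - r) / P := by field_simp; ring
    rw [this, abs_div, abs_of_pos hP0, div_le_div_iff₀ hP0 (by positivity)]
    nlinarith
  · intro a b hab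
    have trivial_bd : ‖∑ y ∈ Finset.Icc a b, ee (γ * y)‖ ≤ P := by
      refine (norm_sum_le _ _).trans ?_
      simp only [norm_ee, Finset.sum_const, nsmul_eq_mul, mul_one, Int.card_Icc]
      have : (b + 1 - a).toNat ≤ P := by omega
      exact_mod_cast this
    by_cases h0 : |(r : ℝ)| ≤ 1
    · have : cw r = 1 := by unfold cw; rw [max_eq_left h0]; norm_num
      rw [this, mul_one]; gcongr
    · push Not at h0
      have e1 : cw r = 1 / |(r : ℝ)| ^ 2 := by unfold cw; rw [max_eq_right h0.le]
      have h1 := geom_ee γ a b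
      have h2 : ee γ = ee t := by rw [show γ = t + m by simp [ht], ee_add_int]
      rw [h2] at h1
      have h3 := norm_ee_sub_one_ge t ht2
      have h4 : |(r : ℝ)| / 2 ≤ P * |t| := by
        rw [← hPt]
        have := abs_sub_abs_le_abs_sub (r : ℝ) (P * t)
        rw [abs_sub_comm] at this
        linarith
      set S := ‖∑ y ∈ Finset.Icc a b, ee (γ * y)‖ with hS
      have hS0 : 0 ≤ S := norm_nonneg _
      have h5 : S * (4 * |t|) ≤ 2 := (mul_le_mul_of_nonneg_left h3 hS0).trans h1
      have h6 : S * |(r : ℝ)| ≤ P := by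
        have : S * (|(r : ℝ)| / 2) ≤ S * (P * |t|) := mul_le_mul_of_nonneg_left h4 hS0
        nlinarith
      rw [e1, mul_one_div, le_div_iff₀ (by positivity), ← mul_pow]
      gcongr

lemma cw_sum (P : ℕ) : ∑ r ∈ Finset.Icc (-P : ℤ) P, cw r ≤ 7 := by
  have key : ∀ k : ℕ, ∑ r ∈ Finset.Icc (-(k : ℤ)) k, cw r ≤ 7 - 4 / (k + 1) := by
    intro k
    induction k with
    | zero => simp [cw]; norm_num
    | succ k ih =>
      have h1 : Finset.Icc (-((k + 1 : ℕ) : ℤ)) ((k + 1 : ℕ) : ℤ) =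
          insert (k + 1 : ℤ) (insert (-(k + 1) : ℤ) (Finset.Icc (-(k : ℤ)) k)) := by
        ext x; simp; omega
      rw [h1, Finset.sum_insert (by simp; omega), Finset.sum_insert (by simp)]
      have e1 : cw (k + 1 : ℤ) = 1 / ((k : ℝ) + 1) ^ 2 := by
        unfold cw; push_cast
        rw [abs_of_nonneg (by positivity), max_eq_right (by linarith [k.cast_nonneg (α := ℝ)])]
      have e2 : cw (-(k + 1) : ℤ) = 1 / ((k : ℝ) + 1) ^ 2 := by
        rw [← e1]; unfold cw; rw [Int.cast_neg, abs_neg]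
      rw [e1, e2]
      have : 2 * (1 / ((k : ℝ) + 1) ^ 2) ≤ 4 / (k + 1) - 4 / (k + 2) := by
        have : (4 : ℝ) / (k + 1) - 4 / (k + 2) = 4 / ((k + 1) * (k + 2)) := by field_simp; ring
        rw [this, mul_one_div, div_le_div_iff₀ (by positivity) (by positivity)]
        nlinarith [k.cast_nonneg (α := ℝ)]
      push_cast
      rw [show (k : ℝ) + 1 + 1 = k + 2 by ring]
      linarith
  refine (key P).trans ?_
  have : (0 : ℝ) ≤ 4 / (P + 1) := by positivity
  linarith

section weyl
variable {n : ℕ}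

lemma Icc_pi (a b : Fin n → ℤ) : Finset.Icc a b = Fintype.piFinset fun i => Finset.Icc (a i) (b i) := by
  ext x; simp [Fintype.mem_piFinset, Pi.le_def, forall_and]

lemma lin_sum (γ : Fin n → ℝ) (a b : Fin n → ℤ) :
    ∑ y ∈ Finset.Icc a b, ee (∑ i, γ i * y i) = ∏ i, ∑ y ∈ Finset.Icc (a i) (b i), ee (γ i * y) := by
  rw [Icc_pi, Finset.prod_univ_sum]
  refine Finset.sum_congr rfl fun y _ => ee_sum _ _

/-- differenced boxes -/
def lobx : List (Fin n → ℤ) → (Fin n → ℤ) → (Fin n → ℤ)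
  | [], a => a
  | h :: l, a => lobx l (a ⊔ (a - h))

/-- differenced boxes -/
def hibx : List (Fin n → ℤ) → (Fin n → ℤ) → (Fin n → ℤ)
  | [], b => b
  | h :: l, b => hibx l (b ⊓ (b - h))

lemma bx_sides (l : List (Fin n → ℤ)) (a b : Fin n → ℤ) (P : ℕ) (h : ∀ i, b i < a i + P) :
    ∀ i, hibx l b i < lobx l a i + P := by
  induction l generalizing a b with
  | nil => exact h
  | cons v l ih =>
    refine ih _ _ fun i => ?_
    have := h i
    simp only [Pi.sup_apply, Pi.inf_apply, Pi.sub_apply]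
    have h1 : min (b i) (b i - v i) ≤ b i := min_le_left _ _
    have h2 : a i ≤ max (a i) (a i - v i) := le_max_left _ _
    show min _ _ < max _ _ + _
    omega

lemma diff1 (f : (Fin n → ℤ) → ℝ) (a b : Fin n → ℤ) (P : ℕ) (hab : ∀ i, b i < a i + P) :
    ((‖∑ y ∈ Finset.Icc a b, ee (f y)‖ ^ 2 : ℝ) : ℂ) =
      ∑ h ∈ bx n P, ∑ y ∈ Finset.Icc (a ⊔ (a - h)) (b ⊓ (b - h)), ee (f (y + h) - f y) := by
  have h0 := Complex.mul_conj' (∑ y ∈ Finset.Icc a b, ee (f y))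
  push_cast
  rw [← h0, map_sum, Finset.sum_mul_sum, Finset.sum_comm]
  simp only [← ee_neg, ← ee_add, ← sub_eq_add_neg]
  rw [Finset.sum_sigma', Finset.sum_sigma']
  refine Finset.sum_bij' (fun x _ => (⟨x.2 - x.1, x.1⟩ : (_ : Fin n → ℤ) × (Fin n → ℤ)))
    (fun x _ => (⟨x.2, x.2 + x.1⟩ : (_ : Fin n → ℤ) × (Fin n → ℤ))) ?_ ?_ ?_ ?_ ?_
  · rintro ⟨y, x⟩ h
    simp only [Finset.mem_sigma, Finset.mem_Icc] at h ⊢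
    obtain ⟨⟨h1, h2⟩, h3, h4⟩ := h
    refine ⟨mem_bx.2 fun i => ?_, ?_⟩
    · have q1 : a i ≤ y i := h1 i
      have q2 : y i ≤ b i := h2 i
      have q3 : a i ≤ x i := h3 i
      have q4 : x i ≤ b i := h4 i
      have := hab i
      have : |(x - y) i| < (P : ℤ) := by rw [abs_lt]; simp; omega
      exact_mod_cast this
    · refine ⟨sup_le h1 fun i => ?_, le_inf h2 fun i => ?_⟩
      · have q3 : a i ≤ x i := h3 i
        simp; omega
      · have q4 : x i ≤ b i := h4 i
        simp; omega
  · rintro ⟨h, y⟩ hh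
    simp only [Finset.mem_sigma, Finset.mem_Icc, sup_le_iff, le_inf_iff] at hh ⊢
    obtain ⟨h0, ⟨h1, h2⟩, h3, h4⟩ := hh
    refine ⟨⟨h1, h3⟩, fun i => ?_, fun i => ?_⟩
    · have := h2 i; simp at this ⊢; omega
    · have := h4 i; simp at this ⊢; omega
  · rintro ⟨y, x⟩ h; simp
  · rintro ⟨y, x⟩ h; simp
  · rintro ⟨y, x⟩ h; simp

lemma sum_pow_le {ι : Type*} (s : Finset ι) (z : ι → ℂ) (k : ℕ) (hk : 1 ≤ k) :
    ‖∑ i ∈ s, z i‖ ^ k ≤ (s.card : ℝ) ^ (k - 1) * ∑ i ∈ s, ‖z i‖ ^ k := by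
  obtain ⟨j, rfl⟩ : ∃ j, k = j + 1 := ⟨k - 1, by omega⟩
  calc ‖∑ i ∈ s, z i‖ ^ (j + 1) ≤ (∑ i ∈ s, ‖z i‖) ^ (j + 1) := by gcongr; exact norm_sum_le _ _
    _ ≤ _ := by
      rcases s.eq_empty_or_nonempty with rfl | hs
      · simp
      · have := pow_sum_div_card_le_sum_pow (s := s) (f := fun i => ‖z i‖) (fun i _ => norm_nonneg _) j
        rw [div_le_iff₀ (by have := hs.card_pos; positivity)] at this
        simpa [mul_comm] using this

lemma re_lsum_aux {ι : Type*} (s : Finset ι) (z : ι → ℂ) : (∑ i ∈ s, z i).re = ∑ i ∈ s, (z i).re :=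
  Complex.re_sum _ _

/-- Weyl differencing -/
lemma weyl (k : ℕ) (f : (Fin n → ℤ) → ℝ) (a b : Fin n → ℤ) (P : ℕ) (hab : ∀ i, b i < a i + P) :
    ‖∑ y ∈ Finset.Icc a b, ee (f y)‖ ^ (2 ^ (k + 1)) ≤
      ((bx n P).card : ℝ) ^ (2 ^ (k + 1) - k - 2) * lsum (k + 1) (bx n P) (fun l =>
        (∑ y ∈ Finset.Icc (lobx l a) (hibx l b), ee (dd l f y)).re) := by
  induction k generalizing f a b with
  | zero =>
    have := congrArg Complex.re (diff1 f a b P hab)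
    rw [Complex.ofReal_re, Complex.re_sum] at this
    simp only [zero_add, pow_one]
    norm_num
    rw [this]
    simp [lsum, lobx, hibx, dd]
  | succ k ih =>
    have h1 : ‖∑ y ∈ Finset.Icc a b, ee (f y)‖ ^ 2 = ‖∑ h ∈ bx n P,
        ∑ y ∈ Finset.Icc (a ⊔ (a - h)) (b ⊓ (b - h)), ee (f (y + h) - f y)‖ := by
      rw [← diff1 f a b P hab, Complex.norm_real, Real.norm_of_nonneg (by positivity)]
    have h2 : (1:ℕ) ≤ 2 ^ (k + 1) := Nat.one_le_two_pow
    have h3 : k + 2 ≤ 2 ^ (k + 1) := by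
      have := Nat.lt_two_pow_self (n := k + 1); omega
    calc ‖∑ y ∈ Finset.Icc a b, ee (f y)‖ ^ (2 ^ (k + 1 + 1))
        = (‖∑ y ∈ Finset.Icc a b, ee (f y)‖ ^ 2) ^ (2 ^ (k + 1)) := by
          rw [← pow_mul]; congr 1; ring
      _ ≤ ((bx n P).card : ℝ) ^ (2 ^ (k + 1) - 1) * ∑ h ∈ bx n P,
          ‖∑ y ∈ Finset.Icc (a ⊔ (a - h)) (b ⊓ (b - h)), ee (f (y + h) - f y)‖ ^ (2 ^ (k + 1)) := by
          rw [h1]; exact sum_pow_le _ _ _ h2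
      _ ≤ ((bx n P).card : ℝ) ^ (2 ^ (k + 1) - 1) * ∑ h ∈ bx n P,
          (((bx n P).card : ℝ) ^ (2 ^ (k + 1) - k - 2) * lsum (k + 1) (bx n P) (fun l =>
        (∑ y ∈ Finset.Icc (lobx (h :: l) a) (hibx (h :: l) b), ee (dd (h :: l) f y)).re)) := by
          gcongr with h hh
          exact ih (fun y => f (y + h) - f y) _ _ (bx_sides [h] a b P hab)
      _ = _ := by
          rw [← Finset.mul_sum, ← mul_assoc, ← pow_add]
          have : 2 ^ (k + 1) - 1 + (2 ^ (k + 1) - k - 2) = 2 ^ (k + 1 + 1) - (k + 1) - 2 := by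
            rw [pow_succ 2 (k + 1)]; omega
          rw [this]; rfl

end weyl

section weyl2
variable {n : ℕ}

lemma cell (P : ℕ) (hP : 1 ≤ P) (L : (Fin n → ℤ) → Fin n → ℝ)
    (hL : ∀ u v i, L (u - v) i = L u i - L v i) (W : (Fin n → ℤ) → ℝ)
    (hW : ∀ u, ∃ r : Fin n → ℤ, (∀ i, r i ∈ Finset.Icc (-P : ℤ) P) ∧
      (∀ i, nd (L u i - r i / P) (1 / (2 * P))) ∧ W u ≤ ∏ i, ((P : ℝ) ^ 2 * cw (r i))) :
    ∑ u ∈ bx n P, W u ≤ (7 * (P : ℝ) ^ 2) ^ n *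
      ∑ u ∈ bx n (2 * P), if ∀ i, nd (L u i) (1 / P) then 1 else 0 := by
  choose r hr1 hr2 hr3 using hW
  set N : ℝ := ∑ u ∈ bx n (2 * P), if ∀ i, nd (L u i) (1 / P) then 1 else 0 with hN
  have hN0 : 0 ≤ N := Finset.sum_nonneg fun u _ => by split_ifs <;> norm_num
  have hP0 : (0 : ℝ) < P := by exact_mod_cast hP
  set T := Fintype.piFinset fun _ : Fin n => Finset.Icc (-P : ℤ) P with hT
  have h1 : ∑ u ∈ bx n P, W u ≤ ∑ u ∈ bx n P, ∏ i, ((P : ℝ) ^ 2 * cw (r u i)) :=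
    Finset.sum_le_sum fun u _ => hr3 u
  have h2 : ∑ u ∈ bx n P, ∏ i, ((P : ℝ) ^ 2 * cw (r u i)) =
      ∑ s ∈ T, ∑ u ∈ (bx n P).filter (fun u => r u = s), ∏ i, ((P : ℝ) ^ 2 * cw (r u i)) :=
    (Finset.sum_fiberwise_of_maps_to (fun u _ => Fintype.mem_piFinset.2 (hr1 u)) _).symm
  have h3 : ∀ s ∈ T, ∑ u ∈ (bx n P).filter (fun u => r u = s), ∏ i, ((P : ℝ) ^ 2 * cw (r u i)) ≤
      (∏ i, ((P : ℝ) ^ 2 * cw (s i))) * N := by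
    intro s _
    rw [Finset.sum_congr rfl (g := fun _ => ∏ i, ((P : ℝ) ^ 2 * cw (s i)))
      (fun u hu => by rw [(Finset.mem_filter.1 hu).2])]
    rw [Finset.sum_const, nsmul_eq_mul, mul_comm]
    refine mul_le_mul_of_nonneg_left ?_ (Finset.prod_nonneg fun i _ => by
      have := cw_nonneg (s i); positivity)
    rcases ((bx n P).filter (fun u => r u = s)).eq_empty_or_nonempty with h | ⟨v, hv⟩
    · rw [h]; simpa using hN0
    · rw [hN, Finset.sum_ite, Finset.sum_const_zero, add_zero, Finset.sum_const, nsmul_eq_mul, mul_one]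
      have : ((bx n P).filter (fun u => r u = s)).card ≤
          ((bx n (2 * P)).filter fun u => ∀ i, nd (L u i) (1 / P)).card := by
        refine Finset.card_le_card_of_injOn (fun u => u - v) ?_ (fun x _ y _ h => by simpa using h)
        intro u hu
        simp only [Finset.coe_filter, Set.mem_setOf_eq, Finset.mem_filter] at hu hv ⊢
        refine ⟨mem_bx.2 fun i => ?_, fun i => ?_⟩
        · have a1 := mem_bx.1 hu.1 i
          have a2 := mem_bx.1 hv.1 i
          have := abs_sub (u i : ℝ) (v i)
          simp only [Pi.sub_apply, Int.cast_sub]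
          linarith
        · have a1 := hr2 u i
          have a2 := hr2 v i
          rw [hu.2] at a1; rw [hv.2] at a2
          have := a1.sub a2
          rw [hL]
          convert this using 1
          · ring
          · field_simp; norm_num
      exact_mod_cast this
  rw [h2] at h1
  refine h1.trans ((Finset.sum_le_sum h3).trans ?_)
  rw [← Finset.sum_mul]
  refine mul_le_mul_of_nonneg_right ?_ hN0
  have h4 := Finset.prod_univ_sum (fun _ : Fin n => Finset.Icc (-P : ℤ) P) (fun _ r => (P : ℝ) ^ 2 * cw r)
  rw [hT, ← h4, Finset.prod_const, Finset.card_univ, Fintype.card_fin]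
  have h5 : 0 ≤ ∑ r ∈ Finset.Icc (-P : ℤ) P, (P : ℝ) ^ 2 * cw r :=
    Finset.sum_nonneg fun r _ => by have := cw_nonneg r; positivity
  gcongr
  rw [← Finset.mul_sum, mul_comm]
  gcongr
  exact cw_sum P

/-- the double exponential sum -/
def SS (F : MvPolynomial (Fin n) ℤ) (a : Fin n → ℤ) (M : ℕ) (a1 b1 a2 b2 : Fin n → ℤ) (α : ℝ) : ℂ :=
  ∑ y ∈ Finset.Icc a1 b1, ∑ z ∈ Finset.Icc a2 b2, ee (α * (eval (a + M • (y + z)) F : ℤ))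

lemma dd_mul (l : List (Fin n → ℤ)) (f : (Fin n → ℤ) → ℤ) (α : ℝ) (x : Fin n → ℤ) :
    dd l (fun x => α * (f x : ℝ)) x = α * (dd l f x : ℤ) := by
  induction l generalizing f with
  | nil => rfl
  | cons h l ih =>
    simp only [dd]
    rw [← ih]
    congr 1
    ext x; push_cast; ring

lemma card_box (a b : Fin n → ℤ) (P : ℕ) (hab : ∀ i, b i < a i + P) :
    ((Finset.Icc a b).card : ℝ) ≤ (P : ℝ) ^ n := by
  rw [Icc_pi, Fintype.card_piFinset]
  have : ∏ i, (Finset.Icc (a i) (b i)).card ≤ ∏ _i : Fin n, P :=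
    Finset.prod_le_prod' fun i _ => by rw [Int.card_Icc]; have := hab i; omega
  simp only [Finset.prod_const, Finset.card_univ, Fintype.card_fin] at this
  exact_mod_cast this

lemma weyl_count (k : ℕ) (F : MvPolynomial (Fin n) ℤ) (hF : F.IsHomogeneous (k + 2))
    (P M : ℕ) (hP : 1 ≤ P) (a a1 b1 a2 b2 : Fin n → ℤ) (h1 : ∀ i, b1 i < a1 i + P)
    (h2 : ∀ i, b2 i < a2 i + P) (α : ℝ) :
    ‖SS F a M a1 b1 a2 b2 α‖ ^ (2 ^ (k + 1)) ≤
      ((P : ℝ) ^ n) ^ (2 ^ (k + 1) - 1) * (((3 * P : ℝ) ^ n) ^ (2 ^ (k + 1) - k - 2) *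
       ((7 * (P : ℝ) ^ 2) ^ n *
      lsum (k + 1) (bx n (2 * P)) (fun l =>
        if ∀ i, nd (α * M ^ (k + 2) * Phi l (pderiv i F)) (1 / P) then 1 else 0))) := by
  set K := 2 ^ (k + 1) with hK
  have hP' : (1 : ℝ) ≤ P := by exact_mod_cast hP
  have hK1 : 1 ≤ K := Nat.one_le_two_pow
  set γ : List (Fin n → ℤ) → Fin n → ℝ := fun l i => α * M ^ (k + 2) * Phi l (pderiv i F) with hγ
  -- phase
  have hphase : ∀ l : List (Fin n → ℤ), l.length = k + 1 → ∃ c : ℝ, ∀ y z : Fin n → ℤ,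
      dd l (fun y => α * ((eval (a + M • (y + z)) F : ℤ) : ℝ)) y =
        c + (∑ i, γ l i * y i) + ∑ i, γ l i * z i := by
    intro l hl
    obtain ⟨c, hc⟩ := dd_phase l F (by rw [hl]; exact DLT.of_hom hF) a M
    refine ⟨α * c, fun y z => ?_⟩
    rw [dd_mul l (fun y => eval (a + M • (y + z)) F) α y,
      dd_shift l (fun y => eval (a + M • y) F) z y, hc, hl]
    push_cast
    simp only [hγ, Finset.mul_sum, mul_add, add_assoc, Pi.add_apply]
    rw [← Finset.sum_add_distrib]
    congr 1
    refine Finset.sum_congr rfl fun i _ => ?_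
    push_cast; ring
  -- step 1
  have s1 : ‖SS F a M a1 b1 a2 b2 α‖ ^ K ≤ ((P : ℝ) ^ n) ^ (K - 1) *
      ∑ z ∈ Finset.Icc a2 b2, ‖∑ y ∈ Finset.Icc a1 b1, ee (α * (eval (a + M • (y + z)) F : ℤ))‖ ^ K := by
    unfold SS
    rw [Finset.sum_comm]
    refine (sum_pow_le _ _ _ hK1).trans ?_
    gcongr
    exact card_box a2 b2 P h2
  refine s1.trans (mul_le_mul_of_nonneg_left ?_ (by positivity))
  have s2 : ∑ z ∈ Finset.Icc a2 b2,
      ‖∑ y ∈ Finset.Icc a1 b1, ee (α * (eval (a + M • (y + z)) F : ℤ))‖ ^ K ≤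
      ∑ z ∈ Finset.Icc a2 b2, (((bx n P).card : ℝ) ^ (K - k - 2) * lsum (k + 1) (bx n P) (fun l =>
        (∑ y ∈ Finset.Icc (lobx l a1) (hibx l b1),
          ee (dd l (fun y => α * ((eval (a + M • (y + z)) F : ℤ) : ℝ)) y)).re)) :=
    Finset.sum_le_sum fun z _ => weyl k (fun y => α * ((eval (a + M • (y + z)) F : ℤ) : ℝ)) a1 b1 P h1
  refine s2.trans ?_
  rw [← Finset.mul_sum, ← lsum_finsum]
  set E1 : List (Fin n → ℤ) → ℝ := fun l =>
    ‖∑ y ∈ Finset.Icc (lobx l a1) (hibx l b1), ee (∑ i, γ l i * y i)‖ *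
    ‖∑ z ∈ Finset.Icc a2 b2, ee (∑ i, γ l i * z i)‖ with hE1
  have s3 : lsum (k + 1) (bx n P) (fun l => ∑ z ∈ Finset.Icc a2 b2,
      (∑ y ∈ Finset.Icc (lobx l a1) (hibx l b1),
          ee (dd l (fun y => α * ((eval (a + M • (y + z)) F : ℤ) : ℝ)) y)).re) ≤
      lsum (k + 1) (bx n P) E1 := by
    refine lsum_mono _ _ _ _ fun l hl _ => ?_
    obtain ⟨c, hc⟩ := hphase l hl
    rw [← Complex.re_sum]
    refine (Complex.re_le_norm _).trans ?_
    simp only [hc, ee_add, ← Finset.mul_sum, ← Finset.sum_mul, hE1]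
    rw [norm_mul, norm_mul, norm_ee, one_mul]
  have hE1n : ∀ l, 0 ≤ E1 l := fun l => by positivity
  have s4 : lsum (k + 1) (bx n P) E1 ≤ (7 * (P : ℝ) ^ 2) ^ n *
      lsum (k + 1) (bx n (2 * P)) (fun l =>
        if ∀ i, nd (α * M ^ (k + 2) * Phi l (pderiv i F)) (1 / P) then 1 else 0) := by
    show ∑ u ∈ bx n P, lsum k (bx n P) (fun l => E1 (u :: l)) ≤ (7 * (P : ℝ) ^ 2) ^ n *
      ∑ u ∈ bx n (2 * P), lsum k (bx n (2 * P)) (fun l =>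
        if ∀ i, nd (γ (u :: l) i) (1 / P) then 1 else 0)
    rw [← lsum_finsum, ← lsum_finsum, ← lsum_mul]
    have s5 : lsum k (bx n P) (fun l => ∑ u ∈ bx n P, E1 (u :: l)) ≤
      lsum k (bx n P) (fun l => (7 * (P : ℝ) ^ 2) ^ n * ∑ u ∈ bx n (2 * P),
        if ∀ i, nd (γ (u :: l) i) (1 / P) then 1 else 0) := by
      refine lsum_mono _ _ _ _ fun l hl _ => ?_
      refine cell P hP (fun u i => γ (u :: l) i) ?_ _ ?_
      · intro u v i
        simp only [hγ, Phi, Pi.sub_apply, sub_mul, Finset.sum_sub_distrib]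
        push_cast; ring
      · intro u
        choose r hr1 hr2 hr3 using fun i => lin1 P hP (γ (u :: l) i)
        refine ⟨r, hr1, hr2, ?_⟩
        simp only [hE1]
        rw [lin_sum, lin_sum, norm_prod, norm_prod, ← Finset.prod_mul_distrib]
        refine Finset.prod_le_prod (fun i _ => by positivity) fun i _ => ?_
        have q1 := hr3 i _ _ (bx_sides (u :: l) a1 b1 P h1 i)
        have q2 := hr3 i _ _ (h2 i)
        nlinarith [sq_nonneg (‖∑ y ∈ Finset.Icc (lobx (u :: l) a1 i) (hibx (u :: l) b1 i), ee (γ (u :: l) i * y)‖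
          - ‖∑ y ∈ Finset.Icc (a2 i) (b2 i), ee (γ (u :: l) i * y)‖)]
    refine s5.trans (lsum_subset _ _ _ _ (fun l => ?_) (bx_mono (by linarith)))
    refine mul_nonneg (by positivity) (Finset.sum_nonneg fun u _ => by split_ifs <;> norm_num)
  have s6 := lsum_nonneg (k + 1) (bx n P) E1 hE1n
  calc _ ≤ ((bx n P).card : ℝ) ^ (K - k - 2) * lsum (k + 1) (bx n P) E1 := by gcongr
    _ ≤ ((3 * P : ℝ) ^ n) ^ (K - k - 2) * lsum (k + 1) (bx n P) E1 := by
      gcongr; exact card_bx hP'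
    _ ≤ _ := by gcongr

end weyl2

lemma sep_cover {E : Type*} [PseudoMetricSpace E] (r : ℝ) (A : Finset E) :
    ∃ A' ⊆ A, (∀ x ∈ A', ∀ y ∈ A', x ≠ y → r ≤ dist x y) ∧ ∀ x ∈ A, ∃ y ∈ A', x = y ∨ dist x y < r := by
  induction A using Finset.induction_on with
  | empty => exact ⟨∅, by simp, by simp, by simp⟩
  | insert a A ha ih =>
    obtain ⟨A', h1, h2, h3⟩ := ih
    by_cases h : ∃ y ∈ A', dist a y < r
    · refine ⟨A', h1.trans (Finset.subset_insert _ _), h2, fun x hx => ?_⟩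
      rcases Finset.mem_insert.1 hx with rfl | hx
      · obtain ⟨y, hy, hh⟩ := h; exact ⟨y, hy, Or.inr hh⟩
      · exact h3 x hx
    · push Not at h
      refine ⟨insert a A', Finset.insert_subset_insert _ h1, ?_, ?_⟩
      · intro x hx y hy hxy
        rcases Finset.mem_insert.1 hx with rfl | hx' <;> rcases Finset.mem_insert.1 hy with rfl | hy'
        · exact absurd rfl hxy
        · exact h y hy'
        · rw [dist_comm]; exact h x (by assumption)
        · exact h2 x hx' y hy' hxy
      · intro x hx
        rcases Finset.mem_insert.1 hx with rfl | hx
        · exact ⟨x, by simp, Or.inl rfl⟩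
        · obtain ⟨y, hy, hh⟩ := h3 x hx; exact ⟨y, by simp [hy], hh⟩

lemma packing {E : Type*} [NormedAddCommGroup E] [NormedSpace ℝ E] [FiniteDimensional ℝ E]
    (r : ℝ) (hr : 0 < r) (hr1 : r ≤ 1) (A : Finset E) (hA : ∀ x ∈ A, ‖x‖ ≤ 1)
    (hsep : ∀ x ∈ A, ∀ y ∈ A, x ≠ y → r ≤ dist x y) :
    (A.card : ℝ) ≤ (3 / r) ^ (Module.finrank ℝ E) := by
  let _ : MeasurableSpace E := borel E
  have _ : BorelSpace E := ⟨rfl⟩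
  let μ : MeasureTheory.Measure E := MeasureTheory.Measure.addHaar
  have hd : (A : Set E).PairwiseDisjoint fun x => Metric.ball x (r / 2) := by
    intro x hx y hy hxy
    exact Metric.ball_disjoint_ball (by have := hsep x hx y hy hxy; linarith)
  have h1 : μ (⋃ x ∈ A, Metric.ball x (r / 2)) = ∑ x ∈ A, μ (Metric.ball x (r / 2)) :=
    MeasureTheory.measure_biUnion_finset hd fun x _ => Metric.isOpen_ball.measurableSet
  have h2 : (⋃ x ∈ A, Metric.ball x (r / 2)) ⊆ Metric.ball (0 : E) (3 / 2) := by
    intro z hz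
    simp only [Set.mem_iUnion, Metric.mem_ball, exists_prop] at hz ⊢
    obtain ⟨x, hx, hz⟩ := hz
    have h3 := hA x hx
    have h4 := dist_triangle z x 0
    rw [dist_zero_right x] at h4
    linarith
  have h3 := MeasureTheory.measure_mono (μ := μ) h2
  rw [h1] at h3
  have h4 : ∀ x ∈ A, μ (Metric.ball x (r / 2)) =
      ENNReal.ofReal ((r / 2) ^ (Module.finrank ℝ E)) * μ (Metric.ball 0 1) := fun x _ =>
    MeasureTheory.Measure.addHaar_ball_of_pos μ x (by positivity)
  rw [Finset.sum_congr rfl h4, Finset.sum_const, nsmul_eq_mul,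
    MeasureTheory.Measure.addHaar_ball_of_pos μ _ (by norm_num : (0 : ℝ) < 3 / 2), ← mul_assoc] at h3
  have hb0 : μ (Metric.ball (0 : E) 1) ≠ 0 := (Metric.measure_ball_pos μ 0 one_pos).ne'
  have hb1 : μ (Metric.ball (0 : E) 1) ≠ ⊤ := MeasureTheory.measure_ball_lt_top.ne
  rw [ENNReal.mul_le_mul_iff_left hb0 hb1] at h3
  rw [← ENNReal.ofReal_natCast, ← ENNReal.ofReal_mul (by positivity),
    ENNReal.ofReal_le_ofReal_iff (by positivity)] at h3
  have h5 : (3 / r) ^ (Module.finrank ℝ E) * (r / 2) ^ (Module.finrank ℝ E) = (3 / 2 : ℝ) ^ (Module.finrank ℝ E) := by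
    rw [← mul_pow]; congr 1; field_simp
  rw [← h5] at h3
  exact le_of_mul_le_mul_right h3 (by positivity)

section shrink
variable {n : ℕ}

/-- symplectic form -/
def sy (v w : (Fin n → ℝ) × (Fin n → ℝ)) : ℝ := ∑ i, (v.1 i * w.2 i - w.1 i * v.2 i)

lemma isotropic (S : Set ((Fin n → ℝ) × (Fin n → ℝ))) (h : ∀ v ∈ S, ∀ w ∈ S, sy v w = 0) :
    Module.finrank ℝ (Submodule.span ℝ S) ≤ n := by
  set W := Submodule.span ℝ S
  have add_l : ∀ a b w : (Fin n → ℝ) × (Fin n → ℝ), sy (a + b) w = sy a w + sy b w := by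
    intro a b w; simp only [sy, ← Finset.sum_add_distrib]
    refine Finset.sum_congr rfl fun i _ => ?_
    simp; ring
  have smul_l : ∀ (c : ℝ) (a w : (Fin n → ℝ) × (Fin n → ℝ)), sy (c • a) w = c * sy a w := by
    intro c a w; simp only [sy, Finset.mul_sum]
    refine Finset.sum_congr rfl fun i _ => ?_
    simp; ring
  have anti : ∀ a w : (Fin n → ℝ) × (Fin n → ℝ), sy a w = - sy w a := by
    intro a w; simp only [sy, ← Finset.sum_neg_distrib]
    exact Finset.sum_congr rfl fun i _ => by ring
  have z_l : ∀ w : (Fin n → ℝ) × (Fin n → ℝ), sy 0 w = 0 := by intro w; simp [sy]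
  have h1 : ∀ v ∈ W, ∀ w ∈ S, sy v w = 0 := by
    intro v hv w hw
    induction hv using Submodule.span_induction with
    | mem x hx => exact h x hx w hw
    | zero => exact z_l w
    | add x y _ _ hx hy => rw [add_l, hx, hy, add_zero]
    | smul c x _ hx => rw [smul_l, hx, mul_zero]
  have h2 : ∀ w ∈ W, ∀ v ∈ W, sy w v = 0 := by
    intro w hw v hv
    induction hw using Submodule.span_induction with
    | mem x hx => rw [anti, h1 v hv x hx, neg_zero]
    | zero => exact z_l v
    | add x y _ _ hx hy => rw [add_l, hx, hy, add_zero]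
    | smul c x _ hx => rw [smul_l, hx, mul_zero]
  let J : ((Fin n → ℝ) × (Fin n → ℝ)) →ₗ[ℝ] ((Fin n → ℝ) × (Fin n → ℝ)) :=
    LinearMap.prod (-LinearMap.snd ℝ _ _) (LinearMap.fst ℝ _ _)
  have hJ : Function.Injective J := by
    intro a b hab
    simp only [J, LinearMap.prod_apply, Function.prod, Prod.mk.injEq, LinearMap.neg_apply, LinearMap.snd_apply, LinearMap.fst_apply] at hab
    exact Prod.ext hab.2 (neg_injective hab.1)
  have hdis : Disjoint W (W.map J) := by
    rw [Submodule.disjoint_def]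
    rintro v hv hv'
    obtain ⟨w, hw, rfl⟩ := (Submodule.mem_map).1 hv'
    have h3 := h2 _ hv w hw
    simp only [sy, J, LinearMap.prod_apply, Function.prod, LinearMap.neg_apply, LinearMap.snd_apply, LinearMap.fst_apply, Pi.neg_apply] at h3
    have h4 : ∑ i, (w.2 i ^ 2 + w.1 i ^ 2) = 0 := by
      rw [← neg_eq_zero, ← Finset.sum_neg_distrib, ← h3]
      exact Finset.sum_congr rfl fun i _ => by ring
    rw [Finset.sum_eq_zero_iff_of_nonneg (fun i _ => by positivity)] at h4
    have : w = 0 := by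
      ext i
      · have := h4 i (Finset.mem_univ _); simp; nlinarith [sq_nonneg (w.2 i), sq_nonneg (w.1 i)]
      · have := h4 i (Finset.mem_univ _); simp; nlinarith [sq_nonneg (w.2 i), sq_nonneg (w.1 i)]
    rw [this, map_zero]
  have h5 := Submodule.finrank_add_finrank_le_of_disjoint hdis
  rw [← (Submodule.equivMapOfInjective J hJ W).finrank_eq] at h5
  simp at h5
  omega


/-- count in the shrinking lemma -/
def cnt (Λ : Fin n → Fin n → ℝ) (X Y : ℝ) : ℕ :=
  ((bx n X).filter fun u => ∀ i, nd (∑ j, Λ i j * u j) Y).card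

lemma shrink (hn : 0 < n) : ∃ C : ℝ, 1 ≤ C ∧ ∀ (Λ : Fin n → Fin n → ℝ), (∀ i j, Λ i j = Λ j i) →
    ∀ X Y t : ℝ, 0 < X → 0 < Y → X * Y ≤ 2 → 0 < t → t ≤ 1 →
    (cnt Λ X Y : ℝ) ≤ C * (1 / t) ^ n * cnt Λ (t * X) (t * Y) := by
  refine ⟨6 ^ n * (((8 * n + 1) ^ n * (8 * n + 1) ^ n : ℕ) : ℝ), ?_, ?_⟩
  · have h1 : (1 : ℝ) ≤ 6 ^ n := one_le_pow₀ (by norm_num)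
    have h2 : 1 ≤ (8 * n + 1) ^ n * (8 * n + 1) ^ n := Nat.one_le_iff_ne_zero.2 (by positivity)
    have h3 : (1 : ℝ) ≤ (((8 * n + 1) ^ n * (8 * n + 1) ^ n : ℕ) : ℝ) := by exact_mod_cast h2
    nlinarith
  intro Λ hsym X Y t hX hY hXY ht ht1
  have hn' : (1 : ℝ) ≤ n := by exact_mod_cast hn
  set L : (Fin n → ℤ) → Fin n → ℝ := fun u i => ∑ j, Λ i j * u j with hL
  have Lsub : ∀ u v i, L (u - v) i = L u i - L v i := by
    intro u v i
    simp only [hL, ← Finset.sum_sub_distrib]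
    refine Finset.sum_congr rfl fun j _ => ?_
    simp; ring
  set A0 := (bx n X).filter fun u => ∀ i, nd (L u i) Y with hA0
  have hm : ∀ u, ∃ m : Fin n → ℤ, u ∈ A0 → ∀ i, |L u i - m i| ≤ Y := by
    intro u
    by_cases h : u ∈ A0
    · choose m hm using (Finset.mem_filter.1 h).2
      exact ⟨m, fun _ => hm⟩
    · exact ⟨0, fun h' => absurd h' h⟩
  choose m hm using hm
  set c : ℝ := 1 / (4 * n) with hc
  have hc0 : 0 < c := by positivity
  set v : (Fin n → ℤ) → (Fin n → ℝ) × (Fin n → ℝ) := fun u =>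
    (fun i => u i / X, fun i => (L u i - m u i) / Y) with hv
  have hv1 : ∀ u ∈ A0, ∀ i, |(v u).1 i| ≤ 1 := by
    intro u hu i
    have := mem_bx.1 (Finset.mem_filter.1 hu).1 i
    simp only [hv, abs_div, abs_of_pos hX]
    rw [div_le_one hX]; exact this.le
  have hv2 : ∀ u ∈ A0, ∀ i, |(v u).2 i| ≤ 1 := by
    intro u hu i
    have := hm u hu i
    simp only [hv, abs_div, abs_of_pos hY]
    rw [div_le_one hY]; exact this
  set I : Finset ℤ := Finset.Icc (-(4 * n : ℤ)) (4 * n) with hI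
  have hfl : ∀ x : ℝ, |x| ≤ 1 → ⌊x / c⌋ ∈ I := by
    intro x hx
    rw [hI, Finset.mem_Icc]
    rw [abs_le] at hx
    have e : x / c = 4 * n * x := by rw [hc]; field_simp
    rw [e]
    constructor
    · rw [Int.le_floor]; push_cast; nlinarith
    · have : (⌊4 * n * x⌋ : ℝ) ≤ 4 * n * x := Int.floor_le _
      have : (⌊4 * n * x⌋ : ℝ) ≤ 4 * n := by nlinarith
      exact_mod_cast this
  have hfl2 : ∀ x y : ℝ, ⌊x / c⌋ = ⌊y / c⌋ → |x - y| ≤ c := by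
    intro x y h
    have := Int.abs_sub_lt_one_of_floor_eq_floor h
    rw [← sub_div, abs_div, abs_of_pos hc0, div_lt_one hc0] at this
    exact this.le
  set κ : (Fin n → ℤ) → (Fin n → ℤ) × (Fin n → ℤ) := fun u =>
    (fun i => ⌊(v u).1 i / c⌋, fun i => ⌊(v u).2 i / c⌋) with hκ
  set TT := (Fintype.piFinset fun _ : Fin n => I) ×ˢ (Fintype.piFinset fun _ : Fin n => I) with hTT
  have hTTc : TT.card = (8 * n + 1) ^ n * (8 * n + 1) ^ n := by
    rw [hTT, Finset.card_product, Fintype.card_piFinset]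
    simp only [hI, Int.card_Icc, Finset.prod_const, Finset.card_univ, Fintype.card_fin]
    congr 2 <;> omega
  set N := cnt Λ (t * X) (t * Y) with hN
  have main : ∀ s ∈ TT, (A0.filter fun u => κ u = s).card ≤ ⌊(6 / t) ^ n⌋₊ * N := by
    intro s _
    set T := A0.filter fun u => κ u = s with hT
    rcases T.eq_empty_or_nonempty with h | ⟨u0, hu0⟩
    · rw [h]; simp
    have hdiff : ∀ u ∈ T, ‖v u - v u0‖ ≤ c := by
      intro u hu
      have e : κ u = κ u0 := by rw [(Finset.mem_filter.1 hu).2, (Finset.mem_filter.1 hu0).2]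
      rw [Prod.norm_def]
      refine max_le ?_ ?_
      · rw [pi_norm_le_iff_of_nonneg hc0.le]
        intro i
        exact hfl2 _ _ (congrFun (congrArg Prod.fst e) i)
      · rw [pi_norm_le_iff_of_nonneg hc0.le]
        intro i
        exact hfl2 _ _ (congrFun (congrArg Prod.snd e) i)
    set w : (Fin n → ℤ) → (Fin n → ℝ) × (Fin n → ℝ) := fun u => v u - v u0 with hw
    set S : Set ((Fin n → ℝ) × (Fin n → ℝ)) := w '' T with hS
    have hw1 : ∀ u i, (w u).1 i = (u i - u0 i) / X := by
      intro u i; simp only [hw, hv, Prod.fst_sub, Pi.sub_apply]; ring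
    have hw2 : ∀ u i, (w u).2 i = (L (u - u0) i - (m u i - m u0 i)) / Y := by
      intro u i; simp only [hw, hv, Prod.snd_sub, Pi.sub_apply, Lsub]; ring
    have hiso : ∀ x ∈ S, ∀ y ∈ S, sy x y = 0 := by
      rintro _ ⟨u, hu, rfl⟩ _ ⟨u', hu', rfl⟩
      have e1 : X * Y * sy (w u) (w u') = ((∑ i, ((u' i - u0 i) * (m u i - m u0 i) -
          (u i - u0 i) * (m u' i - m u0 i)) : ℤ) : ℝ) := by
        have e2 : ∑ i, ((u i - u0 i : ℤ) : ℝ) * L (u' - u0) i = ∑ i, ((u' i - u0 i : ℤ) : ℝ) * L (u - u0) i := by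
          simp only [hL, Finset.mul_sum]
          rw [Finset.sum_comm]
          refine Finset.sum_congr rfl fun i _ => Finset.sum_congr rfl fun j _ => ?_
          rw [hsym j i]; simp only [Pi.sub_apply]; push_cast; ring
        have e3 : X * Y * sy (w u) (w u') = ∑ i, ((u i - u0 i : ℤ) : ℝ) * L (u' - u0) i -
            ∑ i, ((u' i - u0 i : ℤ) : ℝ) * L (u - u0) i + ∑ i, (((u' i - u0 i) * (m u i - m u0 i) -
          (u i - u0 i) * (m u' i - m u0 i) : ℤ) : ℝ) := by
          rw [← Finset.sum_sub_distrib, ← Finset.sum_add_distrib, sy, Finset.mul_sum]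
          refine Finset.sum_congr rfl fun i _ => ?_
          rw [hw1, hw1, hw2, hw2]
          field_simp
          push_cast; ring
        rw [e3, e2, sub_self, zero_add]; push_cast; rfl
      have b1 : |sy (w u) (w u')| ≤ n * (2 * c ^ 2) := by
        refine (Finset.abs_sum_le_sum_abs _ _).trans ?_
        have q : ∀ i ∈ Finset.univ, |(w u).1 i * (w u').2 i - (w u').1 i * (w u).2 i| ≤ 2 * c ^ 2 := by
          intro i _
          have p1 := (norm_le_pi_norm (w u).1 i).trans ((norm_fst_le (w u)).trans (hdiff u hu))
          have p2 := (norm_le_pi_norm (w u').1 i).trans ((norm_fst_le (w u')).trans (hdiff u' hu'))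
          have p3 := (norm_le_pi_norm (w u).2 i).trans ((norm_snd_le (w u)).trans (hdiff u hu))
          have p4 := (norm_le_pi_norm (w u').2 i).trans ((norm_snd_le (w u')).trans (hdiff u' hu'))
          rw [Real.norm_eq_abs] at p1 p2 p3 p4
          refine (abs_sub _ _).trans ?_
          rw [abs_mul, abs_mul]
          have := mul_le_mul p1 p4 (abs_nonneg _) hc0.le
          have := mul_le_mul p2 p3 (abs_nonneg _) hc0.le
          nlinarith
        refine (Finset.sum_le_sum q).trans ?_
        simp
      have b2 : |X * Y * sy (w u) (w u')| < 1 := by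
        rw [abs_mul, abs_of_pos (mul_pos hX hY)]
        have : X * Y * |sy (w u) (w u')| ≤ 2 * (n * (2 * c ^ 2)) :=
          mul_le_mul hXY b1 (abs_nonneg _) (by norm_num)
        have e : 2 * (n * (2 * c ^ 2)) = 1 / (4 * n) := by rw [hc]; field_simp; norm_num
        rw [e] at this
        refine this.trans_lt ?_
        rw [div_lt_one (by positivity)]; linarith
      rw [e1] at b2
      have b3 : (∑ i, ((u' i - u0 i) * (m u i - m u0 i) -
          (u i - u0 i) * (m u' i - m u0 i))) = 0 := by
        rw [← Int.abs_lt_one_iff]; exact_mod_cast b2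
      rw [b3, Int.cast_zero] at e1
      exact (mul_eq_zero.1 e1).resolve_left (mul_pos hX hY).ne'
    set W := Submodule.span ℝ S with hW
    have hdim : Module.finrank ℝ W ≤ n := isotropic S hiso
    let wW : (Fin n → ℤ) → W := fun u => if h : w u ∈ W then ⟨w u, h⟩ else 0
    have hwW : ∀ u ∈ T, (wW u : (Fin n → ℝ) × (Fin n → ℝ)) = w u := by
      intro u hu
      have : w u ∈ W := Submodule.subset_span ⟨u, hu, rfl⟩
      simp [wW, this]
    obtain ⟨A', hA1, hA2, hA3⟩ := sep_cover (t / 2) (T.image wW)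
    have hcard : (A'.card : ℝ) ≤ (6 / t) ^ n := by
      refine (packing (t / 2) (by positivity) (by linarith) A' ?_ hA2).trans ?_
      · intro x hx
        obtain ⟨u, hu, rfl⟩ := Finset.mem_image.1 (hA1 hx)
        have : ‖wW u‖ = ‖w u‖ := by rw [← hwW u hu]; rfl
        rw [this]
        refine (hdiff u hu).trans ?_
        rw [hc, div_le_one (by positivity)]; linarith
      · rw [show 3 / (t / 2) = 6 / t by field_simp; norm_num]
        refine pow_le_pow_right₀ ?_ hdim
        rw [le_div_iff₀ ht]; linarith
    have hch : ∀ u : Fin n → ℤ, ∃ y : W, u ∈ T → y ∈ A' ∧ dist (wW u) y ≤ t / 2 := by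
      intro u
      by_cases hu : u ∈ T
      · obtain ⟨y, hy, h⟩ := hA3 (wW u) (Finset.mem_image_of_mem _ hu)
        refine ⟨y, fun _ => ⟨hy, ?_⟩⟩
        rcases h with h | h
        · rw [h, dist_self]; positivity
        · exact h.le
      · exact ⟨0, fun h => absurd h hu⟩
    choose g hg using hch
    have hfin : T.card ≤ N * A'.card := by
      refine Finset.card_le_mul_card_image_of_maps_to (f := g) (fun u hu => (hg u hu).1) N ?_
      intro y hy
      obtain ⟨u', hu', rfl⟩ := Finset.mem_image.1 (hA1 hy)
      rw [hN, cnt]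
      refine Finset.card_le_card_of_injOn (fun u => u - u') ?_ (fun x _ y _ h => by simpa using h)
      intro u hu
      simp only [Finset.coe_filter, Finset.mem_filter, Set.mem_ofPred_eq] at hu ⊢
      have hd := (hg u hu.1).2
      rw [hu.2] at hd
      have hd2 : ‖w u - w u'‖ ≤ t / 2 := by
        have : dist (wW u) (wW u') = ‖w u - w u'‖ := by
          rw [← hwW u hu.1, ← hwW u' hu', Subtype.dist_eq, dist_eq_norm]
        rwa [this] at hd
      have hd3 : w u - w u' = v u - v u' := by simp [hw]
      rw [hd3] at hd2
      refine ⟨mem_bx.2 fun i => ?_, fun i => ?_⟩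
      · have p1 := (norm_le_pi_norm (v u - v u').1 i).trans ((norm_fst_le (v u - v u')).trans hd2)
        have e : (v u - v u').1 i = ((u - u') i : ℤ) / X := by
          simp only [hv, Prod.fst_sub, Pi.sub_apply]; push_cast; ring
        rw [e, Real.norm_eq_abs, abs_div, abs_of_pos hX, div_le_iff₀ hX] at p1
        nlinarith
      · have p1 := (norm_le_pi_norm (v u - v u').2 i).trans ((norm_snd_le (v u - v u')).trans hd2)
        have e : (v u - v u').2 i = (L (u - u') i - ((m u i - m u' i : ℤ) : ℝ)) / Y := by
          simp only [hv, Prod.snd_sub, Pi.sub_apply, Lsub]; push_cast; ring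
        rw [e, Real.norm_eq_abs, abs_div, abs_of_pos hY, div_le_iff₀ hY] at p1
        refine ⟨m u i - m u' i, p1.trans ?_⟩
        nlinarith
    rw [mul_comm]
    exact hfin.trans (Nat.mul_le_mul_left _ (Nat.le_floor hcard))
  have h1 : A0.card ≤ (⌊(6 / t) ^ n⌋₊ * N) * TT.card := by
    refine Finset.card_le_mul_card_image_of_maps_to (f := κ) ?_ _ main
    intro u hu
    rw [hTT, Finset.mem_product]
    exact ⟨Fintype.mem_piFinset.2 fun i => hfl _ (hv1 u hu i),
      Fintype.mem_piFinset.2 fun i => hfl _ (hv2 u hu i)⟩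
  rw [hTTc] at h1
  have h2 : ((A0.card : ℕ) : ℝ) ≤ (⌊(6 / t) ^ n⌋₊ * N) * (((8 * n + 1) ^ n * (8 * n + 1) ^ n : ℕ) : ℝ) := by
    exact_mod_cast h1
  refine h2.trans ?_
  have h3 : (⌊(6 / t) ^ n⌋₊ : ℝ) ≤ (6 / t) ^ n := Nat.floor_le (by positivity)
  calc _ ≤ ((6 / t) ^ n * N) * (((8 * n + 1) ^ n * (8 * n + 1) ^ n : ℕ) : ℝ) := by gcongr
    _ = _ := by
      rw [div_eq_mul_one_div, mul_pow]; ring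

end shrink

section dich
variable {n : ℕ}

/-- indicator -/
def nind (F : MvPolynomial (Fin n) ℤ) (β Y : ℝ) (l : List (Fin n → ℤ)) : ℝ :=
  if ∀ i, nd (β * Phi l (pderiv i F)) Y then 1 else 0

lemma nind_nonneg (F : MvPolynomial (Fin n) ℤ) (β Y : ℝ) (l : List (Fin n → ℤ)) :
    0 ≤ nind F β Y l := by unfold nind; split_ifs <;> norm_num

lemma nind_sum (F : MvPolynomial (Fin n) ℤ) (β X Y : ℝ) (l₁ l₂ : List (Fin n → ℤ)) :
    ∑ u ∈ bx n X, nind F β Y (l₁ ++ u :: l₂) =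
      cnt (fun i j => β * Phi (l₁ ++ l₂) (pderiv j (pderiv i F))) X Y := by
  unfold nind cnt
  rw [Finset.sum_ite, Finset.sum_const_zero, add_zero, Finset.sum_const, nsmul_eq_mul, mul_one]
  congr 3
  ext u
  refine forall_congr' fun i => ?_
  rw [Phi_mid]
  push_cast
  rw [Finset.mul_sum]
  have : ∀ j, β * ((u j : ℝ) * (Phi (l₁ ++ l₂) (pderiv j (pderiv i F)) : ℝ)) =
    β * (Phi (l₁ ++ l₂) (pderiv j (pderiv i F)) : ℝ) * (u j : ℝ) := fun j => by ring
  simp only [this]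

lemma shrink_iter (hn : 0 < n) : ∃ C : ℝ, 1 ≤ C ∧ ∀ (F : MvPolynomial (Fin n) ℤ) (β P R : ℝ), 1 ≤ P →
    0 < R → R ≤ P → ∀ (r j : ℕ) (Y : ℝ), 0 < Y → P * Y ≤ 1 →
    lsum j (bx n (2 * R)) (fun l₁ => lsum r (bx n (2 * P)) (fun l₂ => nind F β Y (l₁ ++ l₂))) ≤
      (C * (P / R) ^ n) ^ r * lsum (j + r) (bx n (2 * R)) (nind F β ((R / P) ^ r * Y)) := by
  obtain ⟨C, hC, hsh⟩ := shrink hn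
  refine ⟨C, hC, fun F β P R hP hR hRP r => ?_⟩
  have hP0 : 0 < P := by linarith
  have ht : 0 < R / P := by positivity
  have ht1 : R / P ≤ 1 := by rw [div_le_one hP0]; exact hRP
  induction r with
  | zero => intro j Y hY hPY; simp [lsum]
  | succ r ih =>
    intro j Y hY hPY
    have h1 : lsum j (bx n (2 * R)) (fun l₁ => lsum (r + 1) (bx n (2 * P)) (fun l₂ => nind F β Y (l₁ ++ l₂)))
        ≤ lsum j (bx n (2 * R)) (fun l₁ => (C * (P / R) ^ n) * ∑ u ∈ bx n (2 * R),
          lsum r (bx n (2 * P)) (fun l₂ => nind F β (R / P * Y) (u :: l₁ ++ l₂))) := by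
      refine lsum_mono _ _ _ _ fun l₁ _ _ => ?_
      rw [← lsum_finsum, ← lsum_mul]
      show ∑ u ∈ bx n (2 * P), lsum r (bx n (2 * P)) (fun l₂ => nind F β Y (l₁ ++ u :: l₂)) ≤ _
      rw [← lsum_finsum]
      refine lsum_mono _ _ _ _ fun l₂ _ _ => ?_
      have e : ∀ u, nind F β (R / P * Y) (u :: l₁ ++ l₂) = nind F β (R / P * Y) (l₁ ++ u :: l₂) := by
        intro u; unfold nind
        have : ∀ i, Phi (u :: l₁ ++ l₂) (pderiv i F) = Phi (l₁ ++ u :: l₂) (pderiv i F) := by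
          intro i; rw [Phi_mid]; rfl
        simp only [this]
      simp only [e]
      rw [nind_sum, nind_sum]
      have := hsh (fun i j => β * Phi (l₁ ++ l₂) (pderiv j (pderiv i F)))
        (fun i j => by rw [pderiv_comm']) (2 * P) Y (R / P) (by positivity) hY (by linarith) ht ht1
      rw [one_div_div, show R / P * (2 * P) = 2 * R by field_simp] at this
      exact this
    rw [lsum_mul, lsum_finsum] at h1
    have h2 := ih (j + 1) (R / P * Y) (by positivity) (by
      calc P * (R / P * Y) = (R / P) * (P * Y) := by ring
        _ ≤ 1 * 1 := by gcongr
        _ = 1 := by norm_num)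
    have h3 : lsum (j + 1) (bx n (2 * R)) (fun l₁ => lsum r (bx n (2 * P))
        (fun l₂ => nind F β (R / P * Y) (l₁ ++ l₂))) = ∑ u ∈ bx n (2 * R), lsum j (bx n (2 * R))
        (fun l₁ => lsum r (bx n (2 * P)) (fun l₂ => nind F β (R / P * Y) (u :: l₁ ++ l₂))) := rfl
    rw [← h3] at h1
    refine h1.trans ?_
    have hCP : 0 ≤ C * (P / R) ^ n := by positivity
    refine (mul_le_mul_of_nonneg_left h2 hCP).trans (le_of_eq ?_)
    rw [show j + 1 + r = j + (r + 1) by ring, ← mul_assoc ((R / P) ^ r), ← pow_succ (R / P) r]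
    ring

/-- closeness to rationals with small denominators -/
def near (Q δ α : ℝ) : Prop := ∃ q : ℕ, 1 ≤ q ∧ (q : ℝ) ≤ Q ∧ ∃ b : ℤ, |q * α - b| ≤ δ

lemma dichotomy (hn : 0 < n) (k : ℕ) (F : MvPolynomial (Fin n) ℤ) (hF : F.IsHomogeneous (k + 2))
    (hs : SmoothF F) : ∃ C : ℝ, 1 ≤ C ∧ ∀ (P M : ℕ), 1 ≤ P → 1 ≤ M → ∀ (a a1 b1 a2 b2 : Fin n → ℤ),
      (∀ i, b1 i < a1 i + P) → (∀ i, b2 i < a2 i + P) → ∀ (α R : ℝ), 1 ≤ R → R ≤ P →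
      ‖SS F a M a1 b1 a2 b2 α‖ ^ (2 ^ (k + 1)) * R ^ n ≤ C * ((P : ℝ) ^ (2 * n)) ^ (2 ^ (k + 1)) ∨
      near (C * M ^ (k + 2) * R ^ (k + 1)) (R ^ (k + 1) / P ^ (k + 2)) α := by
  obtain ⟨C1, hC1, hit⟩ := shrink_iter hn
  obtain ⟨C2, hC2, hz⟩ := zero_count hn (k + 2) (by omega) F hF hs
  choose C3 hC3 hb using fun i => Phi_bound (k + 1) (pderiv i F)
  set K := 2 ^ (k + 1) with hK
  have hKk : k + 2 ≤ K := by
    have := Nat.lt_two_pow_self (n := k + 1); omega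
  set Ca := (3 ^ n) ^ (K - k - 2) * 7 ^ n * C1 ^ (k + 1) * C2 * 2 ^ (n * k) with hCa
  set Cb := (∑ i, C3 i) * 2 ^ (k + 1) with hCb
  have hCa0 : 0 ≤ Ca := by positivity
  have hCb0 : 0 ≤ Cb := by
    have : 0 ≤ ∑ i, C3 i := Finset.sum_nonneg fun i _ => by linarith [hC3 i]
    positivity
  refine ⟨1 + Ca + Cb, by linarith, fun P M hP hM a a1 b1 a2 b2 h1 h2 α R hR hRP => ?_⟩
  have hP' : (1 : ℝ) ≤ P := by exact_mod_cast hP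
  have hP0 : (0 : ℝ) < P := by linarith
  have hR0 : 0 < R := by linarith
  by_cases hex : ∃ l : List (Fin n → ℤ), l.length = k + 1 ∧ (∀ u ∈ l, u ∈ bx n (2 * R)) ∧
      (∀ i, nd (α * M ^ (k + 2) * Phi l (pderiv i F)) ((R / P) ^ (k + 1) * (1 / P))) ∧
      ∃ i, Phi l (pderiv i F) ≠ 0
  · right
    obtain ⟨l, hl, hlb, hnd, i, hi⟩ := hex
    obtain ⟨b, hb'⟩ := hnd i
    have hY : (R / P) ^ (k + 1) * (1 / P) = R ^ (k + 1) / (P : ℝ) ^ (k + 2) := by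
      rw [div_pow, pow_succ (P : ℝ) (k + 1)]; field_simp
    rw [hY] at hb'
    set φ := Phi l (pderiv i F) with hφ
    have hbd : |(φ : ℝ)| ≤ C3 i * (2 * R) ^ (k + 1) := hb i l (2 * R) hl (by positivity)
      (fun h hh i => (mem_bx.1 (hlb h hh) i).le)
    obtain ⟨sg, hsg, hsg2⟩ : ∃ sg : ℤ, |(sg : ℝ)| = 1 ∧ ((φ.natAbs : ℕ) : ℝ) = sg * φ := by
      have e : ((φ.natAbs : ℕ) : ℝ) = |(φ : ℝ)| := by
        rw [← Int.cast_abs, ← Int.natCast_natAbs]; simp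
      rcases abs_cases (φ : ℝ) with h | h
      · exact ⟨1, by simp, by rw [e, h.1]; simp⟩
      · exact ⟨-1, by simp, by rw [e, h.1]; simp⟩
    refine ⟨M ^ (k + 2) * φ.natAbs, ?_, ?_, sg * b, ?_⟩
    · exact Nat.one_le_iff_ne_zero.2 (mul_ne_zero (by positivity) (by simpa using hi))
    · have e : (φ.natAbs : ℝ) = |(φ : ℝ)| := by
        rw [← Int.cast_abs, ← Int.natCast_natAbs]; simp
      push_cast
      rw [e]
      have hle : C3 i ≤ ∑ i, C3 i := Finset.single_le_sum (f := C3) (fun i _ => by linarith [hC3 i]) (Finset.mem_univ i)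
      calc (M : ℝ) ^ (k + 2) * |(φ : ℝ)| ≤ M ^ (k + 2) * ((∑ i, C3 i) * (2 * R) ^ (k + 1)) := by
            gcongr; exact hbd.trans (by gcongr)
        _ = Cb * M ^ (k + 2) * R ^ (k + 1) := by rw [hCb, mul_pow]; ring
        _ ≤ _ := by gcongr; linarith
    · have e2 : ((M ^ (k + 2) * φ.natAbs : ℕ) : ℝ) * α - ((sg * b : ℤ) : ℝ) =
          sg * (α * M ^ (k + 2) * φ - b) := by
        push_cast; rw [hsg2]; ring
      rw [e2, abs_mul, hsg, one_mul]; exact hb'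
  · left
    push Not at hex
    have s1 := weyl_count k F hF P M hP a a1 b1 a2 b2 h1 h2 α
    have s2 := hit F (α * M ^ (k + 2)) P R hP' hR0 hRP (k + 1) 0 (1 / P) (by positivity) (by field_simp; rfl)
    simp only [zero_add] at s2
    have s3 : lsum (k + 1) (bx n (2 * R)) (nind F (α * M ^ (k + 2)) ((R / P) ^ (k + 1) * (1 / P))) ≤
        C2 * (2 * R) ^ (n * k) := by
      refine le_trans (lsum_mono _ _ _ _ fun l hl hlb => ?_) (hz (2 * R) (by linarith))
      unfold nind
      split_ifs with q1 q2 q2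
      · exact le_rfl
      · exact absurd (hex l hl hlb q1) q2
      · norm_num
      · norm_num
    have s2' : lsum (k + 1) (bx n (2 * P)) (fun l =>
        if ∀ i, nd (α * M ^ (k + 2) * Phi l (pderiv i F)) (1 / P) then 1 else 0) ≤
        (C1 * (P / R) ^ n) ^ (k + 1) * (C2 * (2 * R) ^ (n * k)) :=
      le_trans s2 (mul_le_mul_of_nonneg_left s3 (by positivity))
    obtain ⟨j, hj⟩ : ∃ j, K = k + 2 + j := ⟨K - k - 2, by omega⟩
    have e1 : K - 1 = k + 1 + j := by omega
    have e2 : K - k - 2 = j := by omega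
    calc ‖SS F a M a1 b1 a2 b2 α‖ ^ K * R ^ n ≤ (((P : ℝ) ^ n) ^ (K - 1) * (((3 * P : ℝ) ^ n) ^ (K - k - 2) *
       ((7 * (P : ℝ) ^ 2) ^ n * ((C1 * (P / R) ^ n) ^ (k + 1) * (C2 * (2 * R) ^ (n * k)))))) * R ^ n := by
          refine mul_le_mul_of_nonneg_right (s1.trans ?_) (by positivity)
          gcongr
      _ = Ca * ((P : ℝ) ^ (2 * n)) ^ K := by
          rw [hCa, e1, e2, hj]
          rw [div_pow, mul_pow C1, div_pow, mul_pow 2 R, mul_pow 3 (P : ℝ), mul_pow 7 ((P : ℝ) ^ 2),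
            mul_pow (3 ^ n)]
          have : (R ^ n) ^ (k + 1) = R ^ (n * k) * R ^ n := by ring
          rw [this]
          field_simp
          ring
      _ ≤ _ := by gcongr; linarith

end dich

section mean1
variable {n : ℕ}

lemma rho_exists (K : ℕ) (hK : 1 ≤ K) : ∃ ρ : ℝ, 0 < ρ ∧ ρ < 1 ∧ ρ ^ K = 1 / 2 := by
  refine ⟨(1 / 2 : ℝ) ^ (1 / (K : ℝ)), by positivity, ?_, ?_⟩
  · have : (0 : ℝ) < K := by exact_mod_cast hK
    exact Real.rpow_lt_one (by norm_num) (by norm_num) (by positivity)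
  · rw [← Real.rpow_natCast, ← Real.rpow_mul (by norm_num)]
    have : (K : ℝ) ≠ 0 := by positivity
    rw [one_div_mul_cancel this, Real.rpow_one]

/-- near at dyadic level `j` -/
def nearj (k P : ℕ) (A : ℝ) (j : ℕ) (α : ℝ) : Prop :=
  near (A * (2 ^ j) ^ (k + 1)) ((2 ^ j) ^ (k + 1) / (P : ℝ) ^ (k + 2)) α

lemma near.mono {Q Q' δ δ' α : ℝ} (h : near Q δ α) (hQ : Q ≤ Q') (hδ : δ ≤ δ') : near Q' δ' α := by
  obtain ⟨q, h1, h2, b, h3⟩ := h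
  exact ⟨q, h1, h2.trans hQ, b, h3.trans hδ⟩

lemma nearj_mono {k P : ℕ} {A A' : ℝ} (hA : 0 ≤ A) (hAA : A ≤ A') {i j : ℕ} (hij : i ≤ j) {α : ℝ}
    (h : nearj k P A i α) : nearj k P A' j α := by
  have : (2 : ℝ) ^ i ≤ 2 ^ j := pow_le_pow_right₀ (by norm_num) hij
  have : 0 ≤ A' := hA.trans hAA
  refine near.mono h ?_ ?_ <;> gcongr

lemma weylSS (hn : 0 < n) (k : ℕ) (hnk : 2 * (k + 1) * 2 ^ (k + 1) + 1 ≤ n)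
    (F : MvPolynomial (Fin n) ℤ) (hF : F.IsHomogeneous (k + 2))
    (hs : SmoothF F) : ∃ C ρ : ℝ, 1 ≤ C ∧ 0 < ρ ∧ ρ < 1 ∧ ∀ (P M : ℕ), 1 ≤ P → 1 ≤ M →
      ∀ (a a1 b1 a2 b2 : Fin n → ℤ),
      (∀ i, b1 i < a1 i + P) → (∀ i, b2 i < a2 i + P) → ∀ (α : ℝ) (j : ℕ), (2 : ℝ) ^ j ≤ P →
      ‖SS F a M a1 b1 a2 b2 α‖ ≤ C * (P : ℝ) ^ (2 * n) * ρ ^ j / ((4 : ℝ) ^ (k + 1)) ^ j ∨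
      nearj k P (C * M ^ (k + 2)) j α := by
  obtain ⟨C, hC, h⟩ := dichotomy hn k F hF hs
  set K := 2 ^ (k + 1) with hK
  have hK1 : 1 ≤ K := Nat.one_le_two_pow
  obtain ⟨ρ, h0, h1, hρ⟩ := rho_exists K hK1
  refine ⟨C, ρ, hC, h0, h1, fun P M hP hM a a1 b1 a2 b2 hb1 hb2 α j hj => ?_⟩
  rcases h P M hP hM a a1 b1 a2 b2 hb1 hb2 α (2 ^ j) (one_le_pow₀ (by norm_num)) hj with h | h
  · left
    refine le_of_pow_le_pow_left₀ (n := K) (by omega) (by positivity) ?_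
    set s := ‖SS F a M a1 b1 a2 b2 α‖
    have e1 : ((2 : ℝ) ^ j) ^ (2 * (k + 1) * K + 1) ≤ (2 ^ j) ^ n :=
      pow_le_pow_right₀ (one_le_pow₀ (by norm_num)) hnk
    have e2 : s ^ K * ((2 : ℝ) ^ j) ^ (2 * (k + 1) * K + 1) ≤ C * ((P : ℝ) ^ (2 * n)) ^ K :=
      (mul_le_mul_of_nonneg_left e1 (by positivity)).trans h
    have e3 : C ≤ C ^ K := le_self_pow₀ hC (by omega)
    have e4 : (C * (P : ℝ) ^ (2 * n) * ρ ^ j / ((4 : ℝ) ^ (k + 1)) ^ j) ^ K =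
        C ^ K * ((P : ℝ) ^ (2 * n)) ^ K / ((2 : ℝ) ^ j) ^ (2 * (k + 1) * K + 1) := by
      rw [div_pow, mul_pow, mul_pow]
      have : (ρ ^ j) ^ K = 1 / 2 ^ j := by rw [← pow_mul, mul_comm, pow_mul, hρ]; simp
      rw [this]
      have : (((4 : ℝ) ^ (k + 1)) ^ j) ^ K = (2 ^ j) ^ (2 * (k + 1) * K) := by
        rw [show (4 : ℝ) = 2 ^ 2 by norm_num]; simp only [← pow_mul]; congr 1; ring
      rw [this, pow_succ (2 ^ j)]
      field_simp
    rw [e4, le_div_iff₀ (by positivity)]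
    exact e2.trans (by gcongr)
  · right; exact h

/-- residues -/
def rs (n m : ℕ) : Finset (Fin n → ℤ) := Fintype.piFinset fun _ => Finset.Ico 0 (m : ℤ)

lemma mem_rs {m : ℕ} {u : Fin n → ℤ} : u ∈ rs n m ↔ ∀ i, 0 ≤ u i ∧ u i < m := by
  simp [rs, Fintype.mem_piFinset]

lemma card_rs (n m : ℕ) : (rs n m).card = m ^ n := by
  simp [rs, Fintype.card_piFinset]

/-- congruence of vectors -/
def cg (M : ℕ) (x a : Fin n → ℤ) : Prop := ∀ i, (M : ℤ) ∣ x i - a i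

/-- reduction -/
def red (m : ℕ) (x : Fin n → ℤ) : Fin n → ℤ := fun i => x i % m

lemma red_mem {m : ℕ} (hm : 1 ≤ m) (x : Fin n → ℤ) : red m x ∈ rs n m := mem_rs.2 fun i =>
  ⟨Int.emod_nonneg _ (by omega), Int.emod_lt_of_pos _ (by omega)⟩

lemma cg_red (m : ℕ) (x : Fin n → ℤ) : cg m (red m x) x := fun i =>
  Int.ModEq.dvd (Int.mod_modEq (x i) m).symm

lemma cg.symm {m : ℕ} {x y : Fin n → ℤ} (h : cg m x y) : cg m y x := fun i => by
  have := (h i).neg_right; simpa using this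

lemma cg.trans {m : ℕ} {x y z : Fin n → ℤ} (h : cg m x y) (h' : cg m y z) : cg m x z := fun i => by
  have := dvd_add (h i) (h' i); simpa using this

lemma cg.refl (m : ℕ) (x : Fin n → ℤ) : cg m x x := fun i => by simp

lemma red_eq_iff {m : ℕ} {x y : Fin n → ℤ} : red m x = red m y ↔ cg m x y := by
  constructor
  · intro h i
    have : x i % m = y i % m := congrFun h i
    exact Int.ModEq.dvd (this.symm : y i ≡ x i [ZMOD m])
  · intro h; funext i
    exact ((Int.modEq_iff_dvd.2 (h i)).symm : x i ≡ y i [ZMOD m])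

lemma red_of_mem {m : ℕ} {x : Fin n → ℤ} (hx : x ∈ rs n m) : red m x = x := by
  funext i
  exact Int.emod_eq_of_lt (mem_rs.1 hx i).1 (mem_rs.1 hx i).2

/-- symmetric box -/
def Bx (n P : ℕ) : Finset (Fin n → ℤ) := Finset.Icc (fun _ => -(P : ℤ)) (fun _ => (P : ℤ))

lemma mem_Bx {P : ℕ} {x : Fin n → ℤ} : x ∈ Bx n P ↔ ∀ i, -(P : ℤ) ≤ x i ∧ x i ≤ P := by
  simp [Bx, Pi.le_def, forall_and]

lemma card_Bx (n P : ℕ) : ((Bx n P).card : ℝ) ≤ ((2 * P + 1 : ℕ) : ℝ) ^ n := by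
  refine card_box _ _ _ fun i => ?_
  push_cast; linarith

lemma add_smul_app (b y : Fin n → ℤ) (M : ℕ) (i : Fin n) : (b + M • y) i = b i + M * y i := by simp

/-- sub-progression of box -/
lemma sum_prog (P M : ℕ) (hM : 1 ≤ M) (b : Fin n → ℤ) (g : (Fin n → ℤ) → ℂ) :
    ∑ y ∈ (Bx n P).filter (fun y => cg M y b), g y =
      ∑ y ∈ Finset.Icc (fun i => -((b i + P) / M)) (fun i => (P - b i) / M), g (b + M • y) := by
  have hM' : (0 : ℤ) < M := by omega
  refine Finset.sum_bij' (fun y _ => fun i => (y i - b i) / M) (fun y _ => b + M • y) ?_ ?_ ?_ ?_ ?_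
  · intro y hy
    rw [Finset.mem_filter, mem_Bx] at hy
    rw [Finset.mem_Icc]
    constructor
    · intro i
      obtain ⟨c, hc⟩ := hy.2 i
      have h1 := (hy.1 i).1
      show -((b i + P) / M) ≤ (y i - b i) / M
      rw [hc, Int.mul_ediv_cancel_left _ hM'.ne', neg_le]
      rw [Int.le_ediv_iff_mul_le hM']; nlinarith
    · intro i
      have h1 := (hy.1 i).2
      exact Int.ediv_le_ediv hM' (by linarith)
  · intro y hy
    rw [Finset.mem_Icc] at hy
    rw [Finset.mem_filter, mem_Bx]
    refine ⟨fun i => ?_, fun i => ⟨y i, by simp⟩⟩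
    have h1 : -((b i + P) / M) ≤ y i := hy.1 i
    have h2 : y i ≤ (P - b i) / M := hy.2 i
    rw [neg_le, Int.le_ediv_iff_mul_le hM'] at h1
    rw [Int.le_ediv_iff_mul_le hM'] at h2
    rw [add_smul_app]
    constructor <;> nlinarith
  · intro y hy
    rw [Finset.mem_filter] at hy
    funext i
    obtain ⟨c, hc⟩ := hy.2 i
    rw [add_smul_app]
    rw [hc, Int.mul_ediv_cancel_left _ hM'.ne']; linarith
  · intro y hy
    funext i
    simp [Int.mul_ediv_cancel_left _ hM'.ne']
  · intro y hy
    congr 1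
    rw [Finset.mem_filter] at hy
    funext i
    obtain ⟨c, hc⟩ := hy.2 i
    rw [add_smul_app]
    rw [hc, Int.mul_ediv_cancel_left _ hM'.ne']; linarith

lemma prog_sides (P M : ℕ) (hM : 1 ≤ M) (b : ℤ) :
    (P - b) / M < -((b + P) / M) + ((2 * P + 1 : ℕ) : ℤ) := by
  have hM' : (0 : ℤ) < M := by omega
  have h1 : (P - b) / M * M ≤ P - b := Int.ediv_mul_le _ hM'.ne'
  have h2 : (b + P) / M * M ≤ b + P := Int.ediv_mul_le _ hM'.ne'
  push_cast
  by_contra hc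
  push Not at hc
  nlinarith

/-- exponential sum over a residue class -/
def Sa (F : MvPolynomial (Fin n) ℤ) (P M : ℕ) (a : Fin n → ℤ) (α : ℝ) : ℂ :=
  ∑ y ∈ Bx n P, ∑ z ∈ (Bx n P).filter (fun z => cg M (y + z) a), ee (α * (eval (y + z) F : ℤ))

lemma Sa_eq (F : MvPolynomial (Fin n) ℤ) (P M : ℕ) (hM : 1 ≤ M) (a : Fin n → ℤ) (α : ℝ) :
    Sa F P M a α = ∑ b ∈ rs n M, SS F a M (fun i => -((b i + P) / M)) (fun i => (P - b i) / M)
      (fun i => -((a i - b i + P) / M)) (fun i => (P - (a i - b i)) / M) α := by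
  unfold Sa
  rw [← Finset.sum_fiberwise_of_maps_to (t := rs n M) (g := red M) (fun y _ => red_mem hM y)]
  refine Finset.sum_congr rfl fun b hb => ?_
  have e1 : (Bx n P).filter (fun y => red M y = b) = (Bx n P).filter (fun y => cg M y b) := by
    refine Finset.filter_congr fun y _ => ?_
    nth_rewrite 1 [← red_of_mem hb]
    exact red_eq_iff
  rw [e1, sum_prog P M hM b]
  unfold SS
  refine Finset.sum_congr rfl fun y _ => ?_
  have e2 : (Bx n P).filter (fun z => cg M (b + M • y + z) a) =
      (Bx n P).filter (fun z => cg M z (a - b)) := by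
    refine Finset.filter_congr fun z _ => forall_congr' fun i => ?_
    rw [Pi.add_apply, add_smul_app, Pi.sub_apply]
    rw [show b i + M * y i + z i - a i = M * y i + (z i - (a i - b i)) by ring]
    exact (Int.dvd_add_right (dvd_mul_right _ _))
  rw [e2, sum_prog P M hM (a - b)]
  refine Finset.sum_congr rfl fun z _ => ?_
  congr 5
  funext i; simp; ring

lemma weylSa (hn : 0 < n) (k : ℕ) (hnk : 2 * (k + 1) * 2 ^ (k + 1) + 1 ≤ n)
    (F : MvPolynomial (Fin n) ℤ) (hF : F.IsHomogeneous (k + 2))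
    (hs : SmoothF F) : ∃ C ρ : ℝ, 1 ≤ C ∧ 0 < ρ ∧ ρ < 1 ∧ ∀ (P M : ℕ), 1 ≤ P → 1 ≤ M →
      ∀ (a : Fin n → ℤ) (α : ℝ) (j : ℕ), (2 : ℝ) ^ j ≤ (2 * P + 1 : ℕ) →
      ‖Sa F P M a α‖ ≤ M ^ n * (C * ((2 * P + 1 : ℕ) : ℝ) ^ (2 * n)) * ρ ^ j / ((4 : ℝ) ^ (k + 1)) ^ j ∨
      nearj k (2 * P + 1) (C * M ^ (k + 2)) j α := by
  obtain ⟨C, ρ, hC, h0, h1, h⟩ := weylSS hn k hnk F hF hs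
  refine ⟨C, ρ, hC, h0, h1, fun P M hP hM a α j hj => ?_⟩
  by_cases hc : nearj k (2 * P + 1) (C * M ^ (k + 2)) j α
  · exact Or.inr hc
  left
  rw [Sa_eq F P M hM]
  refine (norm_sum_le _ _).trans ?_
  have : ∀ b ∈ rs n M, ‖SS F a M (fun i => -((b i + P) / M)) (fun i => (P - b i) / M)
      (fun i => -((a i - b i + P) / M)) (fun i => (P - (a i - b i)) / M) α‖ ≤
      C * ((2 * P + 1 : ℕ) : ℝ) ^ (2 * n) * ρ ^ j / ((4 : ℝ) ^ (k + 1)) ^ j := fun b _ =>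
    (h (2 * P + 1) M (by omega) hM a _ _ _ _ (fun i => prog_sides P M hM (b i))
      (fun i => prog_sides P M hM (a i - b i)) α j hj).resolve_right hc
  refine (Finset.sum_le_sum this).trans (le_of_eq ?_)
  rw [Finset.sum_const, card_rs, nsmul_eq_mul]
  push_cast; ring

end mean1

section mean2

lemma card_real_Icc (S : Finset ℕ) (u v : ℝ) (huv : u ≤ v + 1) (h : ∀ t ∈ S, u ≤ t ∧ (t : ℝ) ≤ v) :
    (S.card : ℝ) ≤ v - u + 1 := by
  have h1 : S.image (fun t : ℕ => (t : ℤ)) ⊆ Finset.Icc ⌈u⌉ ⌊v⌋ := by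
    intro z hz
    obtain ⟨t, ht, rfl⟩ := Finset.mem_image.1 hz
    rw [Finset.mem_Icc]
    exact ⟨Int.ceil_le.2 (by exact_mod_cast (h t ht).1), Int.le_floor.2 (by exact_mod_cast (h t ht).2)⟩
  have h2 := Finset.card_le_card h1
  rw [Finset.card_image_of_injective _ Nat.cast_injective, Int.card_Icc] at h2
  have h3 : (S.card : ℝ) ≤ (((⌊v⌋ + 1 - ⌈u⌉).toNat : ℤ) : ℝ) := by exact_mod_cast h2
  refine h3.trans ?_
  rw [Int.toNat_eq_max]
  push_cast
  refine max_le ?_ (by linarith)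
  linarith [Int.floor_le v, Int.le_ceil u]

lemma near_count (Q δ : ℝ) (hQ : 0 ≤ Q) (hδ : 0 < δ) (hδ1 : δ ≤ 1) (L : ℕ) (hL : 1 ≤ L)
    (h : 4 * Q ≤ δ * L) :
    (((Finset.range L).filter fun t : ℕ => near Q δ ((t : ℝ) / L)).card : ℝ) ≤ 9 * Q * δ * L := by
  have hL0 : (0 : ℝ) < L := by exact_mod_cast hL
  have hsub : ((Finset.range L).filter fun t : ℕ => near Q δ ((t : ℝ) / L)) ⊆
      (Finset.Icc 1 ⌊Q⌋₊).biUnion fun q : ℕ => (Finset.Icc (-1 : ℤ) (q + 1)).biUnion fun b : ℤ =>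
        (Finset.range L).filter fun t : ℕ => |(q : ℝ) * ((t : ℝ) / L) - b| ≤ δ := by
    intro t ht
    rw [Finset.mem_filter, Finset.mem_range] at ht
    obtain ⟨htL, q, h1, h2, b, h3⟩ := ht
    simp only [Finset.mem_biUnion, Finset.mem_filter, Finset.mem_Icc, Finset.mem_range]
    refine ⟨q, ⟨h1, Nat.le_floor h2⟩, b, ?_, htL, h3⟩
    have h4 := abs_le.1 (h3.trans hδ1)
    have h5 : (t : ℝ) / L ≤ 1 := by rw [div_le_one hL0]; exact_mod_cast htL.le
    have h6 : 0 ≤ (t : ℝ) / L := by positivity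
    have h7 : (0 : ℝ) ≤ q := by positivity
    constructor
    · have : (-1 : ℝ) ≤ b := by nlinarith
      exact_mod_cast this
    · have : (b : ℝ) ≤ q + 1 := by nlinarith
      exact_mod_cast this
  have hcard : ∀ q ∈ Finset.Icc 1 ⌊Q⌋₊, ((((Finset.Icc (-1 : ℤ) (q + 1)).biUnion fun b : ℤ =>
        (Finset.range L).filter fun t : ℕ => |(q : ℝ) * ((t : ℝ) / L) - b| ≤ δ).card : ℕ) : ℝ) ≤
        8 * δ * L + 4 * Q := by
    intro q hq
    rw [Finset.mem_Icc] at hq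
    have hq1 : (1 : ℝ) ≤ q := by exact_mod_cast hq.1
    have hqQ : (q : ℝ) ≤ Q := (Nat.le_floor_iff hQ).1 hq.2
    have h0 : (((Finset.Icc (-1 : ℤ) (q + 1)).biUnion fun b : ℤ =>
        (Finset.range L).filter fun t : ℕ => |(q : ℝ) * ((t : ℝ) / L) - b| ≤ δ).card : ℝ) ≤
        ∑ b ∈ Finset.Icc (-1 : ℤ) (q + 1), (2 * δ * L / q + 1) := by
      refine (Nat.cast_le.2 Finset.card_biUnion_le).trans ?_
      push_cast
      refine Finset.sum_le_sum fun b _ => ?_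
      refine (card_real_Icc _ ((b - δ) * L / q) ((b + δ) * L / q) ?_ ?_).trans (le_of_eq ?_)
      · have : (b - δ) * L / q ≤ (b + δ) * L / q := by gcongr; linarith
        linarith
      · intro t ht
        have h3 := abs_le.1 (Finset.mem_filter.1 ht).2
        have e : (t : ℝ) = (q * (t / L)) * L / q := by field_simp
        constructor
        · rw [e]; gcongr; linarith
        · rw [e]; gcongr; linarith
      · field_simp; ring
    refine h0.trans ?_
    rw [Finset.sum_const, Int.card_Icc, nsmul_eq_mul]
    have e : (((q : ℤ) + 1 + 1 - -1).toNat : ℝ) = q + 3 := by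
      have : ((q : ℤ) + 1 + 1 - -1).toNat = q + 3 := by omega
      rw [this]; push_cast; ring
    rw [e]
    have e2 : ((q : ℝ) + 3) * (2 * δ * L / q + 1) = 2 * δ * L + 6 * δ * L / q + q + 3 := by
      field_simp; ring
    have e3 : 6 * δ * L / q ≤ 6 * δ * L := div_le_self (by positivity) hq1
    rw [e2]; linarith
  have h1 := (Finset.card_le_card hsub).trans Finset.card_biUnion_le
  have h2 : (((Finset.range L).filter fun t : ℕ => near Q δ ((t : ℝ) / L)).card : ℝ) ≤
      ∑ q ∈ Finset.Icc 1 ⌊Q⌋₊, (8 * δ * L + 4 * Q) := by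
    refine (Nat.cast_le.2 h1).trans ?_
    push_cast
    exact Finset.sum_le_sum hcard
  refine h2.trans ?_
  rw [Finset.sum_const, Nat.card_Icc, nsmul_eq_mul]
  have h3 : ((⌊Q⌋₊ + 1 - 1 : ℕ) : ℝ) ≤ Q := by simpa using Nat.floor_le hQ
  calc _ ≤ Q * (8 * δ * L + 4 * Q) := by gcongr
    _ ≤ Q * (8 * δ * L + δ * L) := by gcongr
    _ = _ := by ring

lemma nearj_count (k P : ℕ) (hP : 1 ≤ P) (A : ℝ) (hA : 1 ≤ A) (j : ℕ) (hj : (2 : ℝ) ^ j ≤ P) (L : ℕ)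
    (hL : 4 * A * (P : ℝ) ^ (k + 2) ≤ L) :
    (((Finset.range L).filter fun t : ℕ => nearj k P A j ((t : ℝ) / L)).card : ℝ) ≤
      9 * A * ((4 : ℝ) ^ (k + 1)) ^ j * L / (P : ℝ) ^ (k + 2) := by
  have hP1 : (1 : ℝ) ≤ P := by exact_mod_cast hP
  have hL1 : (1 : ℝ) ≤ L := by
    have : (1 : ℝ) ≤ (P : ℝ) ^ (k + 2) := one_le_pow₀ hP1
    nlinarith
  refine (near_count _ _ (by positivity) (by positivity) ?_ L (by exact_mod_cast hL1) ?_).trans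
    (le_of_eq ?_)
  · rw [div_le_one (by positivity)]
    calc ((2 : ℝ) ^ j) ^ (k + 1) ≤ (P : ℝ) ^ (k + 1) := by gcongr
      _ ≤ _ := pow_le_pow_right₀ hP1 (by omega)
  · rw [div_mul_eq_mul_div, le_div_iff₀ (by positivity)]
    have : (0 : ℝ) < (2 ^ j) ^ (k + 1) := by positivity
    nlinarith
  · rw [show (4 : ℝ) = 2 * 2 by norm_num, mul_pow, mul_pow]
    have : ((2 : ℝ) ^ j) ^ (k + 1) = (2 ^ (k + 1)) ^ j := by rw [← pow_mul, ← pow_mul, mul_comm]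
    rw [this]; ring

lemma mean_bound (k : ℕ) (ρ : ℝ) (h0 : 0 < ρ) (h1 : ρ < 1) : ∃ C : ℝ, 1 ≤ C ∧ ∀ (P : ℕ) (A T : ℝ)
    (f : ℝ → ℝ), 1 ≤ P → 1 ≤ A → 0 ≤ T →
    (∀ α (j : ℕ), (2 : ℝ) ^ j ≤ P → f α ≤ T * ρ ^ j / ((4 : ℝ) ^ (k + 1)) ^ j ∨ nearj k P A j α) →
    ∀ j0 : ℕ, (2 : ℝ) ^ j0 ≤ P → ∀ L : ℕ, 4 * A * (P : ℝ) ^ (k + 2) ≤ L →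
    ∑ t ∈ (Finset.range L).filter (fun t : ℕ => ¬ nearj k P A j0 ((t : ℝ) / L)), f ((t : ℝ) / L) ≤
      C * A * T * ρ ^ j0 * L / (P : ℝ) ^ (k + 2) := by
  refine ⟨9 * 4 ^ (k + 1) / (1 - ρ) + 4 ^ (k + 1), ?_, ?_⟩
  · have : 0 ≤ 9 * (4 : ℝ) ^ (k + 1) / (1 - ρ) := div_nonneg (by positivity) (by linarith)
    have : (1 : ℝ) ≤ 4 ^ (k + 1) := one_le_pow₀ (by norm_num)
    linarith
  intro P A T f hP hA hT hf j0 hj0 L hL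
  have hP1 : (1 : ℝ) ≤ P := by exact_mod_cast hP
  set g : ℕ → ℝ := fun j => T * ρ ^ j / ((4 : ℝ) ^ (k + 1)) ^ j with hg
  have hg0 : ∀ j, 0 ≤ g j := fun j => by positivity
  set J := Nat.log 2 P with hJ
  have hJP : (2 : ℝ) ^ J ≤ P := by exact_mod_cast Nat.pow_log_le_self 2 (by omega)
  have hJP' : (P : ℝ) ≤ 2 ^ (J + 1) := by exact_mod_cast (Nat.lt_pow_succ_log_self (by norm_num) P).le
  have hj0J : j0 ≤ J := Nat.le_log_of_pow_le (by norm_num) (by exact_mod_cast hj0)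
  have hjP : ∀ j, j ≤ J → (2 : ℝ) ^ j ≤ P := fun j hj =>
    (pow_le_pow_right₀ (by norm_num) hj).trans hJP
  have hper : ∀ α, ¬ nearj k P A j0 α → f α ≤
      ∑ j ∈ Finset.Ico j0 J, (if nearj k P A (j + 1) α then g j else 0) + g J := by
    intro α hα
    have hs0 : ∀ j ∈ Finset.Ico j0 J, 0 ≤ (if nearj k P A (j + 1) α then g j else 0) := by
      intro j _; split_ifs; exacts [hg0 j, le_rfl]
    by_cases hJn : nearj k P A J α
    · have hex : ∃ j, nearj k P A j α := ⟨J, hJn⟩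
      have hm := Nat.find_spec hex
      have hle := Nat.find_min' hex hJn
      set j := Nat.find hex with hjdef
      have hjj : j0 < j := by
        by_contra hc
        push Not at hc
        exact hα (nearj_mono (by linarith) le_rfl hc hm)
      obtain ⟨i, hi⟩ : ∃ i, j = i + 1 := ⟨j - 1, by omega⟩
      have hni : ¬ nearj k P A i α := Nat.find_min hex (by omega)
      have hfi := (hf α i (hjP i (by omega))).resolve_right hni
      have hmem : i ∈ Finset.Ico j0 J := by rw [Finset.mem_Ico]; omega
      have hs := Finset.single_le_sum hs0 hmem
      rw [← hi, if_pos hm] at hs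
      have := hg0 J
      calc f α ≤ g i := hfi
        _ ≤ _ := by linarith
    · have := (hf α J hJP).resolve_right hJn
      have h2 := Finset.sum_nonneg hs0
      linarith
  have hL0 : (0 : ℝ) ≤ L := by positivity
  have hx : ∀ j ∈ Finset.Ico j0 J, ∑ t ∈ Finset.range L,
      (if nearj k P A (j + 1) ((t : ℝ) / L) then g j else 0) ≤
      9 * 4 ^ (k + 1) * A * T * L / (P : ℝ) ^ (k + 2) * ρ ^ j := by
    intro j hj
    rw [Finset.mem_Ico] at hj
    rw [← Finset.sum_filter, Finset.sum_const, nsmul_eq_mul]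
    have := nearj_count k P hP A hA (j + 1) (hjP _ (by omega)) L hL
    refine (mul_le_mul_of_nonneg_right this (hg0 j)).trans (le_of_eq ?_)
    simp only [hg]
    rw [pow_succ (4 ^ (k + 1)) j]
    field_simp
  have hgeo : ∑ j ∈ Finset.Ico j0 J, ρ ^ j ≤ ρ ^ j0 / (1 - ρ) := by
    exact geom_sum_Ico_le_of_lt_one h0.le h1
  have hlast : g J ≤ 4 ^ (k + 1) * T * ρ ^ j0 / (P : ℝ) ^ (k + 2) := by
    simp only [hg]
    rw [div_le_div_iff₀ (by positivity) (by positivity)]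
    have e1 : ρ ^ J ≤ ρ ^ j0 := pow_le_pow_of_le_one h0.le h1.le hj0J
    have e2 : (P : ℝ) ^ (k + 2) ≤ 4 ^ (k + 1) * (4 ^ (k + 1)) ^ J := by
      calc (P : ℝ) ^ (k + 2) ≤ P ^ (2 * (k + 1)) := pow_le_pow_right₀ hP1 (by omega)
        _ ≤ (2 ^ (J + 1)) ^ (2 * (k + 1)) := by gcongr
        _ = _ := by
          rw [show (4 : ℝ) = 2 ^ 2 by norm_num]; simp only [← pow_mul, ← pow_add]; congr 1; ring
    calc T * ρ ^ J * (P : ℝ) ^ (k + 2) ≤ T * ρ ^ j0 * (4 ^ (k + 1) * (4 ^ (k + 1)) ^ J) := by gcongr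
      _ = _ := by ring
  calc ∑ t ∈ (Finset.range L).filter (fun t : ℕ => ¬ nearj k P A j0 ((t : ℝ) / L)), f ((t : ℝ) / L)
      ≤ ∑ t ∈ (Finset.range L).filter (fun t : ℕ => ¬ nearj k P A j0 ((t : ℝ) / L)),
        (∑ j ∈ Finset.Ico j0 J, (if nearj k P A (j + 1) ((t : ℝ) / L) then g j else 0) + g J) :=
        Finset.sum_le_sum fun t ht => hper _ (Finset.mem_filter.1 ht).2
    _ ≤ ∑ t ∈ Finset.range L,
        (∑ j ∈ Finset.Ico j0 J, (if nearj k P A (j + 1) ((t : ℝ) / L) then g j else 0) + g J) := by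
        refine Finset.sum_le_sum_of_subset_of_nonneg (Finset.filter_subset _ _) fun t _ _ => ?_
        refine add_nonneg (Finset.sum_nonneg fun j _ => ?_) (hg0 J)
        split_ifs
        exacts [hg0 j, le_rfl]
    _ = ∑ j ∈ Finset.Ico j0 J, ∑ t ∈ Finset.range L,
        (if nearj k P A (j + 1) ((t : ℝ) / L) then g j else 0) + L * g J := by
        rw [Finset.sum_add_distrib, Finset.sum_comm]; simp
    _ ≤ ∑ j ∈ Finset.Ico j0 J, 9 * 4 ^ (k + 1) * A * T * L / (P : ℝ) ^ (k + 2) * ρ ^ j +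
        L * (A * (4 ^ (k + 1) * T * ρ ^ j0 / (P : ℝ) ^ (k + 2))) := by
        refine add_le_add (Finset.sum_le_sum hx) ?_
        refine mul_le_mul_of_nonneg_left (hlast.trans ?_) hL0
        exact le_mul_of_one_le_left (by positivity) hA
    _ ≤ 9 * 4 ^ (k + 1) * A * T * L / (P : ℝ) ^ (k + 2) * (ρ ^ j0 / (1 - ρ)) +
        L * (A * (4 ^ (k + 1) * T * ρ ^ j0 / (P : ℝ) ^ (k + 2))) := by
        rw [← Finset.mul_sum]; gcongr
    _ = _ := by
        have : 1 - ρ ≠ 0 := by linarith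
        field_simp

/-- orthogonality -/
lemma orth (L : ℕ) (hL : 1 ≤ L) (m : ℤ) (hm : |m| < L) :
    ∑ t ∈ Finset.range L, ee ((t : ℝ) / L * m) = if m = 0 then (L : ℂ) else 0 := by
  have hL0 : (L : ℝ) ≠ 0 := by positivity
  split_ifs with h
  · subst h; simp [ee_zero]
  · have hne : ee ((m : ℝ) / L) ≠ 1 := by
      intro hc
      unfold ee at hc
      rw [Complex.exp_eq_one_iff] at hc
      obtain ⟨j, hj⟩ := hc
      have hpi : (2 * Real.pi * Complex.I : ℂ) ≠ 0 := Complex.two_pi_I_ne_zero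
      have : ((m : ℝ) / L : ℝ) = (j : ℝ) := by
        have h1 : (((m : ℝ) / L : ℝ) : ℂ) = ((j : ℝ) : ℂ) := by
          apply mul_left_cancel₀ hpi
          rw [show ((j : ℝ) : ℂ) = (j : ℂ) by norm_cast]
          push_cast at hj ⊢; linear_combination hj
        exact_mod_cast h1
      rw [div_eq_iff hL0] at this
      have h2 : m = j * L := by exact_mod_cast this
      have h3 : (L : ℤ) ∣ m := ⟨j, by rw [h2]; ring⟩
      exact h (Int.eq_zero_of_abs_lt_dvd h3 hm)
    have hg : ∀ t : ℕ, ee ((t : ℝ) / L * m) = (ee ((m : ℝ) / L)) ^ t := by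
      intro t
      induction t with
      | zero => simp [ee_zero]
      | succ t ih => rw [pow_succ, ← ih, ← ee_add]; congr 1; push_cast; ring
    simp_rw [hg]
    rw [geom_sum_eq hne]
    rw [← hg L]
    rw [show (L : ℝ) / L * m = (m : ℤ) by field_simp, ee_int]; simp

end mean2

section mean3
variable {n : ℕ}

/-- weighted number of zeros in a class -/
def ra (F : MvPolynomial (Fin n) ℤ) (P M : ℕ) (a : Fin n → ℤ) : ℝ :=
  ∑ y ∈ Bx n P, ∑ z ∈ (Bx n P).filter (fun z => cg M (y + z) a), if eval (y + z) F = 0 then 1 else 0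

lemma ra_eq (F : MvPolynomial (Fin n) ℤ) (P : ℕ) : ∃ L0 : ℕ, 1 ≤ L0 ∧ ∀ L, L0 ≤ L → ∀ M a,
    ((L * ra F P M a : ℝ) : ℂ) = ∑ t ∈ Finset.range L, Sa F P M a ((t : ℝ) / L) := by
  set L0 := ∑ y ∈ Bx n P, ∑ z ∈ Bx n P, (eval (y + z) F).natAbs + 1 with hL0
  refine ⟨L0, by omega, fun L hL M a => ?_⟩
  unfold Sa ra
  rw [Finset.sum_comm]
  push_cast
  rw [Finset.mul_sum]
  refine Finset.sum_congr rfl fun y hy => ?_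
  rw [Finset.sum_comm, Finset.mul_sum]
  refine Finset.sum_congr rfl fun z hz => ?_
  rw [orth L (by omega)]
  · split_ifs <;> simp
  · have h1 : (eval (y + z) F).natAbs ≤ ∑ z ∈ Bx n P, (eval (y + z) F).natAbs :=
      Finset.single_le_sum (f := fun z => (eval (y + z) F).natAbs) (fun _ _ => Nat.zero_le _)
        (Finset.mem_filter.1 hz).1
    have h2 : ∑ z ∈ Bx n P, (eval (y + z) F).natAbs ≤
        ∑ y ∈ Bx n P, ∑ z ∈ Bx n P, (eval (y + z) F).natAbs :=
      Finset.single_le_sum (f := fun y => ∑ z ∈ Bx n P, (eval (y + z) F).natAbs)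
        (fun _ _ => Nat.zero_le _) hy
    rw [Int.abs_eq_natAbs]; omega

lemma Sa_triv (F : MvPolynomial (Fin n) ℤ) (P M : ℕ) (a : Fin n → ℤ) (α : ℝ) :
    ‖Sa F P M a α‖ ≤ ((2 * P + 1 : ℕ) : ℝ) ^ (2 * n) := by
  unfold Sa
  have h0 := card_Bx n P
  have h1 : ∀ y ∈ Bx n P, ‖∑ z ∈ (Bx n P).filter (fun z => cg M (y + z) a),
      ee (α * (eval (y + z) F : ℤ))‖ ≤ ((2 * P + 1 : ℕ) : ℝ) ^ n := by
    intro y _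
    refine (norm_sum_le _ _).trans ?_
    simp only [norm_ee, Finset.sum_const, nsmul_eq_mul, mul_one]
    exact (Nat.cast_le.2 (Finset.card_filter_le _ _)).trans h0
  refine (norm_sum_le _ _).trans ((Finset.sum_le_sum h1).trans ?_)
  rw [Finset.sum_const, nsmul_eq_mul, two_mul n, pow_add]
  gcongr

lemma ra_mean (hn : 0 < n) (k : ℕ) (hnk : 2 * (k + 1) * 2 ^ (k + 1) + 1 ≤ n)
    (F : MvPolynomial (Fin n) ℤ) (hF : F.IsHomogeneous (k + 2)) (hs : SmoothF F) :
    ∃ C ρ : ℝ, 1 ≤ C ∧ 0 < ρ ∧ ρ < 1 ∧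
    (∀ P, 1 ≤ P → ∀ a, ra F P 1 a ≤ C * ((2 * P + 1 : ℕ) : ℝ) ^ (2 * n) / ((2 * P + 1 : ℕ) : ℝ) ^ (k + 2)) ∧
    (∀ P M : ℕ, 1 ≤ P → 1 ≤ M → ∀ a a' (j0 : ℕ), (2 : ℝ) ^ j0 ≤ (2 * P + 1 : ℕ) → ∀ E : ℝ, 0 ≤ E →
      (∀ α, nearj k (2 * P + 1) (C * M ^ (k + 2)) j0 α → ‖Sa F P M a α - Sa F P M a' α‖ ≤ E) →
      |ra F P M a - ra F P M a'| ≤ C * M ^ (n + k + 2) / ((2 * P + 1 : ℕ) : ℝ) ^ (k + 2) *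
        (ρ ^ j0 * ((2 * P + 1 : ℕ) : ℝ) ^ (2 * n) + ((4 : ℝ) ^ (k + 1)) ^ j0 * E)) := by
  obtain ⟨C, ρ, hC, h0, h1, hw⟩ := weylSa hn k hnk F hF hs
  obtain ⟨C2, hC2, hm⟩ := mean_bound k ρ h0 h1
  have key : ∀ P M : ℕ, 1 ≤ P → 1 ≤ M → ∀ a (j0 : ℕ), (2 : ℝ) ^ j0 ≤ (2 * P + 1 : ℕ) → ∀ L : ℕ,
      4 * (C * M ^ (k + 2)) * ((2 * P + 1 : ℕ) : ℝ) ^ (k + 2) ≤ L →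
      ∑ t ∈ (Finset.range L).filter (fun t : ℕ => ¬ nearj k (2 * P + 1) (C * M ^ (k + 2)) j0 ((t : ℝ) / L)),
        ‖Sa F P M a ((t : ℝ) / L)‖ ≤
      C2 * (C * M ^ (k + 2)) * (M ^ n * (C * ((2 * P + 1 : ℕ) : ℝ) ^ (2 * n))) * ρ ^ j0 * L /
        ((2 * P + 1 : ℕ) : ℝ) ^ (k + 2) := by
    intro P M hP hM a j0 hj0 L hL
    have hM1 : (1 : ℝ) ≤ M := by exact_mod_cast hM
    exact hm (2 * P + 1) (C * M ^ (k + 2)) (M ^ n * (C * ((2 * P + 1 : ℕ) : ℝ) ^ (2 * n)))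
      (fun α => ‖Sa F P M a α‖) (by omega) (by nlinarith [one_le_pow₀ hM1 (n := k + 2)])
      (by positivity) (fun α j hj => hw P M hP hM a α j hj) j0 hj0 L hL
  have hCC : 9 * C ≤ 9 * C2 * C * C := by nlinarith [mul_le_mul hC2 hC (by linarith) (by linarith)]
  have hCC2 : C2 * C * C ≤ 9 * C2 * C * C := by nlinarith [mul_pos (by linarith : 0 < C2) (by nlinarith : 0 < C * C)]
  have hCC0 : 1 ≤ C2 * C * C := by
    have := mul_le_mul (mul_le_mul hC2 hC (by linarith) (by linarith)) hC (by linarith) (by nlinarith)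
    linarith
  refine ⟨18 * C2 * C * C, ρ, by linarith, h0, h1, ?_, ?_⟩
  · intro P hP a
    obtain ⟨L0, hL0, hL⟩ := ra_eq F P
    set X : ℝ := ((2 * P + 1 : ℕ) : ℝ) with hX
    have hX1 : 1 ≤ X := by rw [hX]; push_cast; have : (0 : ℝ) ≤ P := by positivity
                           linarith
    obtain ⟨L, hLL0, hLX⟩ : ∃ L : ℕ, L0 ≤ L ∧ 4 * (C * (1 : ℕ) ^ (k + 2)) * X ^ (k + 2) ≤ L :=
      ⟨L0 + ⌈4 * (C * (1 : ℕ) ^ (k + 2)) * X ^ (k + 2)⌉₊, by omega, by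
        push_cast; have := Nat.le_ceil (4 * (C * (1 : ℕ) ^ (k + 2)) * X ^ (k + 2))
        push_cast at this
        have h0 : (0 : ℝ) ≤ L0 := by positivity
        linarith⟩
    have hLp : (0 : ℝ) < L := by exact_mod_cast (by omega : 0 < L)
    have hj0 : (2 : ℝ) ^ 0 ≤ (2 * P + 1 : ℕ) := by simpa using hX1
    have e1 := key P 1 hP le_rfl a 0 hj0 L hLX
    have e2 := nearj_count k (2 * P + 1) (by omega) (C * (1 : ℕ) ^ (k + 2)) (by simpa using hC) 0
      hj0 L hLX
    have e3 := hL L hLL0 1 a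
    have e4 : |(L * ra F P 1 a : ℝ)| ≤ ∑ t ∈ Finset.range L, ‖Sa F P 1 a ((t : ℝ) / L)‖ := by
      rw [← Real.norm_eq_abs, ← Complex.norm_real, e3]; exact norm_sum_le _ _
    rw [← Finset.sum_filter_add_sum_filter_not (Finset.range L)
      (fun t : ℕ => nearj k (2 * P + 1) (C * (1 : ℕ) ^ (k + 2)) 0 ((t : ℝ) / L))] at e4
    have e5 : ∑ t ∈ (Finset.range L).filter
        (fun t : ℕ => nearj k (2 * P + 1) (C * (1 : ℕ) ^ (k + 2)) 0 ((t : ℝ) / L)),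
        ‖Sa F P 1 a ((t : ℝ) / L)‖ ≤ 9 * C * L / X ^ (k + 2) * X ^ (2 * n) := by
      refine (Finset.sum_le_sum fun t _ => Sa_triv F P 1 a _).trans ?_
      rw [Finset.sum_const, nsmul_eq_mul]
      refine mul_le_mul_of_nonneg_right (e2.trans (le_of_eq ?_)) (by positivity)
      simp [hX]
    have e6 := le_abs_self (L * ra F P 1 a : ℝ)
    have e7 : L * ra F P 1 a ≤ 9 * C * L / X ^ (k + 2) * X ^ (2 * n) +
        C2 * C * C * X ^ (2 * n) * L / X ^ (k + 2) := by
      refine e6.trans (e4.trans (add_le_add e5 (e1.trans (le_of_eq ?_))))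
      rw [← hX, Nat.cast_one]; ring
    refine le_of_mul_le_mul_left (e7.trans ?_) hLp
    rw [show 9 * C * L / X ^ (k + 2) * X ^ (2 * n) + C2 * C * C * X ^ (2 * n) * L / X ^ (k + 2) =
      L * ((9 * C + C2 * C * C) * X ^ (2 * n) / X ^ (k + 2)) by ring]
    gcongr
    linarith
  · intro P M hP hM a a' j0 hj0 E hE hnear
    obtain ⟨L0, hL0, hL⟩ := ra_eq F P
    have hM1 : (1 : ℝ) ≤ M := by exact_mod_cast hM
    set A : ℝ := C * M ^ (k + 2) with hA
    have hA1 : 1 ≤ A := by rw [hA]; nlinarith [one_le_pow₀ hM1 (n := k + 2)]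
    set X : ℝ := ((2 * P + 1 : ℕ) : ℝ) with hX
    have hX1 : 1 ≤ X := by rw [hX]; push_cast; have : (0 : ℝ) ≤ P := by positivity
                           linarith
    have hAle : A ≤ 18 * C2 * C * C * M ^ (k + 2) := by rw [hA]; gcongr; nlinarith
    obtain ⟨L, hLL0, hLX⟩ : ∃ L : ℕ, L0 ≤ L ∧ 4 * A * X ^ (k + 2) ≤ L :=
      ⟨L0 + ⌈4 * A * X ^ (k + 2)⌉₊, by omega, by
        push_cast; have := Nat.le_ceil (4 * A * X ^ (k + 2))
        have h0 : (0 : ℝ) ≤ L0 := by positivity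
        linarith⟩
    have hLp : (0 : ℝ) < L := by exact_mod_cast (by omega : 0 < L)
    have e1 := key P M hP hM a j0 hj0 L hLX
    have e1' := key P M hP hM a' j0 hj0 L hLX
    have e2 := nearj_count k (2 * P + 1) (by omega) A hA1 j0 hj0 L hLX
    have e4 : |(L * (ra F P M a - ra F P M a') : ℝ)| ≤
        ∑ t ∈ Finset.range L, ‖Sa F P M a ((t : ℝ) / L) - Sa F P M a' ((t : ℝ) / L)‖ := by
      rw [← Real.norm_eq_abs, ← Complex.norm_real, mul_sub, Complex.ofReal_sub, hL L hLL0 M a,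
        hL L hLL0 M a', ← Finset.sum_sub_distrib]; exact norm_sum_le _ _
    rw [← Finset.sum_filter_add_sum_filter_not (Finset.range L)
      (fun t : ℕ => nearj k (2 * P + 1) A j0 ((t : ℝ) / L))] at e4
    have e5 : ∑ t ∈ (Finset.range L).filter (fun t : ℕ => nearj k (2 * P + 1) A j0 ((t : ℝ) / L)),
        ‖Sa F P M a ((t : ℝ) / L) - Sa F P M a' ((t : ℝ) / L)‖ ≤
        9 * A * ((4 : ℝ) ^ (k + 1)) ^ j0 * L / X ^ (k + 2) * E := by
      refine (Finset.sum_le_sum fun t ht => hnear _ ?_).trans ?_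
      · refine nearj_mono (by linarith) hAle le_rfl (Finset.mem_filter.1 ht).2
      rw [Finset.sum_const, nsmul_eq_mul]
      exact mul_le_mul_of_nonneg_right e2 hE
    have e6 : ∑ t ∈ (Finset.range L).filter (fun t : ℕ => ¬ nearj k (2 * P + 1) A j0 ((t : ℝ) / L)),
        ‖Sa F P M a ((t : ℝ) / L) - Sa F P M a' ((t : ℝ) / L)‖ ≤
        2 * (C2 * A * (M ^ n * (C * X ^ (2 * n))) * ρ ^ j0 * L / X ^ (k + 2)) := by
      refine (Finset.sum_le_sum fun t _ => norm_sub_le _ _).trans ?_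
      rw [Finset.sum_add_distrib]
      linarith
    have e7 := e4.trans (add_le_add e5 e6)
    rw [abs_mul, abs_of_pos hLp] at e7
    refine le_of_mul_le_mul_left (e7.trans ?_) hLp
    have f1 : 9 * A * ((4 : ℝ) ^ (k + 1)) ^ j0 * L / X ^ (k + 2) * E ≤
        L * (18 * C2 * C * C * M ^ (n + k + 2) / X ^ (k + 2) * (((4 : ℝ) ^ (k + 1)) ^ j0 * E)) := by
      rw [show 9 * A * ((4 : ℝ) ^ (k + 1)) ^ j0 * L / X ^ (k + 2) * E =
        L * (9 * A / X ^ (k + 2) * (((4 : ℝ) ^ (k + 1)) ^ j0 * E)) by ring]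
      have : 9 * A ≤ 18 * C2 * C * C * M ^ (n + k + 2) := by
        rw [hA, show n + k + 2 = n + (k + 2) by ring, pow_add _ n, ← mul_assoc (9:ℝ)]
        have g1 : (1 : ℝ) ≤ M ^ n := one_le_pow₀ hM1
        have g2 : (M : ℝ) ^ (k + 2) ≤ M ^ n * M ^ (k + 2) := le_mul_of_one_le_left (by positivity) g1
        exact mul_le_mul (by linarith) g2 (by positivity) (by linarith)
      gcongr
    have f2 : 2 * (C2 * A * (M ^ n * (C * X ^ (2 * n))) * ρ ^ j0 * L / X ^ (k + 2)) ≤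
        L * (18 * C2 * C * C * M ^ (n + k + 2) / X ^ (k + 2) * (ρ ^ j0 * X ^ (2 * n))) := by
      rw [hA, show n + k + 2 = n + (k + 2) by ring, pow_add _ n]
      rw [show 2 * (C2 * (C * M ^ (k + 2)) * (M ^ n * (C * X ^ (2 * n))) * ρ ^ j0 * L / X ^ (k + 2)) =
        L * (2 * C2 * C * C * (M ^ n * M ^ (k + 2)) / X ^ (k + 2) * (ρ ^ j0 * X ^ (2 * n))) by ring]
      gcongr
      norm_num
    rw [mul_add, mul_add]
    linarith

end mean3

section loc
variable {n : ℕ}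

lemma cg.mono {m m' : ℕ} (h : m ∣ m') {x y : Fin n → ℤ} (hx : cg m' x y) : cg m x y := fun i =>
  (Int.natCast_dvd_natCast.2 h).trans (hx i)

lemma cg.add {m : ℕ} {x y x' y' : Fin n → ℤ} (h : cg m x y) (h' : cg m x' y') :
    cg m (x + x') (y + y') := fun i => by
  have := dvd_add (h i) (h' i)
  simpa [add_sub_add_comm] using this

lemma cg_eval {m : ℕ} (F : MvPolynomial (Fin n) ℤ) {x y : Fin n → ℤ} (h : cg m x y) :
    (m : ℤ) ∣ eval x F - eval y F := by
  induction F using MvPolynomial.induction_on with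
  | C a => simp
  | add p q hp hq =>
    rw [map_add, map_add, add_sub_add_comm]; exact dvd_add hp hq
  | mul_X p i hp =>
    rw [map_mul, map_mul, eval_X, eval_X]
    rw [show eval x p * x i - eval y p * y i = (eval x p - eval y p) * x i + eval y p * (x i - y i) by ring]
    exact dvd_add (hp.mul_right _) ((h i).mul_left _)

lemma taylor_sq (F : MvPolynomial (Fin n) ℤ) (a w : Fin n → ℤ) (M : ℕ) :
    ((M : ℤ) ^ 2) ∣ eval (a + M • w) F - eval a F - M * ∑ i, w i * eval a (pderiv i F) := by
  induction F using MvPolynomial.induction_on with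
  | C a => simp
  | add p q hp hq =>
    have := dvd_add hp hq
    simp only [map_add, mul_add, Finset.sum_add_distrib]
    refine this.trans (dvd_of_eq ?_)
    ring
  | mul_X p j hp =>
    have h1 : ∑ i, w i * eval a (pderiv i (p * X j)) =
        (∑ i, w i * eval a (pderiv i p)) * a j + eval a p * w j := by
      simp only [Derivation.leibniz, smul_eq_mul, map_add, map_mul, eval_X, pderiv_X, mul_add,
        Finset.sum_add_distrib]
      rw [add_comm, Finset.sum_mul]
      congr 1
      · exact Finset.sum_congr rfl fun i _ => by ring
      · rw [Finset.sum_eq_single j]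
        · simp; ring
        · intro i _ hij; simp [hij.symm]
        · simp
    rw [h1, map_mul, map_mul, eval_X, eval_X, add_smul_app]
    set A := eval (a + M • w) p
    set B := eval a p
    set D := ∑ i, w i * eval a (pderiv i p)
    obtain ⟨c, hc⟩ := hp
    refine ⟨c * (a j + M * w j) + D * w j, ?_⟩
    have : A = M ^ 2 * c + B + M * D := by linarith
    rw [this]; ring

lemma card_shift {m : ℕ} (hm : 1 ≤ m) (t : Fin n → ℤ) (A : (Fin n → ℤ) → Prop)
    [DecidablePred A] [DecidablePred fun u => A (u + t)]
    (hA : ∀ x y, cg m x y → (A x ↔ A y)) :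
    ((rs n m).filter fun u => A (u + t)).card = ((rs n m).filter A).card := by
  refine Finset.card_bij' (fun u _ => red m (u + t)) (fun u _ => red m (u - t)) ?_ ?_ ?_ ?_
  · intro u hu
    rw [Finset.mem_filter] at hu ⊢
    exact ⟨red_mem hm _, (hA _ _ (cg_red m _)).2 hu.2⟩
  · intro u hu
    rw [Finset.mem_filter] at hu ⊢
    refine ⟨red_mem hm _, (hA _ _ ?_).2 hu.2⟩
    have := (cg_red m (u - t)).add (cg.refl m t)
    simpa using this
  · intro u hu
    rw [Finset.mem_filter] at hu
    nth_rewrite 2 [← red_of_mem hu.1]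
    rw [red_eq_iff]
    have := (cg_red m (u + t)).add (cg.refl m (-t))
    simpa [sub_eq_add_neg] using this
  · intro u hu
    rw [Finset.mem_filter] at hu
    nth_rewrite 2 [← red_of_mem hu.1]
    rw [red_eq_iff]
    have := (cg_red m (u - t)).add (cg.refl m t)
    simpa using this

lemma lin_count (p : ℕ) (hp : p.Prime) (e : ℤ) (g : Fin n → ℤ) (hg : ∃ i, ¬ (p : ℤ) ∣ g i) :
    p * ((rs n p).filter fun w => (p : ℤ) ∣ e + ∑ i, w i * g i).card = p ^ n := by
  obtain ⟨j, hj⟩ := hg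
  have hp' : Prime (p : ℤ) := Nat.prime_iff_prime_int.1 hp
  have hper : ∀ e : ℤ, ∀ x y : Fin n → ℤ, cg p x y →
      ((p : ℤ) ∣ e + ∑ i, x i * g i ↔ (p : ℤ) ∣ e + ∑ i, y i * g i) := by
    intro e x y h
    refine Int.ModEq.dvd_iff ?_
    refine Int.ModEq.add_left _ (Int.ModEq.sum fun i _ => ?_)
    exact ((Int.modEq_iff_dvd.2 (h i)).symm).mul_right _
  have hcop : IsCoprime (p : ℤ) (g j) := (hp'.coprime_iff_not_dvd).2 hj
  obtain ⟨s, r, hsr⟩ := hcop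
  have hsame : ∀ e' : ℤ, ((rs n p).filter fun w => (p : ℤ) ∣ e' + ∑ i, w i * g i).card =
      ((rs n p).filter fun w => (p : ℤ) ∣ e + ∑ i, w i * g i).card := by
    intro e'
    rw [← card_shift hp.one_le (Pi.single j (r * (e' - e))) (fun w => (p : ℤ) ∣ e + ∑ i, w i * g i) (hper e)]
    congr 1
    refine Finset.filter_congr fun w _ => ?_
    have : e + ∑ i, (w + (Pi.single j (r * (e' - e)) : Fin n → ℤ)) i * g i =
        e' + ∑ i, w i * g i + p * (-(s * (e' - e))) := by
      have : ∑ i, (w + (Pi.single j (r * (e' - e)) : Fin n → ℤ)) i * g i = ∑ i, w i * g i + r * (e' - e) * g j := by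
        simp only [Pi.add_apply, add_mul, Finset.sum_add_distrib]
        congr 1
        rw [Finset.sum_eq_single j]
        · simp
        · intro b _ hb; simp [hb]
        · simp
      rw [this]; linear_combination (e' - e) * hsr
    rw [this]
    exact (Int.dvd_add_left (dvd_mul_right _ _)).symm
  have htot : ∑ e' ∈ Finset.range p, ((rs n p).filter fun w => (p : ℤ) ∣ (e' : ℤ) + ∑ i, w i * g i).card =
      (rs n p).card := by
    rw [Finset.card_eq_sum_card_fiberwise (f := fun w => ((-∑ i, w i * g i) % (p : ℤ)).toNat)
      (t := Finset.range p)]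
    · refine Finset.sum_congr rfl fun e' he' => ?_
      congr 1
      refine Finset.filter_congr fun w _ => ?_
      rw [Finset.mem_range] at he'
      have h0 : 0 ≤ (-∑ i, w i * g i) % (p : ℤ) := Int.emod_nonneg _ (by have := hp.pos; omega)
      rw [← Int.natCast_inj (m := _) (n := e'), Int.toNat_of_nonneg h0]
      rw [show (e' : ℤ) + ∑ i, w i * g i = e' - (-∑ i, w i * g i) by ring]
      rw [← Int.modEq_iff_dvd]
      unfold Int.ModEq
      rw [Int.emod_eq_of_lt (by omega : (0 : ℤ) ≤ e') (by exact_mod_cast he')]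
    · intro w _
      have h0 : 0 ≤ (-∑ i, w i * g i) % (p : ℤ) := Int.emod_nonneg _ (by have := hp.pos; omega)
      have h1 : (-∑ i, w i * g i) % (p : ℤ) < p := Int.emod_lt_of_pos _ (by have := hp.pos; omega)
      simp only [Finset.coe_range, Set.mem_Iio]
      omega
  rw [Finset.sum_congr rfl fun (e' : ℕ) _ => hsame (e' : ℤ), Finset.sum_const, Finset.card_range,
    card_rs, smul_eq_mul] at htot
  exact htot

/-- local count -/
def lct (F : MvPolynomial (Fin n) ℤ) (M q : ℕ) (a : Fin n → ℤ) (c : ℤ) : ℕ :=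
  ((rs n (q * M)).filter fun u => cg M u a ∧ ((q * M : ℕ) : ℤ) ∣ eval u F - c).card

/-- nonsingular modulo all primes dividing `M` -/
def smt (F : MvPolynomial (Fin n) ℤ) (M : ℕ) (a : Fin n → ℤ) : Prop :=
  ∀ p : ℕ, p.Prime → p ∣ M → ∃ i, ¬ (p : ℤ) ∣ eval a (pderiv i F)

lemma dvd_sub_iff_of {m x y c : ℤ} (h : m ∣ x - y) : m ∣ x - c ↔ m ∣ y - c := by
  rw [show x - c = (x - y) + (y - c) by ring]; exact dvd_add_right h

lemma lift_count (F : MvPolynomial (Fin n) ℤ) (M p : ℕ) (hM : 1 ≤ M) (hp : p.Prime) (hpM : p ∣ M)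
    (a : Fin n → ℤ) (c : ℤ) (hc : (M : ℤ) ∣ eval a F - c) (hs : smt F M a) :
    p * ((rs n (p * M)).filter fun u => cg M u a ∧ ((p * M : ℕ) : ℤ) ∣ eval u F - c).card = p ^ n := by
  obtain ⟨e, he⟩ := hc
  rw [← lin_count p hp e (fun i => eval a (pderiv i F)) (hs p hp hpM)]
  congr 1
  have hM' : (0 : ℤ) < M := by omega
  have hpM1 : 1 ≤ p * M := Nat.mul_pos hp.pos hM
  have hiff : ∀ w : Fin n → ℤ, ((p * M : ℕ) : ℤ) ∣ eval (a + M • w) F - c ↔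
      (p : ℤ) ∣ e + ∑ i, w i * eval a (pderiv i F) := by
    intro w
    have h1 : ((p * M : ℕ) : ℤ) ∣ eval (a + M • w) F - eval a F - M * ∑ i, w i * eval a (pderiv i F) := by
      refine dvd_trans ?_ (taylor_sq F a w M)
      rw [sq]; push_cast; exact mul_dvd_mul_right (Int.natCast_dvd_natCast.2 hpM) _
    have h2 : eval (a + M • w) F - c = (eval (a + M • w) F - eval a F -
        M * ∑ i, w i * eval a (pderiv i F)) + (e + ∑ i, w i * eval a (pderiv i F)) * M := by
      linear_combination he
    rw [h2, dvd_add_right h1]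
    push_cast
    exact mul_dvd_mul_iff_right hM'.ne'
  symm
  refine Finset.card_bij (fun w _ => red (p * M) (a + M • w)) ?_ ?_ ?_
  · intro w hw
    rw [Finset.mem_filter] at hw ⊢
    refine ⟨red_mem hpM1 _, ?_, ?_⟩
    · refine ((cg_red _ _).mono (dvd_mul_left _ _)).trans fun i => ?_
      rw [add_smul_app]; exact ⟨w i, by ring⟩
    · rw [dvd_sub_iff_of (cg_eval F (cg_red _ _)), hiff]; exact hw.2
  · intro w hw w' hw' h
    rw [red_eq_iff] at h
    rw [Finset.mem_filter] at hw hw'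
    rw [← red_of_mem hw.1, ← red_of_mem hw'.1, red_eq_iff]
    intro i
    have := h i
    rw [add_smul_app, add_smul_app, show a i + M * w i - (a i + M * w' i) = (w i - w' i) * M by ring] at this
    push_cast at this
    exact (mul_dvd_mul_iff_right hM'.ne').1 this
  · intro u hu
    rw [Finset.mem_filter] at hu
    choose w hw using hu.2.1
    have hua : cg (p * M) (a + M • red p w) u := by
      intro i
      obtain ⟨s, hs⟩ := cg_red p w i
      rw [add_smul_app]
      refine ⟨s, ?_⟩
      push_cast
      linear_combination M * hs - hw i
    refine ⟨red p w, ?_, ?_⟩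
    · rw [Finset.mem_filter]
      refine ⟨red_mem hp.one_le _, ?_⟩
      rw [← hiff, dvd_sub_iff_of (cg_eval F hua)]
      exact hu.2.2
    · rw [← red_of_mem hu.1, red_eq_iff]
      exact hua.trans (cg.refl _ _)

lemma lct_split (F : MvPolynomial (Fin n) ℤ) (M q p : ℕ) (hM : 1 ≤ M) (hp : 1 ≤ p)
    (a : Fin n → ℤ) (c : ℤ) : lct F M (p * q) a c =
      ∑ b ∈ (rs n (p * M)).filter (fun u => cg M u a), lct F (p * M) q b c := by
  unfold lct
  have e0 : p * q * M = q * (p * M) := by ring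
  have hpM1 : 1 ≤ p * M := Nat.mul_pos hp hM
  rw [e0, Finset.card_eq_sum_card_fiberwise (f := red (p * M))
    (t := (rs n (p * M)).filter (fun u => cg M u a))]
  · refine Finset.sum_congr rfl fun b hb => ?_
    rw [Finset.mem_filter] at hb
    rw [Finset.filter_filter]
    congr 1
    refine Finset.filter_congr fun u _ => ?_
    have : red (p * M) u = b ↔ cg (p * M) u b := by
      nth_rewrite 1 [← red_of_mem hb.1]; exact red_eq_iff
    rw [this]
    constructor
    · rintro ⟨⟨h1, h2⟩, h3⟩; exact ⟨h3, h2⟩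
    · rintro ⟨h3, h2⟩; exact ⟨⟨(h3.mono (dvd_mul_left _ _)).trans hb.2, h2⟩, h3⟩
  · intro u hu
    have hu := (Finset.mem_filter.1 hu).2
    exact Finset.mem_coe.2 (Finset.mem_filter.2 ⟨red_mem hpM1 _,
      ((cg_red _ _).mono (dvd_mul_left _ _)).trans hu.1⟩)

lemma lct_eq (F : MvPolynomial (Fin n) ℤ) (q : ℕ) : ∀ M : ℕ, 1 ≤ q → 1 ≤ M → ∀ a a' : Fin n → ℤ,
    (M : ℤ) ∣ eval a F - eval a' F → smt F M a → smt F M a' → ∀ c, lct F M q a c = lct F M q a' c := by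
  induction q using Nat.strong_induction_on with
  | _ q ih =>
  intro M hq hM a a' haa hs hs' c
  by_cases hg : Nat.Coprime q M
  · -- CRT shift
    have hqM : 1 ≤ q * M := Nat.mul_pos hq hM
    have hgz : IsCoprime (q : ℤ) (M : ℤ) := Nat.isCoprime_iff_coprime.2 hg
    obtain ⟨r, s, hrs⟩ := hgz
    set t : Fin n → ℤ := fun i => r * q * (a' i - a i) with ht
    unfold lct
    rw [← card_shift hqM t (fun u => cg M u a' ∧ ((q * M : ℕ) : ℤ) ∣ eval u F - c)]
    · congr 1
      refine Finset.filter_congr fun u _ => ?_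
      have h1 : cg M u a ↔ cg M (u + t) a' := by
        refine forall_congr' fun i => ?_
        have : (u + t) i - a' i = (u i - a i) + M * (- s * (a' i - a i)) := by
          simp only [ht, Pi.add_apply]; linear_combination (a' i - a i) * hrs
        rw [this]
        exact (Int.dvd_add_left (dvd_mul_right _ _)).symm
      rw [← h1]
      refine and_congr_right fun hu => ?_
      refine (dvd_sub_iff_of ?_).symm
      push_cast
      refine IsCoprime.mul_dvd ⟨r, s, hrs⟩ (cg_eval F fun i => ?_) ?_
      · simp only [ht, Pi.add_apply]; exact ⟨r * (a' i - a i), by ring⟩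
      · have e1 := cg_eval F (h1.1 hu)
        have e2 := cg_eval F hu
        have := dvd_sub (dvd_sub e1 e2) haa
        convert this using 1; ring
    · intro x y h
      refine and_congr ⟨fun hx => ((h.mono (dvd_mul_left _ _)).symm).trans hx,
        fun hx => (h.mono (dvd_mul_left _ _)).trans hx⟩ (dvd_sub_iff_of (cg_eval F h))
  · obtain ⟨p, hp, hpq, hpM⟩ := Nat.Prime.not_coprime_iff_dvd.1 hg
    obtain ⟨q', rfl⟩ := hpq
    have hq' : 1 ≤ q' := Nat.pos_of_ne_zero (by rintro rfl; omega)
    have hlt : q' < p * q' := by have := hp.two_le; nlinarith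
    have hpM1 : 1 ≤ p * M := Nat.mul_pos hp.pos hM
    rw [lct_split F M q' p hM hp.one_le, lct_split F M q' p hM hp.one_le]
    have hsm : ∀ x, smt F M x → ∀ b, cg M b x → smt F (p * M) b := by
      intro x hx b hb l hl hlM
      have hlM' : l ∣ M := by
        rcases (Nat.Prime.dvd_mul hl).1 hlM with h | h
        · rw [(Nat.prime_dvd_prime_iff_eq hl hp).1 h]; exact hpM
        · exact h
      obtain ⟨i, hi⟩ := hx l hl hlM'
      refine ⟨i, fun hc => hi ?_⟩
      have := cg_eval (pderiv i F) (hb.mono hlM')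
      exact (dvd_sub_right hc).1 this |> fun h => h
    have hzero : ∀ b, ¬ ((p * M : ℕ) : ℤ) ∣ eval b F - c → lct F (p * M) q' b c = 0 := by
      intro b hb
      unfold lct
      rw [Finset.card_eq_zero, Finset.filter_eq_empty_iff]
      rintro u _ ⟨h1, h2⟩
      refine hb ?_
      rw [← dvd_sub_iff_of (cg_eval F h1)]
      refine dvd_trans ?_ h2
      exact Int.natCast_dvd_natCast.2 (dvd_mul_left _ _)
    have hfil : ∀ x, ∑ b ∈ (rs n (p * M)).filter (fun u => cg M u x), lct F (p * M) q' b c =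
        ∑ b ∈ (rs n (p * M)).filter (fun u => cg M u x ∧ ((p * M : ℕ) : ℤ) ∣ eval u F - c),
          lct F (p * M) q' b c := by
      intro x
      rw [← Finset.filter_filter]
      symm
      refine Finset.sum_filter_of_ne fun b _ hne => ?_
      by_contra hc
      exact hne (hzero b hc)
    by_cases hc : (M : ℤ) ∣ eval a F - c
    · have hc' : (M : ℤ) ∣ eval a' F - c := by rwa [← dvd_sub_iff_of haa]
      have l1 := lift_count F M p hM hp hpM a c hc hs
      have l2 := lift_count F M p hM hp hpM a' c hc' hs'
      rw [hfil, hfil]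
      have hcard := Nat.eq_of_mul_eq_mul_left hp.pos (l1.trans l2.symm)
      by_cases hne : ((rs n (p * M)).filter
          (fun u => cg M u a ∧ ((p * M : ℕ) : ℤ) ∣ eval u F - c)).Nonempty
      · obtain ⟨b0, hb0⟩ := hne
        have hb0 := (Finset.mem_filter.1 hb0).2
        have hcon : ∀ x, smt F M x → ∀ b ∈ (rs n (p * M)).filter
          (fun u => cg M u x ∧ ((p * M : ℕ) : ℤ) ∣ eval u F - c),
            lct F (p * M) q' b c = lct F (p * M) q' b0 c := by
          intro x hx b hb
          have hb := (Finset.mem_filter.1 hb).2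
          refine ih q' hlt (p * M) hq' hpM1 b b0 ?_ (hsm x hx b hb.1) (hsm a hs b0 hb0.1) c
          have := dvd_sub hb.2 hb0.2
          simpa using this
        rw [Finset.sum_congr rfl (hcon a hs), Finset.sum_congr rfl (hcon a' hs'), Finset.sum_const,
          Finset.sum_const, hcard]
      · rw [Finset.not_nonempty_iff_eq_empty] at hne
        rw [hne, Finset.card_empty] at hcard
        rw [hne, Finset.card_eq_zero.1 hcard.symm]
    · have hc' : ¬ (M : ℤ) ∣ eval a' F - c := by rwa [← dvd_sub_iff_of haa]
      have hz : ∀ x, ¬ (M : ℤ) ∣ eval x F - c →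
          ∑ b ∈ (rs n (p * M)).filter (fun u => cg M u x), lct F (p * M) q' b c = 0 := by
        intro x hx
        refine Finset.sum_eq_zero fun b hb => hzero b fun hcc => hx ?_
        have hb := (Finset.mem_filter.1 hb).2
        rw [← dvd_sub_iff_of (cg_eval F hb)]
        exact dvd_trans (Int.natCast_dvd_natCast.2 (dvd_mul_left _ _)) hcc
      rw [hz a hc, hz a' hc']

/-- local exponential sums agree -/
lemma gauss_eq (F : MvPolynomial (Fin n) ℤ) (q M : ℕ) (hq : 1 ≤ q) (hM : 1 ≤ M) (a a' : Fin n → ℤ)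
    (haa : (M : ℤ) ∣ eval a F - eval a' F) (hs : smt F M a) (hs' : smt F M a') (b : ℤ) :
    ∑ u ∈ (rs n (q * M)).filter (fun u => cg M u a), ee ((b : ℝ) / q * (eval u F : ℤ)) =
    ∑ u ∈ (rs n (q * M)).filter (fun u => cg M u a'), ee ((b : ℝ) / q * (eval u F : ℤ)) := by
  have hqM : 1 ≤ q * M := Nat.mul_pos hq hM
  have key : ∀ x, ∑ u ∈ (rs n (q * M)).filter (fun u => cg M u x), ee ((b : ℝ) / q * (eval u F : ℤ)) =
      ∑ c ∈ Finset.Ico (0 : ℤ) ((q * M : ℕ) : ℤ), (lct F M q x c : ℂ) * ee ((b : ℝ) / q * c) := by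
    intro x
    rw [← Finset.sum_fiberwise_of_maps_to (t := Finset.Ico (0 : ℤ) ((q * M : ℕ) : ℤ))
      (g := fun u => eval u F % ((q * M : ℕ) : ℤ))]
    · refine Finset.sum_congr rfl fun c hc => ?_
      rw [Finset.mem_Ico] at hc
      unfold lct
      rw [← nsmul_eq_mul, ← Finset.sum_const, Finset.filter_filter]
      have hiff : ∀ u : Fin n → ℤ, eval u F % ((q * M : ℕ) : ℤ) = c ↔ ((q * M : ℕ) : ℤ) ∣ eval u F - c := by
        intro u
        rw [← Int.modEq_iff_dvd]
        unfold Int.ModEq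
        rw [Int.emod_eq_of_lt hc.1 hc.2]
        exact eq_comm
      refine Finset.sum_congr (Finset.filter_congr fun u _ => by rw [hiff]) fun u hu => ?_
      obtain ⟨s, hs⟩ := (Finset.mem_filter.1 hu).2.2
      have hq0 : (q : ℝ) ≠ 0 := by positivity
      have : (b : ℝ) / q * (eval u F : ℤ) = (b : ℝ) / q * c + ((b * M * s : ℤ) : ℝ) := by
        rw [show eval u F = c + (q * M : ℕ) * s by linarith]
        push_cast; field_simp
      rw [this, ee_add_int]
    · intro u _
      exact Finset.mem_Ico.2 ⟨Int.emod_nonneg _ (by omega), Int.emod_lt_of_pos _ (by omega)⟩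
  rw [key, key]
  refine Finset.sum_congr rfl fun c _ => ?_
  rw [lct_eq F q M hq hM a a' haa hs hs' c]

end loc

section major
variable {n : ℕ}

lemma mon_bound (s : Fin n →₀ ℕ) (x : Fin n → ℝ) (R : ℝ) (hx : ∀ i, |x i| ≤ R) :
    |∏ i, x i ^ s i| ≤ R ^ s.degree := by
  rw [Finset.abs_prod, Finsupp.degree_eq_sum, ← Finset.prod_pow_eq_pow_sum]
  refine Finset.prod_le_prod (fun _ _ => abs_nonneg _) fun i _ => ?_
  rw [abs_pow]; exact pow_le_pow_left₀ (abs_nonneg _) (hx i) _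

lemma mon_lip (s : Fin n →₀ ℕ) : ∃ C : ℝ, 0 ≤ C ∧ ∀ (x u : Fin n → ℝ) (R H : ℝ), 1 ≤ R → 0 ≤ H →
    (∀ i, |x i| ≤ R) → (∀ i, |x i + u i| ≤ R) → (∀ i, |u i| ≤ H) →
    |∏ i, (x i + u i) ^ s i - ∏ i, x i ^ s i| * R ≤ C * H * R ^ s.degree := by
  have hadd : ∀ s t : Fin n →₀ ℕ, (∃ C : ℝ, 0 ≤ C ∧ ∀ (x u : Fin n → ℝ) (R H : ℝ), 1 ≤ R → 0 ≤ H →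
    (∀ i, |x i| ≤ R) → (∀ i, |x i + u i| ≤ R) → (∀ i, |u i| ≤ H) →
    |∏ i, (x i + u i) ^ s i - ∏ i, x i ^ s i| * R ≤ C * H * R ^ s.degree) →
    (∃ C : ℝ, 0 ≤ C ∧ ∀ (x u : Fin n → ℝ) (R H : ℝ), 1 ≤ R → 0 ≤ H →
    (∀ i, |x i| ≤ R) → (∀ i, |x i + u i| ≤ R) → (∀ i, |u i| ≤ H) →
    |∏ i, (x i + u i) ^ t i - ∏ i, x i ^ t i| * R ≤ C * H * R ^ t.degree) →
    (∃ C : ℝ, 0 ≤ C ∧ ∀ (x u : Fin n → ℝ) (R H : ℝ), 1 ≤ R → 0 ≤ H →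
    (∀ i, |x i| ≤ R) → (∀ i, |x i + u i| ≤ R) → (∀ i, |u i| ≤ H) →
    |∏ i, (x i + u i) ^ (s + t) i - ∏ i, x i ^ (s + t) i| * R ≤ C * H * R ^ (s + t).degree) := by
    rintro s t ⟨C, hC, h⟩ ⟨D, hD, h'⟩
    refine ⟨C + D, by linarith, fun x u R H hR hH h1 h2 h3 => ?_⟩
    have e1 := h x u R H hR hH h1 h2 h3
    have e2 := h' x u R H hR hH h1 h2 h3
    have e3 := mon_bound s (fun i => x i + u i) R h2
    have e4 := mon_bound t x R h1
    simp only [Finsupp.add_apply, pow_add, Finset.prod_mul_distrib]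
    set A := ∏ i, (x i + u i) ^ s i
    set A' := ∏ i, x i ^ s i
    set B := ∏ i, (x i + u i) ^ t i
    set B' := ∏ i, x i ^ t i
    have hR0 : 0 ≤ R := by linarith
    have hdeg : (s + t).degree = s.degree + t.degree := by simp
    rw [hdeg, pow_add]
    calc |A * B - A' * B'| * R = |A * (B - B') + (A - A') * B'| * R := by congr 2; ring
      _ ≤ (|A| * |B - B'| + |A - A'| * |B'|) * R := by
        gcongr; exact (abs_add_le _ _).trans (by rw [abs_mul, abs_mul])
      _ = |A| * (|B - B'| * R) + (|A - A'| * R) * |B'| := by ring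
      _ ≤ R ^ s.degree * (D * H * R ^ t.degree) + (C * H * R ^ s.degree) * R ^ t.degree := by
        gcongr
      _ = _ := by ring
  induction s using Finsupp.induction_linear with
  | zero => exact ⟨0, le_rfl, fun x u R H _ _ _ _ _ => by simp⟩
  | add s t hs ht => exact hadd s t hs ht
  | single j m =>
    induction m with
    | zero => exact ⟨0, le_rfl, fun x u R H _ _ _ _ _ => by simp⟩
    | succ m ih =>
      rw [Finsupp.single_add]
      refine hadd _ _ ih ⟨1, by norm_num, fun x u R H hR hH h1 h2 h3 => ?_⟩
      have : ∀ v : Fin n → ℝ, ∏ i, v i ^ (Finsupp.single j 1 : Fin n →₀ ℕ) i = v j := by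
        intro v
        rw [Finset.prod_eq_single j]
        · simp
        · intro b _ hb; simp [hb.symm]
        · simp
      rw [this (fun i => x i + u i), this x]
      simp only [Finsupp.degree_single, pow_one, add_sub_cancel_left, one_mul]
      exact mul_le_mul_of_nonneg_right (h3 j) (by linarith)

lemma F_lip (F : MvPolynomial (Fin n) ℤ) (d : ℕ) (hF : F.IsHomogeneous d) : ∃ C : ℝ, 0 ≤ C ∧
    ∀ (x u : Fin n → ℤ) (R H : ℝ), 1 ≤ R → 0 ≤ H →
    (∀ i, |(x i : ℝ)| ≤ R) → (∀ i, |(x i + u i : ℝ)| ≤ R) → (∀ i, |(u i : ℝ)| ≤ H) →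
    |((eval (x + u) F : ℤ) : ℝ) - ((eval x F : ℤ) : ℝ)| * R ≤ C * H * R ^ d := by
  choose c hc0 hc using mon_lip (n := n)
  refine ⟨∑ s ∈ F.support, |((coeff s F : ℤ) : ℝ)| * c s,
    Finset.sum_nonneg fun s _ => mul_nonneg (abs_nonneg _) (hc0 s), fun x u R H hR hH h1 h2 h3 => ?_⟩
  rw [eval_eq', eval_eq']
  push_cast
  rw [← Finset.sum_sub_distrib, Finset.sum_mul, Finset.sum_mul]
  have hR0 : 0 ≤ R := by linarith
  refine (mul_le_mul_of_nonneg_right (Finset.abs_sum_le_sum_abs _ _) hR0).trans ?_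
  rw [Finset.sum_mul]
  refine Finset.sum_le_sum fun s hs => ?_
  have hdeg : s.degree = d := by
    have := hF (mem_support_iff.1 hs)
    rw [← this, Finsupp.degree_eq_weight_one]; rfl
  have := hc s (fun i => x i) (fun i => u i) R H hR hH h1 h2 h3
  rw [hdeg] at this
  rw [← mul_sub, abs_mul, mul_assoc, mul_assoc, mul_assoc]
  refine mul_le_mul_of_nonneg_left ?_ (abs_nonneg _)
  simpa [mul_assoc] using this

lemma strip_card (P H : ℕ) (i : Fin n) : ((Bx n P).filter fun z => z i < -(P : ℤ) + H).card ≤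
    H * (2 * P + 1) ^ (n - 1) := by
  have hsub : ((Bx n P).filter fun z => z i < -(P : ℤ) + H) ⊆ Fintype.piFinset fun j =>
      if j = i then Finset.Ico (-(P : ℤ)) (-(P : ℤ) + H) else Finset.Icc (-(P : ℤ)) P := by
    intro z hz
    rw [Finset.mem_filter, mem_Bx] at hz
    rw [Fintype.mem_piFinset]
    intro j
    split_ifs with h
    · subst h; exact Finset.mem_Ico.2 ⟨(hz.1 j).1, hz.2⟩
    · exact Finset.mem_Icc.2 (hz.1 j)
  refine (Finset.card_le_card hsub).trans (le_of_eq ?_)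
  rw [Fintype.card_piFinset, ← Finset.mul_prod_erase Finset.univ _ (Finset.mem_univ i)]
  congr 1
  · simp
  · rw [Finset.prod_congr rfl (g := fun _ => 2 * P + 1), Finset.prod_const, Finset.card_erase_of_mem
      (Finset.mem_univ i), Finset.card_univ, Fintype.card_fin]
    intro j hj
    rw [if_neg (Finset.ne_of_mem_erase hj), Int.card_Icc]; omega

lemma box_shift (P H : ℕ) (u : Fin n → ℤ) (hu : u ∈ rs n H) (g : (Fin n → ℤ) → ℂ)
    (hg : ∀ z, ‖g z‖ ≤ 1) : ‖∑ z ∈ Bx n P, g z - ∑ z ∈ Bx n P, g (z + u)‖ ≤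
      2 * (n * (H * ((2 * P + 1 : ℕ) : ℝ) ^ (n - 1))) := by
  set B := Bx n P with hB
  set B' := B.image (· + u) with hB'
  have hinj : Function.Injective (fun z : Fin n → ℤ => z + u) := add_left_injective u
  have e1 : ∑ z ∈ B, g (z + u) = ∑ z ∈ B', g z := by
    rw [hB', Finset.sum_image fun x _ y _ h => hinj h]
  have hcard : B'.card = B.card := Finset.card_image_of_injective _ hinj
  have e2 : ((B \ B').card : ℝ) ≤ n * (H * ((2 * P + 1 : ℕ) : ℝ) ^ (n - 1)) := by
    have hsub : B \ B' ⊆ Finset.univ.biUnion fun i : Fin n => B.filter fun z => z i < -(P : ℤ) + H := by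
      intro z hz
      rw [Finset.mem_sdiff] at hz
      by_contra hc
      simp only [Finset.mem_biUnion, Finset.mem_univ, true_and, Finset.mem_filter, not_exists, not_and,
        not_lt] at hc
      refine hz.2 (Finset.mem_image.2 ⟨z - u, ?_, by simp⟩)
      rw [hB, mem_Bx]
      intro i
      have h1 := hc i hz.1
      have h2 := mem_rs.1 hu i
      have h3 := mem_Bx.1 hz.1 i
      simp only [Pi.sub_apply]
      omega
    have h1 := (Finset.card_le_card hsub).trans (Finset.card_biUnion_le.trans
      (Finset.sum_le_sum fun i _ => strip_card P H i))
    rw [Finset.sum_const, Finset.card_univ, Fintype.card_fin, smul_eq_mul] at h1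
    exact_mod_cast h1
  have e3 : (B' \ B).card = (B \ B').card := by
    have h1 := Finset.card_sdiff_add_card_inter B B'
    have h2 := Finset.card_sdiff_add_card_inter B' B
    rw [Finset.inter_comm] at h2
    omega
  have e4 : ∑ z ∈ B, g z - ∑ z ∈ B', g z = ∑ z ∈ B \ B', g z - ∑ z ∈ B' \ B, g z := by
    have h1 := Finset.sum_inter_add_sum_sdiff B B' g
    have h2 := Finset.sum_inter_add_sum_sdiff B' B g
    rw [Finset.inter_comm] at h2
    rw [← h1, ← h2]; ring
  have e5 : ∀ S : Finset (Fin n → ℤ), ‖∑ z ∈ S, g z‖ ≤ S.card := by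
    intro S
    refine (norm_sum_le _ _).trans ((Finset.sum_le_sum fun z _ => hg z).trans ?_)
    simp
  rw [e1, e4]
  refine (norm_sub_le _ _).trans ((add_le_add (e5 _) (e5 _)).trans ?_)
  rw [e3]; linarith

/-- archimedean sum over a class -/
def Wu (F : MvPolynomial (Fin n) ℤ) (P H : ℕ) (u : Fin n → ℤ) (β : ℝ) : ℂ :=
  ∑ y ∈ Bx n P, ∑ z ∈ Bx n P, if cg H (y + z) u then ee (β * (eval (y + z) F : ℤ)) else 0

lemma Wu_diff (hn : 0 < n) (F : MvPolynomial (Fin n) ℤ) (d : ℕ) (hF : F.IsHomogeneous (d + 1)) :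
    ∃ C : ℝ, 0 ≤ C ∧ ∀ (P H : ℕ) (u : Fin n → ℤ) (β δ : ℝ), 1 ≤ H → u ∈ rs n H → |β| ≤ δ →
    ‖Wu F P H u β - Wu F P H 0 β‖ ≤ C * H ^ (d + 1) * ((2 * P + 1 : ℕ) : ℝ) ^ (2 * n) /
      ((2 * P + 1 : ℕ) : ℝ) * (1 + δ * ((2 * P + 1 : ℕ) : ℝ) ^ (d + 1)) := by
  obtain ⟨C, hC, hlip⟩ := F_lip F (d + 1) hF
  refine ⟨2 * n + 7 * C, by positivity, fun P H u β δ hH hu hβ => ?_⟩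
  set X : ℝ := ((2 * P + 1 : ℕ) : ℝ) with hX
  have hXP : X = 2 * P + 1 := by rw [hX]; push_cast; ring
  have hX1 : 1 ≤ X := by rw [hXP]; have : (0 : ℝ) ≤ P := by positivity
                         linarith
  have hH1 : (1 : ℝ) ≤ H := by exact_mod_cast hH
  have hδ : 0 ≤ δ := (abs_nonneg _).trans hβ
  have hcB := card_Bx n P
  have hy : ∀ y ∈ Bx n P, ‖(∑ z ∈ Bx n P, if cg H (y + z) u then ee (β * (eval (y + z) F : ℤ)) else 0) -
      ∑ z ∈ Bx n P, (if cg H (y + z) 0 then ee (β * (eval (y + z) F : ℤ)) else 0)‖ ≤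
      2 * (n * (H * X ^ (n - 1))) + X ^ n * (7 * δ * (C * H ^ (d + 1) * X ^ d)) := by
    intro y hyB
    set g : (Fin n → ℤ) → ℂ := fun z => if cg H (y + z) u then ee (β * (eval (y + z) F : ℤ)) else 0 with hg
    have hg1 : ∀ z, ‖g z‖ ≤ 1 := by
      intro z; simp only [hg]; split_ifs
      · rw [norm_ee]
      · simp
    have h1 := box_shift P H u hu g hg1
    have h2 : ‖∑ z ∈ Bx n P, g (z + u) -
        ∑ z ∈ Bx n P, (if cg H (y + z) 0 then ee (β * (eval (y + z) F : ℤ)) else 0)‖ ≤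
        X ^ n * (7 * δ * (C * H ^ (d + 1) * X ^ d)) := by
      rw [← Finset.sum_sub_distrib]
      refine (norm_sum_le _ _).trans ((Finset.sum_le_sum (g := fun _ =>
        7 * δ * (C * H ^ (d + 1) * X ^ d)) fun z hz => ?_).trans ?_)
      · have hiff : cg H (y + (z + u)) u ↔ cg H (y + z) 0 := by
          refine forall_congr' fun i => ?_
          simp [← add_assoc]
        simp only [hg, hiff]
        split_ifs
        · rw [show y + (z + u) = (y + z) + u by rw [add_assoc]]
          set x := y + z with hx
          have hxb : ∀ i, |(x i : ℝ)| ≤ 2 * P := by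
            intro i
            have a1 := mem_Bx.1 hyB i
            have a2 := mem_Bx.1 hz i
            have : |x i| ≤ 2 * P := by rw [abs_le, hx, Pi.add_apply]; constructor <;> linarith
            exact_mod_cast this
          have hub : ∀ i, |(u i : ℝ)| ≤ H := by
            intro i
            have a1 := mem_rs.1 hu i
            have : |u i| ≤ H := by rw [abs_le]; constructor <;> linarith
            exact_mod_cast this
          have hXH : X ≤ X * H := le_mul_of_one_le_right (by linarith) hH1
          have hP0 : (0 : ℝ) ≤ P := by positivity
          have hl := hlip x u (X * H) H (by linarith) (by linarith)
            (fun i => (hxb i).trans (by linarith)) (fun i => (abs_add_le _ _).trans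
              ((add_le_add (hxb i) (hub i)).trans (by rw [hXP]; nlinarith))) hub
          have hl2 : |((eval (x + u) F : ℤ) : ℝ) - ((eval x F : ℤ) : ℝ)| ≤ C * H ^ (d + 1) * X ^ d := by
            refine le_of_mul_le_mul_right (hl.trans (le_of_eq ?_)) (by positivity : 0 < X * H)
            ring
          rw [show β * ((eval (x + u) F : ℤ) : ℝ) = β * (((eval (x + u) F : ℤ) : ℝ) - ((eval x F : ℤ) : ℝ)) +
            β * ((eval x F : ℤ) : ℝ) by ring, ee_add, ← sub_one_mul, norm_mul, norm_ee, mul_one]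
          refine (norm_ee_sub_one _).trans ?_
          rw [abs_mul, mul_assoc]
          gcongr
        · simp only [sub_self, norm_zero]; positivity
      · rw [Finset.sum_const, nsmul_eq_mul]
        gcongr
    have h3 : (∑ z ∈ Bx n P, if cg H (y + z) u then ee (β * (eval (y + z) F : ℤ)) else 0) =
      ∑ z ∈ Bx n P, g z := rfl
    rw [h3]
    refine (norm_sub_le_norm_sub_add_norm_sub _ (∑ z ∈ Bx n P, g (z + u)) _).trans (add_le_add h1 h2)
  unfold Wu
  rw [← Finset.sum_sub_distrib]
  refine (norm_sum_le _ _).trans ((Finset.sum_le_sum hy).trans ?_)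
  rw [Finset.sum_const, nsmul_eq_mul]
  obtain ⟨m, rfl⟩ : ∃ m, n = m + 1 := ⟨n - 1, by omega⟩
  have hX0 : X ≠ 0 := by linarith
  have hHd : (H : ℝ) ≤ H ^ (d + 1) := le_self_pow₀ hH1 (by omega)
  simp only [Nat.add_sub_cancel]
  calc ((Bx (m + 1) P).card : ℝ) * (2 * (((m + 1 : ℕ) : ℝ) * (H * X ^ m)) +
        X ^ (m + 1) * (7 * δ * (C * H ^ (d + 1) * X ^ d)))
      ≤ X ^ (m + 1) * (2 * (((m + 1 : ℕ) : ℝ) * (H ^ (d + 1) * X ^ m)) +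
        X ^ (m + 1) * (7 * δ * (C * H ^ (d + 1) * X ^ d))) := by gcongr
    _ = (2 * ((m + 1 : ℕ) : ℝ) * H ^ (d + 1) + 7 * C * H ^ (d + 1) * (δ * X ^ (d + 1))) *
        X ^ (2 * (m + 1)) / X := by
        rw [two_mul (m + 1), pow_add _ (m + 1) (m + 1), pow_succ X m, pow_succ X d]; field_simp
    _ ≤ ((2 * ((m + 1 : ℕ) : ℝ) + 7 * C) * H ^ (d + 1) * (1 + δ * X ^ (d + 1))) *
        X ^ (2 * (m + 1)) / X := by
        gcongr
        have a1 : 0 ≤ 2 * ((m + 1 : ℕ) : ℝ) * H ^ (d + 1) * (δ * X ^ (d + 1)) := by positivity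
        have a2 : 0 ≤ 7 * C * (H : ℝ) ^ (d + 1) := by positivity
        nlinarith
    _ = _ := by ring

lemma Sa_major (F : MvPolynomial (Fin n) ℤ) (P M q : ℕ) (hq : 1 ≤ q) (hM : 1 ≤ M) (a : Fin n → ℤ)
    (b : ℤ) (β : ℝ) : Sa F P M a ((b : ℝ) / q + β) = ∑ u ∈ (rs n (q * M)).filter (fun u => cg M u a),
      ee ((b : ℝ) / q * (eval u F : ℤ)) * Wu F P (q * M) u β := by
  have hH : 1 ≤ q * M := Nat.mul_pos hq hM
  unfold Sa Wu
  simp_rw [Finset.mul_sum]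
  rw [Finset.sum_comm]
  refine Finset.sum_congr rfl fun y _ => ?_
  rw [← Finset.sum_fiberwise_of_maps_to (t := (rs n (q * M)).filter (fun u => cg M u a))
    (g := fun z => red (q * M) (y + z))]
  · refine Finset.sum_congr rfl fun u hu => ?_
    rw [Finset.mem_filter] at hu
    rw [Finset.filter_filter, Finset.sum_filter]
    refine Finset.sum_congr rfl fun z _ => ?_
    have h1 : red (q * M) (y + z) = u ↔ cg (q * M) (y + z) u := by
      nth_rewrite 1 [← red_of_mem hu.1]; exact red_eq_iff
    by_cases hc : cg (q * M) (y + z) u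
    · rw [if_pos ⟨(hc.mono (dvd_mul_left _ _)).trans hu.2, h1.2 hc⟩, if_pos hc]
      obtain ⟨s, hs⟩ := cg_eval F (hc.mono (dvd_mul_right _ _))
      have hq0 : (q : ℝ) ≠ 0 := by positivity
      rw [add_mul, ee_add]
      congr 1
      rw [show eval (y + z) F = eval u F + q * s by linarith]
      rw [← ee_add_int ((b : ℝ) / q * (eval u F : ℤ)) (b * s)]
      congr 1
      push_cast; field_simp
    · rw [if_neg (fun h => hc (h1.1 h.2)), if_neg hc, mul_zero]
  · intro z hz
    exact Finset.mem_filter.2 ⟨red_mem hH _, ((cg_red _ _).mono (dvd_mul_left _ _)).trans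
      (Finset.mem_filter.1 hz).2⟩

lemma Sa_near (hn : 0 < n) (F : MvPolynomial (Fin n) ℤ) (d : ℕ) (hF : F.IsHomogeneous (d + 1)) :
    ∃ C : ℝ, 1 ≤ C ∧ ∀ (P M : ℕ) (a a' : Fin n → ℤ) (Q δ : ℝ), 1 ≤ M →
    (M : ℤ) ∣ eval a F - eval a' F → smt F M a → smt F M a' → 0 ≤ δ → 0 ≤ Q → ∀ α, near Q δ α →
    ‖Sa F P M a α - Sa F P M a' α‖ ≤ C * (Q * M) ^ (n + d + 1) * ((2 * P + 1 : ℕ) : ℝ) ^ (2 * n) /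
      ((2 * P + 1 : ℕ) : ℝ) * (1 + δ * ((2 * P + 1 : ℕ) : ℝ) ^ (d + 1)) := by
  obtain ⟨C, hC, hW⟩ := Wu_diff hn F d hF
  refine ⟨2 * C + 1, by linarith, fun P M a a' Q δ hM haa hs hs' hδ hQ α hα => ?_⟩
  obtain ⟨q, hq, hqQ, b, hb⟩ := hα
  have hH : 1 ≤ q * M := Nat.mul_pos hq hM
  have hq1 : (1 : ℝ) ≤ q := by exact_mod_cast hq
  set β := α - b / q with hβ
  have hαβ : α = b / q + β := by rw [hβ]; ring
  have hβδ : |β| ≤ δ := by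
    have e : (q : ℝ) * α - b = q * β := by rw [hβ]; field_simp
    rw [e, abs_mul, abs_of_pos (by linarith : (0 : ℝ) < q)] at hb
    nlinarith [abs_nonneg β]
  set X : ℝ := ((2 * P + 1 : ℕ) : ℝ) with hX
  have hX0 : 0 < X := by positivity
  set Err := C * ((q * M : ℕ) : ℝ) ^ (d + 1) * X ^ (2 * n) / X * (1 + δ * X ^ (d + 1)) with hErr
  have key : ∀ x, ‖Sa F P M x α - (∑ u ∈ (rs n (q * M)).filter (fun u => cg M u x),
      ee ((b : ℝ) / q * (eval u F : ℤ))) * Wu F P (q * M) 0 β‖ ≤ ((q * M : ℕ) : ℝ) ^ n * Err := by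
    intro x
    rw [hαβ, Sa_major F P M q hq hM x b β, Finset.sum_mul, ← Finset.sum_sub_distrib]
    refine (norm_sum_le _ _).trans ((Finset.sum_le_sum (g := fun _ => Err) fun u hu => ?_).trans ?_)
    · rw [← mul_sub, norm_mul, norm_ee, one_mul]
      exact hW P (q * M) u β δ hH (Finset.mem_filter.1 hu).1 hβδ
    · rw [Finset.sum_const, nsmul_eq_mul]
      gcongr
      have := (Finset.card_filter_le (rs n (q * M)) (fun u => cg M u x)).trans (card_rs n (q * M)).le
      exact_mod_cast this
  have k1 := key a
  have k2 := key a'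
  rw [gauss_eq F q M hq hM a a' haa hs hs' b] at k1
  rw [norm_sub_rev] at k2
  have k3 := (norm_sub_le_norm_sub_add_norm_sub _ _ _).trans (add_le_add k1 k2)
  refine k3.trans ?_
  have hqM : ((q * M : ℕ) : ℝ) ≤ Q * M := by push_cast; gcongr
  calc ((q * M : ℕ) : ℝ) ^ n * Err + ((q * M : ℕ) : ℝ) ^ n * Err
      = 2 * C * ((q * M : ℕ) : ℝ) ^ (n + d + 1) * X ^ (2 * n) / X * (1 + δ * X ^ (d + 1)) := by
        rw [hErr, add_assoc n, pow_add _ n]; ring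
    _ ≤ (2 * C + 1) * (Q * M) ^ (n + d + 1) * X ^ (2 * n) / X * (1 + δ * X ^ (d + 1)) := by
        gcongr; linarith

end major

section equi
variable {n : ℕ}

lemma ra_diff (hn : 0 < n) (k : ℕ) (hnk : 2 * (k + 1) * 2 ^ (k + 1) + 1 ≤ n)
    (F : MvPolynomial (Fin n) ℤ) (hF : F.IsHomogeneous (k + 2)) (hs : SmoothF F) :
    ∃ (C ρ : ℝ) (A : ℕ), 1 ≤ C ∧ 0 < ρ ∧ ρ < 1 ∧ 1 ≤ A ∧
    (∀ P, 1 ≤ P → ∀ a, ra F P 1 a ≤ C * ((2 * P + 1 : ℕ) : ℝ) ^ (2 * n) / ((2 * P + 1 : ℕ) : ℝ) ^ (k + 2)) ∧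
    (∀ P M : ℕ, 1 ≤ P → 1 ≤ M → ∀ a a' (j0 : ℕ), (2 : ℝ) ^ j0 ≤ (2 * P + 1 : ℕ) →
      (M : ℤ) ∣ eval a F - eval a' F → smt F M a → smt F M a' →
      |ra F P M a - ra F P M a'| ≤ C * M ^ A * (((2 * P + 1 : ℕ) : ℝ) ^ (2 * n) /
        ((2 * P + 1 : ℕ) : ℝ) ^ (k + 2)) * (ρ ^ j0 + ((2 : ℝ) ^ j0) ^ A / ((2 * P + 1 : ℕ) : ℝ))) := by
  obtain ⟨C, ρ, hC, h0, h1, hr, hd⟩ := ra_mean hn k hnk F hF hs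
  obtain ⟨C', hC', hS⟩ := Sa_near hn F (k + 1) hF
  set m := n + (k + 1) + 1 with hm
  set A := (k + 4) * (m + 3) with hA
  refine ⟨C * (C' * C ^ m * 2), ρ, A, ?_, h0, h1, ?_, ?_, ?_⟩
  · have : 1 ≤ C ^ m := one_le_pow₀ hC
    have h2 : 1 ≤ C' * C ^ m := one_le_mul_of_one_le_of_one_le hC' this
    exact one_le_mul_of_one_le_of_one_le hC (by linarith)
  · rw [hA]; nlinarith
  · intro P hP a
    refine (hr P hP a).trans ?_
    gcongr
    have : 1 ≤ C ^ m := one_le_pow₀ hC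
    have h2 : 1 ≤ C' * C ^ m := one_le_mul_of_one_le_of_one_le hC' this
    nlinarith
  · intro P M hP hM a a' j0 hj0 haa hs1 hs2
    set X : ℝ := ((2 * P + 1 : ℕ) : ℝ) with hX
    have hX1 : 1 ≤ X := by rw [hX]; push_cast; have : (0 : ℝ) ≤ P := by positivity
                           linarith
    have hM1 : (1 : ℝ) ≤ M := by exact_mod_cast hM
    set T : ℝ := 2 ^ j0 with hT
    have hT1 : 1 ≤ T := one_le_pow₀ (by norm_num)
    set E : ℝ := C' * (C * M ^ (k + 2) * T ^ (k + 1) * M) ^ m * X ^ (2 * n) / X *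
      (1 + T ^ (k + 1)) with hE
    have hE0 : 0 ≤ E := by positivity
    have := hd P M hP hM a a' j0 hj0 E hE0 (by
      intro α hα
      have := hS P M a a' _ _ hM haa hs1 hs2 (by positivity) (by positivity) α hα
      refine this.trans (le_of_eq ?_)
      rw [hE, ← hX, ← hT]
      congr 2
      rw [div_mul_cancel₀]; positivity)
    refine this.trans ?_
    have e4 : ((4 : ℝ) ^ (k + 1)) ^ j0 = T ^ (2 * (k + 1)) := by
      rw [hT, show (4 : ℝ) = 2 ^ 2 by norm_num]; simp only [← pow_mul]; congr 1; ring
    have hEb : ((4 : ℝ) ^ (k + 1)) ^ j0 * E ≤ C' * C ^ m * 2 * M ^ ((k + 3) * m) * X ^ (2 * n) * (T ^ A / X) := by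
      have a1 : 1 + T ^ (k + 1) ≤ 2 * T ^ (k + 1) := by linarith [one_le_pow₀ hT1 (n := k + 1)]
      have a2 : T ^ (2 * (k + 1) + (k + 1) * m + (k + 1)) ≤ T ^ A :=
        pow_le_pow_right₀ hT1 (by rw [hA]; nlinarith)
      rw [e4, hE]
      calc T ^ (2 * (k + 1)) * (C' * (C * M ^ (k + 2) * T ^ (k + 1) * M) ^ m * X ^ (2 * n) / X * (1 + T ^ (k + 1)))
          ≤ T ^ (2 * (k + 1)) * (C' * (C * M ^ (k + 2) * T ^ (k + 1) * M) ^ m * X ^ (2 * n) / X * (2 * T ^ (k + 1))) := by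
            gcongr
        _ = C' * C ^ m * 2 * M ^ ((k + 3) * m) * X ^ (2 * n) * (T ^ (2 * (k + 1) + (k + 1) * m + (k + 1)) / X) := by
            rw [show C * (M : ℝ) ^ (k + 2) * T ^ (k + 1) * M = C * M ^ (k + 3) * T ^ (k + 1) by ring,
              mul_pow, mul_pow, ← pow_mul, ← pow_mul, pow_add, pow_add]
            ring
        _ ≤ _ := by gcongr
    have hc1 : (1 : ℝ) ≤ C' * C ^ m * 2 * M ^ ((k + 3) * m) := by
      have : 1 ≤ C ^ m := one_le_pow₀ hC
      have h2 : 1 ≤ C' * C ^ m := one_le_mul_of_one_le_of_one_le hC' this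
      exact one_le_mul_of_one_le_of_one_le (by linarith) (one_le_pow₀ hM1)
    have hb : ρ ^ j0 * X ^ (2 * n) ≤ C' * C ^ m * 2 * M ^ ((k + 3) * m) * X ^ (2 * n) * ρ ^ j0 := by
      rw [mul_assoc _ (X ^ (2 * n)), mul_comm (X ^ (2 * n))]
      exact le_mul_of_one_le_left (by positivity) hc1
    have hMA : (M : ℝ) ^ (n + k + 2) * M ^ ((k + 3) * m) ≤ M ^ A := by
      rw [← pow_add]
      exact pow_le_pow_right₀ hM1 (by rw [hA, hm]; nlinarith)
    calc C * M ^ (n + k + 2) / X ^ (k + 2) * (ρ ^ j0 * X ^ (2 * n) + ((4 : ℝ) ^ (k + 1)) ^ j0 * E)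
        ≤ C * M ^ (n + k + 2) / X ^ (k + 2) *
          (C' * C ^ m * 2 * M ^ ((k + 3) * m) * X ^ (2 * n) * ρ ^ j0 +
            C' * C ^ m * 2 * M ^ ((k + 3) * m) * X ^ (2 * n) * (T ^ A / X)) := by
          gcongr
      _ = C * (C' * C ^ m * 2) * (M ^ (n + k + 2) * M ^ ((k + 3) * m)) * (X ^ (2 * n) / X ^ (k + 2)) *
          (ρ ^ j0 + T ^ A / X) := by ring
      _ ≤ _ := by gcongr

lemma equidist (hn : 0 < n) (k : ℕ) (hnk : 2 * (k + 1) * 2 ^ (k + 1) + 1 ≤ n)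
    (F : MvPolynomial (Fin n) ℤ) (hF : F.IsHomogeneous (k + 2)) (hs : SmoothF F) :
    ∃ (C η : ℝ) (A : ℕ), 1 ≤ C ∧ 0 < η ∧
    (∀ P, 1 ≤ P → ∀ a, ra F P 1 a ≤ C * (((2 * P + 1 : ℕ) : ℝ) ^ (2 * n) / ((2 * P + 1 : ℕ) : ℝ) ^ (k + 2))) ∧
    (∀ P M : ℕ, 1 ≤ P → 1 ≤ M → ∀ a a',
      (M : ℤ) ∣ eval a F - eval a' F → smt F M a → smt F M a' →
      |ra F P M a - ra F P M a'| ≤ C * M ^ A * (((2 * P + 1 : ℕ) : ℝ) ^ (2 * n) /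
        ((2 * P + 1 : ℕ) : ℝ) ^ (k + 2)) * ((2 * P + 1 : ℕ) : ℝ) ^ (-η)) := by
  obtain ⟨C, ρ, A, hC, h0, h1, hA, hr, hd⟩ := ra_diff hn k hnk F hF hs
  set b : ℕ := 2 ^ (2 * A) with hb
  have hb1 : 1 < b := Nat.one_lt_two_pow (by omega)
  have hbr : (1 : ℝ) < b := by exact_mod_cast hb1
  set η' : ℝ := -Real.log ρ / Real.log b with hη'
  have hlb : 0 < Real.log b := Real.log_pos hbr
  have hη0 : 0 < η' := div_pos (by linarith [Real.log_neg h0 h1]) hlb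
  set η := min η' (1 / 2) with hη
  have hηpos : 0 < η := lt_min hη0 (by norm_num)
  have hρb : ρ = (b : ℝ) ^ (-η') := by
    rw [Real.rpow_def_of_pos (by linarith), hη']
    rw [show Real.log b * -(-Real.log ρ / Real.log b) = Real.log ρ by field_simp; ]
    exact (Real.exp_log h0).symm
  have hCρ : C ≤ C * (1 / ρ + 1) := le_mul_of_one_le_right (by linarith)
    (by have : 0 < 1 / ρ := by positivity
        linarith)
  refine ⟨C * (1 / ρ + 1), η, A, hC.trans hCρ, hηpos, ?_, ?_⟩
  · intro P hP a
    refine (hr P hP a).trans ?_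
    rw [mul_div_assoc]
    gcongr
  · intro P M hP hM a a' haa hs1 hs2
    set X : ℝ := ((2 * P + 1 : ℕ) : ℝ) with hX
    have hX1 : 1 ≤ X := by rw [hX]; push_cast; have : (0 : ℝ) ≤ P := by positivity
                           linarith
    set j0 := Nat.log b (2 * P + 1) with hj0
    have hlow : (b : ℝ) ^ j0 ≤ X := by
      rw [hX]; exact_mod_cast Nat.pow_log_le_self b (by omega)
    have hup : X ≤ (b : ℝ) ^ (j0 + 1) := by
      rw [hX]; exact_mod_cast (Nat.lt_pow_succ_log_self hb1 _).le
    have hbT : (b : ℝ) ^ j0 = (((2 : ℝ) ^ j0) ^ A) ^ 2 := by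
      rw [hb]; push_cast; simp only [← pow_mul]; congr 1; ring
    have h2j : (2 : ℝ) ^ j0 ≤ X := by
      refine le_trans ?_ hlow
      rw [hbT, ← pow_mul]
      exact le_self_pow₀ (one_le_pow₀ (by norm_num)) (by omega)
    refine (hd P M hP hM a a' j0 h2j haa hs1 hs2).trans ?_
    have e1 : ((2 : ℝ) ^ j0) ^ A / X ≤ X ^ (-η) := by
      have s1 : ((2 : ℝ) ^ j0) ^ A ≤ X ^ (1 / 2 : ℝ) := by
        rw [← Real.sqrt_eq_rpow]
        refine Real.le_sqrt_of_sq_le ?_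
        rw [← hbT]; exact hlow
      calc ((2 : ℝ) ^ j0) ^ A / X ≤ X ^ (1 / 2 : ℝ) / X := by gcongr
        _ = X ^ (-(1 / 2) : ℝ) := by
          nth_rewrite 2 [← Real.rpow_one X]
          rw [← Real.rpow_sub (by linarith)]; norm_num
        _ ≤ X ^ (-η) := Real.rpow_le_rpow_of_exponent_le hX1 (by linarith [min_le_right η' (1 / 2 : ℝ)])
    have e2 : ρ ^ j0 ≤ 1 / ρ * X ^ (-η) := by
      have : ρ ^ (j0 + 1) ≤ X ^ (-η') := by
        rw [hρb, ← Real.rpow_natCast, ← Real.rpow_mul (by linarith), mul_comm, Real.rpow_mul (by linarith),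
          Real.rpow_natCast]
        exact Real.rpow_le_rpow_of_nonpos (by linarith) hup (by linarith)
      have h3 : X ^ (-η') ≤ X ^ (-η) :=
        Real.rpow_le_rpow_of_exponent_le hX1 (by linarith [min_le_left η' (1 / 2 : ℝ)])
      rw [one_div, inv_mul_eq_div, le_div_iff₀ h0, ← pow_succ]
      exact this.trans h3
    have hXX : 0 ≤ X ^ (2 * n) / X ^ (k + 2) := by positivity
    calc C * M ^ A * (X ^ (2 * n) / X ^ (k + 2)) * (ρ ^ j0 + ((2 : ℝ) ^ j0) ^ A / X)
        ≤ C * M ^ A * (X ^ (2 * n) / X ^ (k + 2)) * (1 / ρ * X ^ (-η) + X ^ (-η)) := by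
          gcongr
      _ = _ := by ring

end equi

section sieve

lemma sieve_avg {κ τ β : Type} [DecidableEq β] [Fintype κ] [DecidableEq κ] (T : Finset τ) (φ : κ → τ → β)
    (X : κ → Finset β) (hX : ∀ i, (X i).Nonempty) (g : κ → β → ℝ)
    (hg : ∀ i b, b ∉ X i → g i b = 0) (E : ℝ)
    (hE : ∀ A ∈ Fintype.piFinset X, ∀ A' ∈ Fintype.piFinset X,
      |((T.filter (fun t => (fun i => φ i t) = A)).card : ℝ) -
        ((T.filter (fun t => (fun i => φ i t) = A')).card : ℝ)| ≤ E) :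
    ∃ r : ℝ, 0 ≤ r ∧ r * ∏ i, ((X i).card : ℝ) ≤ T.card ∧
      |∑ t ∈ T, ∏ i, g i (φ i t) - r * ∏ i, ∑ b ∈ X i, g i b| ≤ E * ∏ i, ∑ b ∈ X i, |g i b| := by
  set R : (κ → β) → ℝ := fun A => ((T.filter (fun t => (fun i => φ i t) = A)).card : ℝ) with hR
  set Y := Fintype.piFinset X with hY
  have hYne : Y.Nonempty := Fintype.piFinset_nonempty.mpr hX
  obtain ⟨A0, hA0, hmin⟩ := Finset.exists_min_image Y R hYne
  refine ⟨R A0, by positivity, ?_, ?_⟩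
  · have h1 : (Y.card : ℝ) = ∏ i, ((X i).card : ℝ) := by
      rw [hY, Fintype.card_piFinset]; push_cast; rfl
    rw [← h1]
    have h2 : R A0 * Y.card ≤ ∑ A ∈ Y, R A := by
      rw [mul_comm, ← nsmul_eq_mul]
      exact Finset.card_nsmul_le_sum _ _ _ hmin
    refine h2.trans ?_
    simp only [hR]
    rw [← Nat.cast_sum, Nat.cast_le]
    have : ∑ A ∈ Y, (T.filter (fun t => (fun i => φ i t) = A)).card
        = (T.filter (fun t => (fun i => φ i t) ∈ Y)).card := by
      rw [Finset.card_eq_sum_card_fiberwise (f := fun t => (fun i => φ i t)) (t := Y)]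
      · refine Finset.sum_congr rfl fun A hA => ?_
        congr 1
        ext t
        simp only [Finset.mem_filter]
        constructor
        · rintro ⟨h, h'⟩; exact ⟨⟨h, h' ▸ hA⟩, h'⟩
        · rintro ⟨⟨h, _⟩, h'⟩; exact ⟨h, h'⟩
      · intro t ht
        simpa using (Finset.mem_filter.mp ht).2
    rw [this]
    exact Finset.card_filter_le _ _
  · have h1 : ∑ t ∈ T, ∏ i, g i (φ i t) = ∑ A ∈ Y, R A * ∏ i, g i (A i) := by
      have h2 : ∑ t ∈ T, ∏ i, g i (φ i t) =
          ∑ t ∈ T.filter (fun t => (fun i => φ i t) ∈ Y), ∏ i, g i (φ i t) := by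
        symm
        refine Finset.sum_subset (Finset.filter_subset _ _) fun t ht ht' => ?_
        have : ∃ i, φ i t ∉ X i := by
          by_contra hc
          push Not at hc
          exact ht' (Finset.mem_filter.mpr ⟨ht, Fintype.mem_piFinset.mpr hc⟩)
        obtain ⟨i, hi⟩ := this
        exact Finset.prod_eq_zero (Finset.mem_univ i) (hg i _ hi)
      rw [h2, ← Finset.sum_fiberwise_of_maps_to (t := Y) (g := fun t => (fun i => φ i t))]
      · refine Finset.sum_congr rfl fun A hA => ?_
        rw [hR]
        simp only
        rw [← nsmul_eq_mul, ← Finset.sum_const]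
        refine Finset.sum_congr ?_ ?_
        · ext t
          simp only [Finset.mem_filter]
          constructor
          · rintro ⟨⟨h, _⟩, h'⟩; exact ⟨h, h'⟩
          · rintro ⟨h, h'⟩; exact ⟨⟨h, h' ▸ hA⟩, h'⟩
        · intro t ht
          have := (Finset.mem_filter.mp ht).2
          rw [← this]
      · intro t ht
        exact (Finset.mem_filter.mp ht).2
    rw [h1, Finset.prod_univ_sum, Finset.prod_univ_sum, Finset.mul_sum, Finset.mul_sum,
      ← Finset.sum_sub_distrib]
    refine (Finset.abs_sum_le_sum_abs _ _).trans (Finset.sum_le_sum fun A hA => ?_)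
    rw [← sub_mul, abs_mul, Finset.abs_prod]
    exact mul_le_mul_of_nonneg_right (hE A hA A0 hA0) (Finset.prod_nonneg fun _ _ => abs_nonneg _)

lemma sieve_main {τ : Type} (T T0 : Finset τ) (hT : T0 ⊆ T) (K : Finset (Finset ℕ))
    (f : ℕ → τ → ℝ) (h : ℕ → ℝ) (E : ℝ) (hE : 0 ≤ E) (hh : ∀ S ∈ K, ∀ p ∈ S, 0 ≤ h p) (h0 : ∅ ∈ K)
    (hf : ∀ S ∈ K, ∀ p ∈ S, ∀ t ∈ T0, f p t = h p)
    (hoff : ∀ S ∈ K, ∀ S' ∈ K, S ≠ S' → ∑ t ∈ T, (∏ p ∈ S, f p t) * ∏ p ∈ S', f p t ≤ E)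
    (hdiag : ∀ S ∈ K, ∑ t ∈ T, (∏ p ∈ S, f p t) * ∏ p ∈ S, f p t ≤ T.card * ∏ p ∈ S, h p + E) :
    1 ≤ ∑ S ∈ K, ∏ p ∈ S, h p ∧
    (T0.card : ℝ) ≤ T.card / (∑ S ∈ K, ∏ p ∈ S, h p) + K.card ^ 2 * E := by
  set G := ∑ S ∈ K, ∏ p ∈ S, h p with hG
  have hG1 : 1 ≤ G := by
    have := Finset.single_le_sum (f := fun S => ∏ p ∈ S, h p)
      (fun S hS => Finset.prod_nonneg (hh S hS)) h0
    simpa using this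
  refine ⟨hG1, ?_⟩
  have h1 : (T0.card : ℝ) * G ^ 2 ≤ ∑ t ∈ T, (∑ S ∈ K, ∏ p ∈ S, f p t) ^ 2 := by
    have : (T0.card : ℝ) * G ^ 2 = ∑ t ∈ T0, (∑ S ∈ K, ∏ p ∈ S, f p t) ^ 2 := by
      rw [← nsmul_eq_mul, ← Finset.sum_const]
      refine Finset.sum_congr rfl fun t ht => ?_
      congr 1
      exact Finset.sum_congr rfl fun S hS => Finset.prod_congr rfl fun p hp => (hf S hS p hp t ht).symm
    rw [this]
    exact Finset.sum_le_sum_of_subset_of_nonneg hT fun _ _ _ => sq_nonneg _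
  have h2 : ∑ t ∈ T, (∑ S ∈ K, ∏ p ∈ S, f p t) ^ 2 ≤ T.card * G + K.card ^ 2 * E := by
    have : ∑ t ∈ T, (∑ S ∈ K, ∏ p ∈ S, f p t) ^ 2 =
        ∑ S ∈ K, ∑ S' ∈ K, ∑ t ∈ T, (∏ p ∈ S, f p t) * ∏ p ∈ S', f p t := by
      simp_rw [sq, Finset.sum_mul_sum]
      rw [Finset.sum_comm]
      refine Finset.sum_congr rfl fun S _ => ?_
      rw [Finset.sum_comm]
    rw [this]
    calc _ ≤ ∑ S ∈ K, ∑ S' ∈ K, ((if S = S' then T.card * ∏ p ∈ S, h p else 0) + E) := by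
          refine Finset.sum_le_sum fun S hS => Finset.sum_le_sum fun S' hS' => ?_
          by_cases hSS : S = S'
          · subst hSS; rw [if_pos rfl]; exact hdiag S hS
          · rw [if_neg hSS, zero_add]; exact hoff S hS S' hS' hSS
      _ = T.card * G + K.card ^ 2 * E := by
          simp_rw [Finset.sum_add_distrib]
          have e1 : ∑ x ∈ K, ∑ x_1 ∈ K, (if x = x_1 then (T.card : ℝ) * ∏ p ∈ x, h p else 0)
            = T.card * G := by
            rw [hG, Finset.mul_sum]
            refine Finset.sum_congr rfl fun S hS => ?_
            rw [Finset.sum_ite_eq, if_pos hS]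
          rw [e1]
          simp only [Finset.sum_const, nsmul_eq_mul]
          ring
  have hGp : 0 < G := by linarith
  have h3 : (T0.card : ℝ) * G ^ 2 ≤ (T.card / G + K.card ^ 2 * E) * G ^ 2 := by
    refine (h1.trans h2).trans ?_
    have : (T.card / G + K.card ^ 2 * E) * G ^ 2 = T.card * G + (K.card ^ 2 * E) * G ^ 2 := by
      field_simp
    rw [this]
    have : 1 ≤ G ^ 2 := one_le_pow₀ hG1
    have h5 : 0 ≤ (K.card : ℝ) ^ 2 * E := by positivity
    nlinarith
  exact le_of_mul_le_mul_right h3 (by positivity)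

end sieve

section sieve2

lemma sieve_corr {τ β : Type} [DecidableEq β] (T : Finset τ) (φ : ℕ → τ → β) (X : ℕ → Finset β)
    (f : ℕ → β → ℝ) (h c : ℕ → ℝ) (S S' U : Finset ℕ) (hU : U = S ∪ S') (E : ℝ) (hE0 : 0 ≤ E)
    (hX : ∀ p ∈ U, (X p).Nonempty) (hf : ∀ p ∈ U, ∀ b, b ∉ X p → f p b = 0)
    (hf0 : ∀ p ∈ U, ∑ b ∈ X p, f p b = 0)
    (hf2 : ∀ p ∈ U, ∑ b ∈ X p, f p b * f p b = (X p).card * h p)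
    (hc1 : ∀ p ∈ U, 1 ≤ c p) (hfc : ∀ p ∈ U, ∀ b, |f p b| ≤ c p)
    (hXc : ∀ p ∈ U, ((X p).card : ℝ) ≤ c p) (hh : ∀ p ∈ U, 0 ≤ h p)
    (hE : ∀ A ∈ Fintype.piFinset (fun i : ↥U => X i),
      ∀ A' ∈ Fintype.piFinset (fun i : ↥U => X i),
      |((T.filter (fun t => (fun i : ↥U => φ i t) = A)).card : ℝ) -
        ((T.filter (fun t => (fun i : ↥U => φ i t) = A')).card : ℝ)| ≤ E) :
    ∑ t ∈ T, (∏ p ∈ S, f p (φ p t)) * ∏ p ∈ S', f p (φ p t) ≤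
      (if S = S' then T.card * ∏ p ∈ S, h p else 0) + E * (∏ p ∈ U, c p) ^ 3 := by
  set g : ℕ → β → ℝ := fun p b => (if p ∈ S then f p b else 1) * (if p ∈ S' then f p b else 1) with hg
  have hgs : ∀ p ∈ U, ∀ b, b ∉ X p → g p b = 0 := by
    intro p hp b hb
    rcases Finset.mem_union.mp (hU ▸ hp) with h1 | h1
    · simp [hg, h1, hf p hp b hb]
    · simp [hg, h1, hf p hp b hb]
  obtain ⟨r, hr0, hr1, hr2⟩ := sieve_avg T (fun i : ↥U => φ i) (fun i : ↥U => X i)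
    (fun i => hX i i.2) (fun i : ↥U => g i) (fun i b hb => hgs i i.2 b hb) E hE
  have e1 : ∀ t, ∏ i : ↥U, g i (φ i t) = (∏ p ∈ S, f p (φ p t)) * ∏ p ∈ S', f p (φ p t) := by
    intro t
    rw [Finset.prod_coe_sort U (fun i => g i (φ i t))]
    simp only [hg]
    rw [Finset.prod_mul_distrib, Finset.prod_ite_mem, Finset.prod_ite_mem,
      Finset.inter_eq_right.mpr (hU ▸ Finset.subset_union_left),
      Finset.inter_eq_right.mpr (hU ▸ Finset.subset_union_right)]
  simp only [e1] at hr2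
  rw [Finset.prod_coe_sort U (fun i => ((X i).card : ℝ))] at hr1
  rw [Finset.prod_coe_sort U (fun i => ∑ b ∈ X i, g i b),
    Finset.prod_coe_sort U (fun i => ∑ b ∈ X i, |g i b|)] at hr2
  have hgc : ∀ p ∈ U, ∀ b, |g p b| ≤ c p ^ 2 := by
    intro p hp b
    simp only [hg, abs_mul, sq]
    have : 0 ≤ c p := by linarith [hc1 p hp]
    refine mul_le_mul ?_ ?_ (abs_nonneg _) this
    · split_ifs
      · exact hfc p hp b
      · simpa using hc1 p hp
    · split_ifs
      · exact hfc p hp b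
      · simpa using hc1 p hp
  have hprod : ∏ p ∈ U, ∑ b ∈ X p, |g p b| ≤ (∏ p ∈ U, c p) ^ 3 := by
    rw [← Finset.prod_pow]
    refine Finset.prod_le_prod (fun _ _ => Finset.sum_nonneg fun _ _ => abs_nonneg _) fun p hp => ?_
    have := Finset.sum_le_card_nsmul (X p) (fun b => |g p b|) (c p ^ 2) fun b _ => hgc p hp b
    rw [nsmul_eq_mul] at this
    refine this.trans ?_
    rw [pow_succ' (c p) 2]
    exact mul_le_mul_of_nonneg_right (hXc p hp) (sq_nonneg _)
  have hfin := (abs_le.mp hr2).2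
  have hEp : E * ∏ p ∈ U, ∑ b ∈ X p, |g p b| ≤ E * (∏ p ∈ U, c p) ^ 3 :=
    mul_le_mul_of_nonneg_left hprod hE0
  have key : r * ∏ p ∈ U, ∑ b ∈ X p, g p b ≤ (if S = S' then T.card * ∏ p ∈ S, h p else 0) := by
    split_ifs with hSS
    · have hUS : U = S := by rw [hU, ← hSS, Finset.union_self]
      have : ∏ p ∈ U, ∑ b ∈ X p, g p b = (∏ p ∈ U, ((X p).card : ℝ)) * ∏ p ∈ U, h p := by
        rw [← Finset.prod_mul_distrib]
        refine Finset.prod_congr rfl fun p hp => ?_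
        rw [← hf2 p hp]
        refine Finset.sum_congr rfl fun b _ => ?_
        have h1 : p ∈ S := hUS ▸ hp
        simp only [hg, if_pos h1, if_pos (hSS ▸ h1 : p ∈ S')]
      rw [this, ← mul_assoc]
      rw [← hUS]
      exact mul_le_mul_of_nonneg_right hr1 (Finset.prod_nonneg hh)
    · have : ∃ p ∈ U, ¬ (p ∈ S ↔ p ∈ S') := by
        by_contra hc
        push Not at hc
        refine hSS (Finset.ext fun p => ⟨fun hp => ?_, fun hp => ?_⟩)
        · exact (hc p (hU ▸ Finset.mem_union_left _ hp)).mp hp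
        · exact (hc p (hU ▸ Finset.mem_union_right _ hp)).mpr hp
      obtain ⟨p, hp, hpS⟩ := this
      have h0 : ∑ b ∈ X p, g p b = 0 := by
        rw [← hf0 p hp]
        refine Finset.sum_congr rfl fun b _ => ?_
        simp only [hg]
        by_cases h1 : p ∈ S
        · have h2 : p ∉ S' := fun h2 => hpS ⟨fun _ => h2, fun _ => h1⟩
          simp [h1, h2]
        · have h2 : p ∈ S' := by
            rcases Finset.mem_union.mp (hU ▸ hp) with h3 | h3
            · exact absurd h3 h1
            · exact h3
          simp [h1, h2]
      rw [Finset.prod_eq_zero hp h0, mul_zero]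
  linarith

/-- the sieving function -/
def fS {β : Type} (Y X : Finset β) (h : ℝ) (b : β) : ℝ :=
  if b ∈ Y then h else if b ∈ X then -1 else 0

lemma fS_facts {β : Type} (Y X : Finset β) (hY : Y.Nonempty) (hYX : Y ⊆ X) (h w : ℝ)
    (hw : w = 1 - (Y.card : ℝ) / X.card) (hh : h = w / (1 - w)) :
    0 ≤ h ∧ h ≤ X.card ∧ (∑ b ∈ X, fS Y X h b = 0) ∧
      (∑ b ∈ X, fS Y X h b * fS Y X h b = X.card * h) ∧
      ∀ b, |fS Y X h b| ≤ X.card := by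
  have hy : 1 ≤ (Y.card : ℝ) := by exact_mod_cast hY.card_pos
  have hyx : (Y.card : ℝ) ≤ X.card := by exact_mod_cast Finset.card_le_card hYX
  have hx : (0 : ℝ) < X.card := by linarith
  have hh' : h * Y.card = X.card - Y.card := by
    have h3 : (Y.card : ℝ) ≠ 0 := by linarith
    have h4 : 1 - w = Y.card / X.card := by rw [hw]; ring
    rw [hh, h4, hw]
    field_simp
  have h0 : 0 ≤ h := by
    by_contra hc
    push Not at hc
    nlinarith
  have h1 : h ≤ X.card := by nlinarith
  have hsplit : ∀ u : β → ℝ, ∑ b ∈ X, u b = ∑ b ∈ Y, u b + ∑ b ∈ X \ Y, u b := by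
    intro u
    rw [add_comm, Finset.sum_sdiff hYX]
  have hcard : ((X \ Y).card : ℝ) = X.card - Y.card := by
    rw [Finset.card_sdiff_of_subset hYX, Nat.cast_sub (Finset.card_le_card hYX)]
  have e1 : ∀ b ∈ Y, fS Y X h b = h := fun b hb => by simp [fS, hb]
  have e2 : ∀ b ∈ X \ Y, fS Y X h b = -1 := fun b hb => by
    obtain ⟨hb1, hb2⟩ := Finset.mem_sdiff.mp hb
    simp [fS, hb1, hb2]
  refine ⟨h0, h1, ?_, ?_, ?_⟩
  · rw [hsplit, Finset.sum_congr rfl e1, Finset.sum_congr rfl e2]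
    simp only [Finset.sum_const, nsmul_eq_mul, hcard]
    linarith
  · rw [hsplit, Finset.sum_congr rfl (fun b hb => by rw [e1 b hb] : ∀ b ∈ Y, _ = h * h),
      Finset.sum_congr rfl (fun b hb => by rw [e2 b hb] : ∀ b ∈ X \ Y, _ = (-1 : ℝ) * (-1))]
    simp only [Finset.sum_const, nsmul_eq_mul, hcard]
    linear_combination (h - 1) * hh'
  · intro b
    have : (1 : ℝ) ≤ X.card := by linarith
    unfold fS
    split_ifs
    · rw [abs_of_nonneg h0]; exact h1
    · simpa using this
    · simp

/-- integer representatives of a set of residues -/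
def rep {n : ℕ} (q : ℕ) (S : Set (Fin n → ZMod q)) : Finset (Fin n → ℤ) :=
  (rs n q).filter (fun a => (fun i => ((a i : ℤ) : ZMod q)) ∈ S)

lemma card_rep {n : ℕ} (q : ℕ) (hq : 1 ≤ q) (S : Set (Fin n → ZMod q)) :
    (rep q S).card = Nat.card S := by
  have : NeZero q := ⟨by omega⟩
  rw [← Fintype.card_coe, ← Nat.card_eq_fintype_card]
  refine Nat.card_eq_of_bijective (fun a : ↥(rep q S) =>
    (⟨fun i => ((a.1 i : ℤ) : ZMod q), (Finset.mem_filter.mp a.2).2⟩ : S)) ⟨?_, ?_⟩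
  · intro a b hab
    apply Subtype.ext
    have h1 := congrArg Subtype.val hab
    simp only at h1
    rw [← red_of_mem (Finset.mem_filter.mp a.2).1, ← red_of_mem (Finset.mem_filter.mp b.2).1,
      red_eq_iff]
    intro i
    have := congrFun h1 i
    exact (ZMod.intCast_eq_intCast_iff_dvd_sub _ _ _).mp this.symm
  · rintro ⟨y, hy⟩
    have e : (fun i => ((((y i).val : ℤ) : ℤ) : ZMod q)) = y := by
      funext i; simp
    refine ⟨⟨fun i => ((y i).val : ℤ), ?_⟩, ?_⟩
    · refine Finset.mem_filter.mpr ⟨mem_rs.2 fun i => ⟨by positivity, ?_⟩, ?_⟩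
      · exact_mod_cast ZMod.val_lt (y i)
      · rw [e]; exact hy
    · exact Subtype.ext e

lemma cast_red {n : ℕ} (q : ℕ) (x : Fin n → ℤ) :
    (fun i => ((red q x i : ℤ) : ZMod q)) = fun i => ((x i : ℤ) : ZMod q) := by
  funext i
  simp [red]

lemma red_mem_rep {n : ℕ} {q : ℕ} (hq : 1 ≤ q) {S : Set (Fin n → ZMod q)} {x : Fin n → ℤ} :
    red q x ∈ rep q S ↔ (fun i => ((x i : ℤ) : ZMod q)) ∈ S := by
  rw [rep, Finset.mem_filter, cast_red]
  exact ⟨fun h => h.2, fun h => ⟨red_mem hq x, h⟩⟩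

lemma rep_mono {n : ℕ} {q : ℕ} {S S' : Set (Fin n → ZMod q)} (h : S ⊆ S') : rep q S ⊆ rep q S' :=
  fun _ ha => Finset.mem_filter.mpr ⟨(Finset.mem_filter.mp ha).1, h (Finset.mem_filter.mp ha).2⟩

end sieve2

section sieve3
variable {n : ℕ}

/-- pairs with sum on the hypersurface -/
def TT (F : MvPolynomial (Fin n) ℤ) (P : ℕ) : Finset ((Fin n → ℤ) × (Fin n → ℤ)) :=
  ((Bx n P) ×ˢ (Bx n P)).filter (fun t => eval (t.1 + t.2) F = 0)

lemma ra_card (F : MvPolynomial (Fin n) ℤ) (P M : ℕ) (a : Fin n → ℤ)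
    (p : (Fin n → ℤ) × (Fin n → ℤ) → Prop) [DecidablePred p]
    (hp : ∀ t ∈ TT F P, p t ↔ cg M (t.1 + t.2) a) :
    (((TT F P).filter p).card : ℝ) = ra F P M a := by
  unfold ra
  rw [Finset.card_filter, TT, Finset.sum_filter, Finset.sum_product]
  push_cast
  refine Finset.sum_congr rfl fun y hy => ?_
  rw [Finset.sum_filter]
  refine Finset.sum_congr rfl fun z hz => ?_
  by_cases h : eval (y + z) F = 0
  · have h1 := hp (y, z) (by simp [TT, hy, hz, h])
    simp only [h, if_true]
    by_cases h2 : p (y, z)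
    · rw [if_pos h2, if_pos (h1.1 h2)]
    · rw [if_neg h2, if_neg (fun h3 => h2 (h1.2 h3))]
  · simp [h]

lemma crt_vec (m : ℕ) (U : Finset ℕ) (hU : ∀ p ∈ U, p.Prime) (A : ↥U → Fin n → ℤ) :
    ∃ a : Fin n → ℤ, ∀ p : ↥U, cg ((p : ℕ) ^ m) a (A p) := by
  have h : ∀ j : Fin n, ∃ r : ℤ, ∀ p : ↥U, (((p : ℕ) ^ m : ℕ) : ℤ) ∣ r - A p j := by
    intro j
    obtain ⟨r, hr⟩ := Ideal.exists_forall_sub_mem_ideal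
      (I := fun p : ↥U => Ideal.span {(((p : ℕ) ^ m : ℕ) : ℤ)}) (by
        intro p q hpq
        change IsCoprime (Ideal.span {(((p : ℕ) ^ m : ℕ) : ℤ)}) (Ideal.span {(((q : ℕ) ^ m : ℕ) : ℤ)})
        rw [Ideal.isCoprime_span_singleton_iff, Nat.isCoprime_iff_coprime]
        refine Nat.Coprime.pow _ _ ((Nat.coprime_primes (hU p p.2) (hU q q.2)).mpr ?_)
        exact fun h => hpq (Subtype.ext h)) (fun p => A p j)
    exact ⟨r, fun p => Ideal.mem_span_singleton.mp (hr p)⟩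
  choose a ha using h
  exact ⟨a, fun p j => ha j p⟩

lemma pprod_dvd_iff (m : ℕ) (U : Finset ℕ) (hU : ∀ p ∈ U, p.Prime) (z : ℤ) :
    ((∏ p ∈ U, p ^ m : ℕ) : ℤ) ∣ z ↔ ∀ p ∈ U, ((p ^ m : ℕ) : ℤ) ∣ z := by
  rw [Nat.cast_prod]
  constructor
  · intro h p hp
    exact (Finset.dvd_prod_of_mem (fun p : ℕ => ((p ^ m : ℕ) : ℤ)) hp).trans h
  · intro h
    refine Finset.prod_dvd_of_coprime ?_ h
    intro p hp q hq hpq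
    change IsCoprime ((p ^ m : ℕ) : ℤ) ((q ^ m : ℕ) : ℤ)
    rw [Nat.isCoprime_iff_coprime]
    exact Nat.Coprime.pow _ _ ((Nat.coprime_primes (hU p hp) (hU q hq)).mpr hpq)

lemma mem_rep_Xhat {N : ℕ} {F : MvPolynomial (Fin (N + 1)) ℤ} {p m : ℕ} (hp : p.Prime)
    {b : Fin (N + 1) → ℤ} (hb : b ∈ rep (p ^ m) (Xhat N F p m)) :
    (∃ i, ¬ (p : ℤ) ∣ b i) ∧ ((p ^ m : ℕ) : ℤ) ∣ eval b F := by
  obtain ⟨h1, ⟨i, hi⟩, h2⟩ := Finset.mem_filter.mp hb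
  have : NeZero (p ^ m) := ⟨(pow_pos hp.pos m).ne'⟩
  refine ⟨⟨i, fun hd => hi ?_⟩, ?_⟩
  · have h3 := ZMod.val_intCast (n := p ^ m) (b i)
    rw [Int.emod_eq_of_lt (mem_rs.1 h1 i).1 (mem_rs.1 h1 i).2] at h3
    rw [← h3] at hd
    exact_mod_cast hd
  · rw [← ZMod.intCast_zmod_eq_zero_iff_dvd, ← h2, eval_map]
    exact eval₂_comp_left (Int.castRingHom (ZMod (p ^ m))) (RingHom.id ℤ) b F

lemma corr_err {N : ℕ} (m : ℕ) (hm : 1 ≤ m) (F : MvPolynomial (Fin (N + 1)) ℤ)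
    (D : ℕ) (hD : ∀ p : ℕ, p.Prime → ¬ p ∣ D → ∀ x : Fin (N + 1) → ℤ,
      (∃ i, ¬ (p : ℤ) ∣ x i) → ∃ i, ¬ (p : ℤ) ∣ eval x (pderiv i F))
    (P : ℕ) (E : ℕ → ℝ) (hE : ∀ M : ℕ, 1 ≤ M → ∀ a a',
      (M : ℤ) ∣ eval a F - eval a' F → smt F M a → smt F M a' → |ra F P M a - ra F P M a'| ≤ E M)
    (U : Finset ℕ) (hU : ∀ p ∈ U, p.Prime ∧ ¬ p ∣ D) :
    ∀ A ∈ Fintype.piFinset (fun i : ↥U => rep ((i : ℕ) ^ m) (Xhat N F i m)),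
      ∀ A' ∈ Fintype.piFinset (fun i : ↥U => rep ((i : ℕ) ^ m) (Xhat N F i m)),
      |(((TT F P).filter (fun t => (fun i : ↥U => red ((i : ℕ) ^ m) (t.1 + t.2)) = A)).card : ℝ) -
        (((TT F P).filter (fun t => (fun i : ↥U => red ((i : ℕ) ^ m) (t.1 + t.2)) = A')).card : ℝ)|
        ≤ E (∏ p ∈ U, p ^ m) := by
  have key : ∀ A ∈ Fintype.piFinset (fun i : ↥U => rep ((i : ℕ) ^ m) (Xhat N F i m)),
      ∃ a, ((∏ p ∈ U, p ^ m : ℕ) : ℤ) ∣ eval a F ∧ smt F (∏ p ∈ U, p ^ m) a ∧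
      (((TT F P).filter (fun t => (fun i : ↥U => red ((i : ℕ) ^ m) (t.1 + t.2)) = A)).card : ℝ) =
        ra F P (∏ p ∈ U, p ^ m) a := by
    intro A hA
    rw [Fintype.mem_piFinset] at hA
    obtain ⟨a, ha⟩ := crt_vec m U (fun p hp => (hU p hp).1) A
    refine ⟨a, ?_, ?_, ?_⟩
    · rw [pprod_dvd_iff m U (fun p hp => (hU p hp).1)]
      intro p hp
      have h1 := (mem_rep_Xhat (hU p hp).1 (hA ⟨p, hp⟩)).2
      have h2 := cg_eval F (ha ⟨p, hp⟩)
      simpa using dvd_add h2 h1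
    · intro p hp hpU
      obtain ⟨q, hq, hpq⟩ := (Prime.dvd_finsetProd_iff hp.prime _).mp hpU
      have hpq' : p = q := (Nat.prime_dvd_prime_iff_eq hp (hU q hq).1).mp (hp.dvd_of_dvd_pow hpq)
      subst hpq'
      refine hD p hp (hU p hq).2 a ?_
      obtain ⟨i, hi⟩ := (mem_rep_Xhat hp (hA ⟨p, hq⟩)).1
      refine ⟨i, fun hai => hi ?_⟩
      have h3 : (p : ℤ) ∣ a i - A ⟨p, hq⟩ i := by
        refine dvd_trans ?_ (ha ⟨p, hq⟩ i)
        exact_mod_cast dvd_pow_self p (by omega : m ≠ 0)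
      have := dvd_sub hai h3
      simpa using this
    · refine ra_card F P _ a _ fun t _ => ?_
      constructor
      · intro h i
        rw [pprod_dvd_iff m U (fun p hp => (hU p hp).1)]
        intro p hp
        have h1 := congrFun h ⟨p, hp⟩
        simp only at h1
        rw [← red_of_mem (Finset.mem_filter.mp (hA ⟨p, hp⟩)).1, red_eq_iff] at h1
        exact (h1.trans (ha ⟨p, hp⟩).symm) i
      · intro h
        funext p
        rw [← red_of_mem (Finset.mem_filter.mp (hA p)).1, red_eq_iff]
        refine cg.trans ?_ (ha p)
        intro i
        exact (pprod_dvd_iff m U (fun p hp => (hU p hp).1) _).mp (h i) p p.2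
  intro A hA A' hA'
  obtain ⟨a, h1, h2, h3⟩ := key A hA
  obtain ⟨a', h1', h2', h3'⟩ := key A' hA'
  rw [h3, h3']
  exact hE _ (Finset.prod_pos fun p hp => pow_pos (hU p hp).1.pos _) a a' (dvd_sub h1 h1') h2 h2'

end sieve3

section sieve4

/-- admissible moduli -/
def adm (D Q : ℕ) : Finset ℕ :=
  (Finset.range (Q + 1)).filter (fun q => Squarefree q ∧ ∀ p ∈ q.primeFactors, ¬ p ∣ D)

lemma union_prod_le (Q : ℕ) (q q' : ℕ) (hq : Squarefree q) (hq' : Squarefree q') (h : q ≤ Q)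
    (h' : q' ≤ Q) : ∏ p ∈ q.primeFactors ∪ q'.primeFactors, p ≤ Q ^ 2 := by
  have h1 := Finset.prod_union_inter (s₁ := q.primeFactors) (s₂ := q'.primeFactors) (f := fun p => p)
  have e1 : ∏ p ∈ q.primeFactors, p = q := Nat.prod_primeFactors_of_squarefree hq
  have e2 : ∏ p ∈ q'.primeFactors, p = q' := Nat.prod_primeFactors_of_squarefree hq'
  have h2 : 1 ≤ ∏ p ∈ q.primeFactors ∩ q'.primeFactors, p :=
    Finset.prod_pos fun p hp => (Nat.prime_of_mem_primeFactors (Finset.mem_inter.mp hp).1).pos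
  calc _ ≤ (∏ p ∈ q.primeFactors ∪ q'.primeFactors, p) * ∏ p ∈ q.primeFactors ∩ q'.primeFactors, p :=
        Nat.le_mul_of_pos_right _ h2
    _ = q * q' := by rw [h1, e1, e2]
    _ ≤ Q ^ 2 := by rw [sq]; exact Nat.mul_le_mul h h'

theorem sieve_bound (N k m : ℕ) (hm : 1 ≤ m) (hnk : 2 * (k + 1) * 2 ^ (k + 1) + 1 ≤ N + 1)
    (F : MvPolynomial (Fin (N + 1)) ℤ) (hF : F.IsHomogeneous (k + 2)) (hs : SmoothF F)
    (Ω : (p : ℕ) → Set (Fin (N + 1) → ZMod (p ^ m)))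
    (hΩ : ∀ p : ℕ, p.Prime → (Ω p).Nonempty ∧ Ω p ⊆ Xhat N F p m)
    (ω : ℕ → ℝ)
    (hω : ∀ p : ℕ, p.Prime →
      ω p = 1 - (Nat.card (Ω p) : ℝ) / (Nat.card (Xhat N F p m) : ℝ)) :
    ∃ (C η : ℝ) (A D : ℕ), 1 ≤ C ∧ 0 < η ∧ 1 ≤ A ∧ D ≠ 0 ∧
      (∀ p : ℕ, p.Prime → 0 ≤ ω p / (1 - ω p)) ∧ ∀ P Q : ℕ, 1 ≤ P → 1 ≤ Q →
      ∀ T0 : Finset ((Fin (N + 1) → ℤ) × (Fin (N + 1) → ℤ)), T0 ⊆ TT F P →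
      (∀ t ∈ T0, ∀ p : ℕ, p.Prime → (fun i => (((t.1 + t.2) i : ℤ) : ZMod (p ^ m))) ∈ Ω p) →
      1 ≤ ∑ q ∈ adm D Q, ∏ p ∈ q.primeFactors, ω p / (1 - ω p) ∧
      (T0.card : ℝ) ≤ C * (((2 * P + 1 : ℕ) : ℝ) ^ (2 * (N + 1)) / ((2 * P + 1 : ℕ) : ℝ) ^ (k + 2)) *
        (1 / (∑ q ∈ adm D Q, ∏ p ∈ q.primeFactors, ω p / (1 - ω p)) +
          (Q : ℝ) ^ A * ((2 * P + 1 : ℕ) : ℝ) ^ (-η)) := by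
  obtain ⟨D, hD0, hD⟩ := good_primes (k + 2) (by omega) F hF hs
  obtain ⟨C, η, A, hC, hη, hb, he⟩ := equidist (by omega) k hnk F hF hs
  set h : ℕ → ℝ := fun p => ω p / (1 - ω p) with hh
  set X : ℕ → Finset (Fin (N + 1) → ℤ) := fun p => rep (p ^ m) (Xhat N F p m) with hX
  set Y : ℕ → Finset (Fin (N + 1) → ℤ) := fun p => rep (p ^ m) (Ω p) with hY
  have hYX : ∀ p, p.Prime → Y p ⊆ X p := fun p hp => rep_mono (hΩ p hp).2
  have hYne : ∀ p, p.Prime → (Y p).Nonempty := by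
    intro p hp
    have hpm : 1 ≤ p ^ m := Nat.one_le_pow _ _ hp.pos
    have : NeZero (p ^ m) := ⟨by omega⟩
    rw [← Finset.card_pos, hY]
    simp only
    rw [card_rep _ hpm]
    have h1 := (hΩ p hp).1.to_subtype
    exact Nat.card_pos
  have facts : ∀ p : ℕ, p.Prime → _ := fun p hp => fS_facts (Y p) (X p) (hYne p hp) (hYX p hp) (h p) (ω p)
    (by
      have hpm : 1 ≤ p ^ m := Nat.one_le_pow _ _ hp.pos
      rw [hω p hp, hY, hX]
      simp only
      rw [card_rep _ hpm, card_rep _ hpm]) rfl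
  have hXc : ∀ p, p.Prime → ((X p).card : ℝ) ≤ ((p ^ m : ℕ) : ℝ) ^ (N + 1) := by
    intro p hp
    have : (X p).card ≤ (p ^ m) ^ (N + 1) := by
      rw [← card_rs (N + 1) (p ^ m)]
      exact Finset.card_filter_le _ _
    exact_mod_cast this
  refine ⟨4 * C, η, 2 * m * A + 6 * m * (N + 1) + 2, D, by linarith, hη, by omega, hD0,
    fun p hp => (facts p hp).1, fun P Q hP hQ T0 hT0 hT0Ω => ?_⟩
  set L : ℝ := ((2 * P + 1 : ℕ) : ℝ) with hL
  have hL0 : 0 < L := by rw [hL]; positivity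
  set V : ℝ := L ^ (2 * (N + 1)) / L ^ (k + 2) with hV
  have hV0 : 0 < V := by positivity
  have hLη : 0 < L ^ (-η) := Real.rpow_pos_of_pos hL0 _
  set K : Finset (Finset ℕ) := (adm D Q).image Nat.primeFactors with hK
  have hKp : ∀ S ∈ K, ∀ p ∈ S, p.Prime ∧ ¬ p ∣ D := by
    intro S hS p hp
    obtain ⟨q, hq, rfl⟩ := Finset.mem_image.mp hS
    exact ⟨Nat.prime_of_mem_primeFactors hp, (Finset.mem_filter.mp hq).2.2 p hp⟩
  have hKG : ∑ S ∈ K, ∏ p ∈ S, h p = ∑ q ∈ adm D Q, ∏ p ∈ q.primeFactors, h p := by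
    rw [hK, Finset.sum_image]
    intro q hq q' hq' hqq
    rw [← Nat.prod_primeFactors_of_squarefree (Finset.mem_filter.mp hq).2.1,
      ← Nat.prod_primeFactors_of_squarefree (Finset.mem_filter.mp hq').2.1, hqq]
  have hK0 : ∅ ∈ K := by
    refine Finset.mem_image.mpr ⟨1, Finset.mem_filter.mpr ⟨?_, squarefree_one, by simp⟩, by simp⟩
    exact Finset.mem_range.mpr (by omega)
  have hKc : (K.card : ℝ) ^ 2 ≤ 4 * (Q : ℝ) ^ 2 := by
    have h1 : K.card ≤ 2 * Q := by
      refine Finset.card_image_le.trans ((Finset.card_filter_le _ _).trans ?_)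
      rw [Finset.card_range]; omega
    have h2 : (K.card : ℝ) ≤ 2 * Q := by exact_mod_cast h1
    calc (K.card : ℝ) ^ 2 ≤ (2 * Q) ^ 2 := by gcongr
      _ = _ := by ring
  set E : ℝ := C * (Q : ℝ) ^ (2 * m * A) * V * L ^ (-η) * (Q : ℝ) ^ (6 * m * (N + 1)) with hE
  have hE0 : 0 ≤ E := by positivity
  have hcorr : ∀ S ∈ K, ∀ S' ∈ K,
      ∑ t ∈ TT F P, (∏ p ∈ S, fS (Y p) (X p) (h p) (red (p ^ m) (t.1 + t.2))) *
        ∏ p ∈ S', fS (Y p) (X p) (h p) (red (p ^ m) (t.1 + t.2)) ≤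
      (if S = S' then (TT F P).card * ∏ p ∈ S, h p else 0) + E := by
    intro S hS S' hS'
    have hUp : ∀ p ∈ S ∪ S', p.Prime ∧ ¬ p ∣ D := by
      intro p hp
      rcases Finset.mem_union.mp hp with h1 | h1
      · exact hKp S hS p h1
      · exact hKp S' hS' p h1
    set M : ℕ := ∏ p ∈ S ∪ S', p ^ m with hM
    have hM1 : 1 ≤ M := Finset.prod_pos fun p hp => pow_pos (hUp p hp).1.pos _
    have hMQ : (M : ℝ) ≤ (Q : ℝ) ^ (2 * m) := by
      have : M ≤ Q ^ (2 * m) := by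
        obtain ⟨q, hq, rfl⟩ := Finset.mem_image.mp hS
        obtain ⟨q', hq', rfl⟩ := Finset.mem_image.mp hS'
        rw [hM, Finset.prod_pow, pow_mul]
        refine Nat.pow_le_pow_left (union_prod_le Q q q' (Finset.mem_filter.mp hq).2.1
          (Finset.mem_filter.mp hq').2.1 ?_ ?_) m
        · exact Nat.lt_succ_iff.mp (Finset.mem_range.mp (Finset.mem_filter.mp hq).1)
        · exact Nat.lt_succ_iff.mp (Finset.mem_range.mp (Finset.mem_filter.mp hq').1)
      exact_mod_cast this
    have h1 := corr_err m hm F D hD P (fun M => C * (M : ℝ) ^ A * V * L ^ (-η))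
      (fun M hM a a' => he P M hP hM a a') (S ∪ S') hUp
    have h2 := sieve_corr (TT F P) (fun p t => red (p ^ m) (t.1 + t.2)) X
      (fun p b => fS (Y p) (X p) (h p) b) h (fun p => ((p ^ m : ℕ) : ℝ) ^ (N + 1)) S S' (S ∪ S') rfl
      (C * (M : ℝ) ^ A * V * L ^ (-η)) (by positivity)
      (fun p hp => (hYne p (hUp p hp).1).mono (hYX p (hUp p hp).1))
      (fun p hp b hb => by
        have : b ∉ Y p := fun h => hb (hYX p (hUp p hp).1 h)
        simp [fS, hb, this])
      (fun p hp => (facts p (hUp p hp).1).2.2.1)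
      (fun p hp => (facts p (hUp p hp).1).2.2.2.1)
      (fun p hp => one_le_pow₀ (by exact_mod_cast Nat.one_le_pow _ _ (hUp p hp).1.pos))
      (fun p hp b => ((facts p (hUp p hp).1).2.2.2.2 b).trans (hXc p (hUp p hp).1))
      (fun p hp => hXc p (hUp p hp).1)
      (fun p hp => (facts p (hUp p hp).1).1) h1
    refine h2.trans (add_le_add le_rfl ?_)
    rw [Finset.prod_pow, ← Nat.cast_prod, ← hM, hE]
    have e1 : (M : ℝ) ^ A ≤ (Q : ℝ) ^ (2 * m * A) := by
      rw [pow_mul]; gcongr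
    have e2 : ((M : ℝ) ^ (N + 1)) ^ 3 ≤ (Q : ℝ) ^ (6 * m * (N + 1)) := by
      calc ((M : ℝ) ^ (N + 1)) ^ 3 ≤ (((Q : ℝ) ^ (2 * m)) ^ (N + 1)) ^ 3 := by gcongr
        _ = _ := by rw [← pow_mul, ← pow_mul]; congr 1; ring
    gcongr
  have hmain := sieve_main (TT F P) T0 hT0 K
    (fun p t => fS (Y p) (X p) (h p) (red (p ^ m) (t.1 + t.2))) h E hE0
    (fun S hS p hp => (facts p (hKp S hS p hp).1).1) hK0
    (fun S hS p hp t ht => by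
      have hpp := (hKp S hS p hp).1
      have : red (p ^ m) (t.1 + t.2) ∈ Y p :=
        (red_mem_rep (Nat.one_le_pow _ _ hpp.pos)).mpr (hT0Ω t ht p hpp)
      simp [fS, this])
    (fun S hS S' hS' hne => by simpa [hne] using hcorr S hS S' hS')
    (fun S hS => by simpa using hcorr S hS S hS)
  rw [hKG] at hmain
  obtain ⟨hG1, hm2⟩ := hmain
  refine ⟨hG1, hm2.trans ?_⟩
  have hT : ((TT F P).card : ℝ) ≤ C * V := by
    have := ra_card F P 1 0 (fun _ => True) (fun t _ => by simp [cg])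
    rw [Finset.filter_true] at this
    rw [this]
    exact hb P hP 0
  set G := ∑ q ∈ adm D Q, ∏ p ∈ q.primeFactors, h p with hGd
  have hG0 : 0 < G := by linarith
  have e1 : ((TT F P).card : ℝ) / G ≤ 4 * C * V * (1 / G) := by
    rw [mul_one_div]
    gcongr
    nlinarith
  have e2 : (K.card : ℝ) ^ 2 * E ≤ 4 * C * V * ((Q : ℝ) ^ (2 * m * A + 6 * m * (N + 1) + 2) * L ^ (-η)) := by
    calc (K.card : ℝ) ^ 2 * E ≤ 4 * (Q : ℝ) ^ 2 * E := by gcongr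
      _ = _ := by rw [hE, pow_add, pow_add]; ring
  rw [mul_add]
  exact add_le_add e1 e2

end sieve4

section final1

lemma G_compare (h : ℕ → ℝ) (hh : ∀ p : ℕ, p.Prime → 0 ≤ h p) (D : ℕ) (hD : D ≠ 0) (Q : ℕ) :
    ∑ q ∈ (Finset.range (Q + 1)).filter Squarefree, ∏ p ∈ q.primeFactors, h p ≤
      (∑ e ∈ D.divisors, ∏ p ∈ e.primeFactors, h p) *
        ∑ q ∈ adm D Q, ∏ p ∈ q.primeFactors, h p := by
  have hnn : ∀ q : ℕ, 0 ≤ ∏ p ∈ q.primeFactors, h p := fun q =>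
    Finset.prod_nonneg fun p hp => hh p (Nat.prime_of_mem_primeFactors hp)
  rw [Finset.sum_mul_sum, ← Finset.sum_product']
  set W := (Finset.range (Q + 1)).filter Squarefree with hW
  set ψ : ℕ → ℕ × ℕ := fun q => (Nat.gcd q D, q / Nat.gcd q D) with hψ
  have hinv : ∀ q : ℕ, Nat.gcd q D * (q / Nat.gcd q D) = q := fun q =>
    Nat.mul_div_cancel' (Nat.gcd_dvd_left q D)
  have hinj : Set.InjOn ψ W := by
    intro q _ q' _ hqq
    have h1 : Nat.gcd q D = Nat.gcd q' D := congrArg Prod.fst hqq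
    have h2 : q / Nat.gcd q D = q' / Nat.gcd q' D := congrArg Prod.snd hqq
    rw [← hinv q, ← hinv q', h2, h1]
  have hval : ∀ q ∈ W, ∏ p ∈ q.primeFactors, h p =
      (∏ p ∈ (ψ q).1.primeFactors, h p) * ∏ p ∈ (ψ q).2.primeFactors, h p := by
    intro q hq
    have hsq : Squarefree (Nat.gcd q D * (q / Nat.gcd q D)) := by
      rw [hinv]; exact (Finset.mem_filter.mp hq).2
    have hcop := (Nat.squarefree_mul_iff.mp hsq).1
    simp only [hψ]
    rw [← Finset.prod_union hcop.disjoint_primeFactors, ← hcop.primeFactors_mul, hinv]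
  calc ∑ q ∈ W, ∏ p ∈ q.primeFactors, h p
      = ∑ q ∈ W, (fun x : ℕ × ℕ => (∏ p ∈ x.1.primeFactors, h p) * ∏ p ∈ x.2.primeFactors, h p) (ψ q) :=
        Finset.sum_congr rfl hval
    _ = ∑ x ∈ W.image ψ, (∏ p ∈ x.1.primeFactors, h p) * ∏ p ∈ x.2.primeFactors, h p :=
        (Finset.sum_image (f := fun x : ℕ × ℕ => (∏ p ∈ x.1.primeFactors, h p) *
          ∏ p ∈ x.2.primeFactors, h p) hinj).symm
    _ ≤ _ := by
        refine Finset.sum_le_sum_of_subset_of_nonneg ?_ fun x _ _ => mul_nonneg (hnn _) (hnn _)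
        intro x hx
        obtain ⟨q, hq, rfl⟩ := Finset.mem_image.mp hx
        have hq0 := Finset.mem_range.mp (Finset.mem_filter.mp hq).1
        have hqs := (Finset.mem_filter.mp hq).2
        have hsq : Squarefree (Nat.gcd q D * (q / Nat.gcd q D)) := by rw [hinv]; exact hqs
        have hcop := Nat.squarefree_mul_iff.mp hsq
        refine Finset.mem_product.mpr ⟨Nat.mem_divisors.mpr ⟨Nat.gcd_dvd_right _ _, hD⟩, ?_⟩
        refine Finset.mem_filter.mpr ⟨Finset.mem_range.mpr ?_, hcop.2.2, ?_⟩
        · exact lt_of_le_of_lt (Nat.div_le_self _ _) hq0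
        · intro p hp hpD
          have hpp := Nat.prime_of_mem_primeFactors hp
          have hpr : p ∣ q / Nat.gcd q D := Nat.dvd_of_mem_primeFactors hp
          have hpq : p ∣ q := hpr.trans (Nat.div_dvd_of_dvd (Nat.gcd_dvd_left q D))
          exact Nat.not_coprime_of_dvd_of_dvd hpp.one_lt (Nat.dvd_gcd hpq hpD) hpr hcop.1

lemma fiber_card {n : ℕ} (F : MvPolynomial (Fin n) ℤ) (P : ℕ) (x : Fin n → ℤ) (hx : x ∈ Bx n P)
    (hF : eval x F = 0) :
    P ^ n ≤ ((TT F P).filter (fun t => t.1 + t.2 = x)).card := by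
  rw [← card_rs n P]
  refine Finset.card_le_card_of_injOn
    (fun w => ((fun i => if 0 ≤ x i then w i else -w i), (fun i => x i - if 0 ≤ x i then w i else -w i))) ?_ ?_
  · intro w hw
    have hw := mem_rs.1 hw
    have hx := mem_Bx.1 hx
    have e : ((fun i => if 0 ≤ x i then w i else -w i) +
        (fun i => x i - if 0 ≤ x i then w i else -w i) : Fin n → ℤ) = x := by
      funext i; simp
    refine Finset.mem_coe.mpr (Finset.mem_filter.mpr ⟨Finset.mem_filter.mpr ⟨?_, ?_⟩, e⟩)
    · refine Finset.mem_product.mpr ⟨mem_Bx.2 fun i => ?_, mem_Bx.2 fun i => ?_⟩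
      · have := hw i
        have := hx i
        simp only
        split_ifs <;> constructor <;> omega
      · have := hw i
        have := hx i
        simp only
        split_ifs <;> constructor <;> omega
    · simp only
      rw [e]; exact hF
  · intro w _ w' _ hww
    have h1 := congrArg Prod.fst hww
    simp only at h1
    funext i
    have := congrFun h1 i
    split_ifs at this <;> omega

lemma count_le {n : ℕ} (F : MvPolynomial (Fin n) ℤ) (P : ℕ) (S : Finset (Fin n → ℤ))
    (hS : ∀ x ∈ S, x ∈ Bx n P ∧ eval x F = 0) :
    S.card * P ^ n ≤ ((TT F P).filter (fun t => t.1 + t.2 ∈ S)).card := by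
  have h0 : Set.MapsTo (fun t : (Fin n → ℤ) × (Fin n → ℤ) => t.1 + t.2)
      ((TT F P).filter (fun t => t.1 + t.2 ∈ S)) S :=
    fun t ht => Finset.mem_coe.mpr (Finset.mem_filter.mp ht).2
  rw [Finset.card_eq_sum_card_fiberwise h0]
  rw [← smul_eq_mul]
  refine Finset.card_nsmul_le_sum _ _ _ fun x hx => ?_
  refine (fiber_card F P x (hS x hx).1 (hS x hx).2).trans (Finset.card_le_card ?_)
  intro t ht
  obtain ⟨h1, h2⟩ := Finset.mem_filter.mp ht
  exact Finset.mem_filter.mpr ⟨Finset.mem_filter.mpr ⟨h1, h2 ▸ hx⟩, h2⟩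

end final1

theorem stmt10 (N d m : ℕ) (hN : 2 ≤ N) (hd : 2 ≤ d) (hm : 1 ≤ m)
    (hNd : 2 ^ d * (d - 1) < N)
    (F : MvPolynomial (Fin (N + 1)) ℤ) (hF : F.IsHomogeneous d)
    (hsmooth : ∀ z : Fin (N + 1) → ℂ, z ≠ 0 →
      eval z (MvPolynomial.map (Int.castRingHom ℂ) F) = 0 →
      ∃ i, eval z (pderiv i (MvPolynomial.map (Int.castRingHom ℂ) F)) ≠ 0)
    (Ω : (p : ℕ) → Set (Fin (N + 1) → ZMod (p ^ m)))
    (hΩ : ∀ p : ℕ, p.Prime → (Ω p).Nonempty ∧ Ω p ⊆ Xhat N F p m)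
    (ω : ℕ → ℝ)
    (hω : ∀ p : ℕ, p.Prime →
      ω p = 1 - (Nat.card (Ω p) : ℝ) / (Nat.card (Xhat N F p m) : ℝ))
    (G : ℝ → ℝ)
    (hG : ∀ Q : ℝ, G Q = ∑ q ∈ (Finset.range (⌊Q⌋₊ + 1)).filter Squarefree,
      ∏ p ∈ q.primeFactors, ω p / (1 - ω p)) :
    ∃ δ₁ δ₂ C : ℝ, 0 < δ₁ ∧ 0 < δ₂ ∧ 0 < C ∧ ∀ B : ℝ, 2 ≤ B →
      (Nat.card {x : Fin (N + 1) → ℤ | IsPrimitiveVec x ∧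
        eval x F = 0 ∧
        ((supNorm x : ℝ)) ^ (N + 1 - d) ≤ B ∧
        ∀ p : ℕ, p.Prime → (fun i => ((x i : ZMod (p ^ m)))) ∈ Ω p} : ℝ)
      ≤ C * B / min (G (B ^ δ₁)) (B ^ δ₂) := by
  obtain ⟨k, rfl⟩ : ∃ k, d = k + 2 := ⟨d - 2, by omega⟩
  have hnk : 2 * (k + 1) * 2 ^ (k + 1) + 1 ≤ N + 1 := by
    have h1 : 2 ^ (k + 2) * (k + 2 - 1) = 2 * (k + 1) * 2 ^ (k + 1) := by
      rw [show k + 2 - 1 = k + 1 by omega, pow_succ 2 (k + 1)]; ring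
    omega
  have hNk : k + 2 < N + 1 := by
    have h1 : 1 ≤ 2 ^ (k + 1) := Nat.one_le_two_pow
    have : 2 * (k + 1) * 1 ≤ 2 * (k + 1) * 2 ^ (k + 1) := Nat.mul_le_mul_left _ h1
    omega
  obtain ⟨C, η, A, D, hC, hη, hA, hD, hh, hmain⟩ :=
    sieve_bound N k m hm hnk F hF hsmooth Ω hΩ ω hω
  set h : ℕ → ℝ := fun p => ω p / (1 - ω p) with hhd
  set e : ℕ := N + 1 - (k + 2) with he
  have he1 : 1 ≤ e := by omega
  have her : (0 : ℝ) < e := by exact_mod_cast he1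
  have hAr : (0 : ℝ) < A := by exact_mod_cast hA
  set K0 : ℝ := ∑ e ∈ D.divisors, ∏ p ∈ e.primeFactors, h p with hK0
  have hK0n : 0 ≤ K0 := Finset.sum_nonneg fun q _ =>
    Finset.prod_nonneg fun p hp => hh p (Nat.prime_of_mem_primeFactors hp)
  refine ⟨η / (2 * e * A), η / (2 * e), C * 3 ^ (2 * (N + 1)) * (K0 + 1), by positivity,
    by positivity, by positivity, fun B hB => ?_⟩
  set δ₁ : ℝ := η / (2 * e * A) with hδ₁
  set δ₂ : ℝ := η / (2 * e) with hδ₂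
  have hδ₁0 : 0 < δ₁ := by positivity
  have hδ₂0 : 0 < δ₂ := by positivity
  have hB0 : 0 < B := by linarith
  have hB1 : 1 ≤ B := by linarith
  set P : ℕ := ⌊B ^ (1 / (e : ℝ))⌋₊ with hP
  set Q : ℕ := ⌊B ^ δ₁⌋₊ with hQ
  have hP1 : 1 ≤ P := Nat.le_floor (by
    rw [Nat.cast_one]; exact Real.one_le_rpow hB1 (by positivity))
  have hQ1 : 1 ≤ Q := Nat.le_floor (by
    rw [Nat.cast_one]; exact Real.one_le_rpow hB1 hδ₁0.le)
  have hPB : (P : ℝ) ^ e ≤ B := by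
    have h1 : (P : ℝ) ≤ B ^ (1 / (e : ℝ)) := Nat.floor_le (by positivity)
    calc (P : ℝ) ^ e ≤ (B ^ (1 / (e : ℝ))) ^ e := by gcongr
      _ = B := by
        rw [← Real.rpow_natCast, ← Real.rpow_mul hB0.le, one_div_mul_cancel her.ne', Real.rpow_one]
  set S : Finset (Fin (N + 1) → ℤ) := (Bx (N + 1) P).filter (fun x => eval x F = 0 ∧
    ∀ p : ℕ, p.Prime → (fun i => ((x i : ZMod (p ^ m)))) ∈ Ω p) with hS
  have hcard : (Nat.card {x : Fin (N + 1) → ℤ | IsPrimitiveVec x ∧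
        eval x F = 0 ∧
        ((supNorm x : ℝ)) ^ e ≤ B ∧
        ∀ p : ℕ, p.Prime → (fun i => ((x i : ZMod (p ^ m)))) ∈ Ω p} : ℝ) ≤ S.card := by
    rw [Nat.card_coe_set_eq, ← Set.ncard_coe_finset, Nat.cast_le]
    refine Set.ncard_le_ncard ?_ (Finset.finite_toSet _)
    rintro x ⟨-, h1, h2, h3⟩
    refine Finset.mem_coe.mpr (Finset.mem_filter.mpr ⟨mem_Bx.2 fun i => ?_, h1, h3⟩)
    have h4 : (supNorm x : ℝ) ≤ B ^ (1 / (e : ℝ)) := by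
      have : (supNorm x : ℝ) = ((supNorm x : ℝ) ^ e) ^ (1 / (e : ℝ)) := by
        rw [← Real.rpow_natCast, ← Real.rpow_mul (by positivity), mul_one_div_cancel her.ne',
          Real.rpow_one]
      rw [this]
      exact Real.rpow_le_rpow (by positivity) h2 (by positivity)
    have h5 : supNorm x ≤ P := Nat.le_floor h4
    have h6 : (x i).natAbs ≤ supNorm x :=
      Finset.le_sup (f := fun i => (x i).natAbs) (Finset.mem_univ i)
    constructor <;> omega
  have hcl := count_le F P S (fun x hx =>
    ⟨(Finset.mem_filter.mp hx).1, (Finset.mem_filter.mp hx).2.1⟩)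
  obtain ⟨hG1, hT⟩ := hmain P Q hP1 hQ1 ((TT F P).filter (fun t => t.1 + t.2 ∈ S))
    (Finset.filter_subset _ _) (fun t ht p hp =>
      (Finset.mem_filter.mp (Finset.mem_filter.mp ht).2).2.2 p hp)
  have hGc := G_compare h hh D hD Q
  rw [← hK0, ← hG (B ^ δ₁)] at hGc
  set GD : ℝ := ∑ q ∈ adm D Q, ∏ p ∈ q.primeFactors, h p with hGD
  set L : ℝ := ((2 * P + 1 : ℕ) : ℝ) with hL
  have hPr : (1 : ℝ) ≤ P := by exact_mod_cast hP1
  have hLP : L ≤ 3 * P := by rw [hL]; push_cast; linarith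
  have hL0 : 0 < L := by rw [hL]; positivity
  have hLB : B ^ (1 / (e : ℝ)) ≤ L := by
    have := (Nat.lt_floor_add_one (B ^ (1 / (e : ℝ)))).le
    rw [← hP] at this
    rw [hL]; push_cast; linarith
  have hLη : L ^ (-η) ≤ B ^ (-(2 * δ₂)) := by
    calc L ^ (-η) ≤ (B ^ (1 / (e : ℝ))) ^ (-η) :=
          Real.rpow_le_rpow_of_nonpos (by positivity) hLB (by linarith)
      _ = B ^ (-(2 * δ₂)) := by
          rw [← Real.rpow_mul hB0.le]; congr 1; rw [hδ₂]; field_simp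
  have hQA : (Q : ℝ) ^ A ≤ B ^ δ₂ := by
    have h1 : (Q : ℝ) ≤ B ^ δ₁ := Nat.floor_le (by positivity)
    calc (Q : ℝ) ^ A ≤ (B ^ δ₁) ^ A := by gcongr
      _ = B ^ δ₂ := by
        rw [← Real.rpow_natCast, ← Real.rpow_mul hB0.le]; congr 1; rw [hδ₁, hδ₂]; field_simp
  have hQL : (Q : ℝ) ^ A * L ^ (-η) ≤ 1 / B ^ δ₂ := by
    calc (Q : ℝ) ^ A * L ^ (-η) ≤ B ^ δ₂ * B ^ (-(2 * δ₂)) := by gcongr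
      _ = 1 / B ^ δ₂ := by
        rw [← Real.rpow_add hB0, one_div, ← Real.rpow_neg hB0.le]; congr 1; ring
  have hV : L ^ (2 * (N + 1)) / L ^ (k + 2) ≤ 3 ^ (2 * (N + 1)) * (P : ℝ) ^ e * (P : ℝ) ^ (N + 1) := by
    have h1 : 2 * (N + 1) = (e + (N + 1)) + (k + 2) := by omega
    have h2 : L ^ (2 * (N + 1)) / L ^ (k + 2) = L ^ (e + (N + 1)) := by
      rw [h1, pow_add L (e + (N + 1)), mul_div_assoc, div_self (by positivity), mul_one]
    rw [h2]
    calc L ^ (e + (N + 1)) ≤ (3 * P) ^ (e + (N + 1)) := by gcongr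
      _ = 3 ^ (e + (N + 1)) * (P : ℝ) ^ e * (P : ℝ) ^ (N + 1) := by rw [mul_pow, pow_add (P : ℝ)]; ring
      _ ≤ _ := by
        gcongr
        · norm_num
        · omega
  have hGpos : 0 < G (B ^ δ₁) := by
    have : (1 : ℝ) ≤ G (B ^ δ₁) := by
      rw [hG]
      have h1 := Finset.single_le_sum (f := fun q : ℕ => ∏ p ∈ q.primeFactors, ω p / (1 - ω p))
        (s := (Finset.range (⌊B ^ δ₁⌋₊ + 1)).filter Squarefree) (a := 1)
        (fun q _ => Finset.prod_nonneg fun p hp => hh p (Nat.prime_of_mem_primeFactors hp))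
        (Finset.mem_filter.mpr ⟨Finset.mem_range.mpr (by omega), squarefree_one⟩)
      refine le_trans (le_of_eq ?_) h1
      simp
    linarith
  have hGD0 : 0 < GD := by linarith
  set μ := min (G (B ^ δ₁)) (B ^ δ₂) with hμ
  have hμ0 : 0 < μ := lt_min hGpos (by positivity)
  have h1G : 1 / GD ≤ K0 / μ := by
    rw [div_le_div_iff₀ hGD0 hμ0, one_mul]
    exact (min_le_left _ _).trans hGc
  have h1B : 1 / B ^ δ₂ ≤ 1 / μ := one_div_le_one_div_of_le hμ0 (min_le_right _ _)
  have hpn : (0 : ℝ) < (P : ℝ) ^ (N + 1) := by positivity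
  have hfin : (S.card : ℝ) * (P : ℝ) ^ (N + 1) ≤
      (C * 3 ^ (2 * (N + 1)) * (K0 + 1) * B / μ) * (P : ℝ) ^ (N + 1) := by
    have hc2 : (S.card : ℝ) * (P : ℝ) ^ (N + 1) ≤
        (((TT F P).filter (fun t => t.1 + t.2 ∈ S)).card : ℝ) := by exact_mod_cast hcl
    refine hc2.trans (hT.trans ?_)
    calc C * (L ^ (2 * (N + 1)) / L ^ (k + 2)) * (1 / GD + (Q : ℝ) ^ A * L ^ (-η))
        ≤ C * (3 ^ (2 * (N + 1)) * B * (P : ℝ) ^ (N + 1)) * (K0 / μ + 1 / μ) := by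
          have h7 : L ^ (2 * (N + 1)) / L ^ (k + 2) ≤ 3 ^ (2 * (N + 1)) * B * (P : ℝ) ^ (N + 1) :=
            hV.trans (by gcongr)
          have h8 : 1 / GD + (Q : ℝ) ^ A * L ^ (-η) ≤ K0 / μ + 1 / μ :=
            add_le_add h1G (hQL.trans h1B)
          have h9 : 0 ≤ 1 / GD + (Q : ℝ) ^ A * L ^ (-η) := by positivity
          exact mul_le_mul (mul_le_mul_of_nonneg_left h7 (by linarith)) h8 h9 (by positivity)
      _ = _ := by field_simp
  exact hcard.trans (le_of_mul_le_mul_right hfin hpn)
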